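/- arXiv:1510.03903 — 3 statements merged into one kernel-verified Lean document; each statement's English description precedes it below -/
import Mathlib

section
/- Given k agents with additive nonatomic probability value measures on [0,1] and positive entitlements w_1,...,w_k summing to 1, there exists an allocation X_1,...,X_k such that agent j values X_j at least w_j, and the total number of connected components of the allocation is at most ceil(log2 k) * (2k-2) + 1. -/
open MeasureTheory Set

/-- A set is a union of `m` intervals. -/
def IsUnionOfIntervals (S : Set ℝ) (m : ℕ) : Prop :=
  ∃ I : Fin m → Set ℝ, (∀ i, (I i).OrdConnected) ∧ S = ⋃ i, I i

def DivP {ι : Type} [Fintype ι] (V : ι → Measure ℝ) (w : ι → ℝ) (a b : ℝ) (N : ℕ) : Prop :=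
  ∃ (X : ι → Set ℝ) (m : ι → ℕ),
    (∀ j, IsUnionOfIntervals (X j) (m j)) ∧ (∀ j, MeasurableSet (X j)) ∧
    Pairwise (Function.onFun Disjoint X) ∧ (⋃ j, X j) = Ioc a b ∧
    (∀ j, w j ≤ (V j).real (X j)) ∧ ∑ j, m j ≤ N

lemma isUnion_union {S T : Set ℝ} {m n : ℕ} (hS : IsUnionOfIntervals S m)
    (hT : IsUnionOfIntervals T n) : IsUnionOfIntervals (S ∪ T) (m + n) := by
  obtain ⟨I, hI, rfl⟩ := hS
  obtain ⟨J, hJ, rfl⟩ := hT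
  refine ⟨Fin.append I J, ?_, ?_⟩
  · intro i
    refine Fin.addCases (fun i => ?_) (fun i => ?_) i
    · rw [Fin.append_left]; exact hI i
    · rw [Fin.append_right]; exact hJ i
  · ext x
    simp only [mem_union, mem_iUnion]
    constructor
    · rintro (⟨i, hi⟩ | ⟨i, hi⟩)
      · exact ⟨Fin.castAdd n i, by rwa [Fin.append_left]⟩
      · exact ⟨Fin.natAdd m i, by rwa [Fin.append_right]⟩
    · rintro ⟨i, hi⟩
      revert hi
      refine Fin.addCases (fun i => ?_) (fun i => ?_) i
      · rw [Fin.append_left]; exact fun h => Or.inl ⟨i, h⟩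
      · rw [Fin.append_right]; exact fun h => Or.inr ⟨i, h⟩

lemma DivP.mono {ι : Type} [Fintype ι] {V : ι → Measure ℝ} {w w' : ι → ℝ} {a b : ℝ} {N N' : ℕ}
    (h : DivP V w a b N) (hw : ∀ j, w' j ≤ w j) (hN : N ≤ N') : DivP V w' a b N' := by
  obtain ⟨X, m, h1, h2, h3, h4, h5, h6⟩ := h
  exact ⟨X, m, h1, h2, h3, h4, fun j => (hw j).trans (h5 j), h6.trans hN⟩

lemma DivP.add {ι : Type} [Fintype ι] {V : ι → Measure ℝ} [∀ j, IsFiniteMeasure (V j)]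
    {w w' : ι → ℝ} {a x b : ℝ} {N N' : ℕ} (hax : a ≤ x) (hxb : x ≤ b)
    (h : DivP V w a x N) (h' : DivP V w' x b N') : DivP V (w + w') a b (N + N') := by
  obtain ⟨X, m, h1, h2, h3, h4, h5, h6⟩ := h
  obtain ⟨Y, n, g1, g2, g3, g4, g5, g6⟩ := h'
  have hd : ∀ i j, Disjoint (X i) (Y j) := by
    intro i j
    have hX : X i ⊆ Ioc a x := h4 ▸ subset_iUnion X i
    have hY : Y j ⊆ Ioc x b := g4 ▸ subset_iUnion Y j
    exact Disjoint.mono hX hY (Set.Ioc_disjoint_Ioc_of_le le_rfl)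
  refine ⟨fun j => X j ∪ Y j, fun j => m j + n j, fun j => isUnion_union (h1 j) (g1 j),
    fun j => (h2 j).union (g2 j), ?_, ?_, ?_, ?_⟩
  · intro i j hij
    simp only [Function.onFun, disjoint_union_left, disjoint_union_right]
    exact ⟨⟨h3 hij, (hd _ _).symm⟩, ⟨hd _ _, g3 hij⟩⟩
  · rw [iUnion_union_distrib, h4, g4, Ioc_union_Ioc_eq_Ioc hax hxb]
  · intro j
    rw [measureReal_union (hd j j) (g2 j)]
    exact add_le_add (h5 j) (g5 j)
  · rw [Finset.sum_add_distrib]; omega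

lemma DivP.single {ι : Type} [Fintype ι] [DecidableEq ι] {V : ι → Measure ℝ} (i : ι) {c a b : ℝ}
    (h : c ≤ (V i).real (Ioc a b)) : DivP V (Pi.single i c) a b 1 := by
  refine ⟨fun j => if j = i then Ioc a b else ∅, fun j => if j = i then 1 else 0, ?_, ?_, ?_, ?_,
    ?_, ?_⟩
  · intro j
    by_cases hj : j = i
    · have : IsUnionOfIntervals (Ioc a b) 1 :=
        ⟨fun _ => Ioc a b, fun _ => ordConnected_Ioc, (iUnion_const _).symm⟩
      simpa only [hj, if_true] using this
    · simp only [hj, if_false]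
      exact ⟨fun _ => ∅, fun _ => ordConnected_empty, by simp⟩
  · intro j
    by_cases hj : j = i <;> simp [hj]
  · intro j k hjk
    by_cases hj : j = i
    · have : k ≠ i := fun h => hjk (hj.trans h.symm)
      simp [Function.onFun, this]
    · simp [Function.onFun, hj]
  · ext x; simp
  · intro j
    by_cases hj : j = i
    · subst hj; simpa using h
    · simp [hj]
  · simp

lemma exists_cdf (μ : Measure ℝ) [IsFiniteMeasure μ] [NullSingletonClass μ] :
    ∃ F : ℝ → ℝ, Continuous F ∧ ∀ x y, x ≤ y → μ.real (Ioc x y) = F y - F x := by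
  have hi : ∀ x y, IntervalIntegrable (fun _ => (1:ℝ)) μ x y := fun x y =>
    intervalIntegrable_const
  refine ⟨fun x => ∫ _ in (0:ℝ)..x, (1:ℝ) ∂μ, ?_, ?_⟩
  · exact intervalIntegral.continuous_primitive hi 0
  · intro x y hxy
    rw [intervalIntegral.integral_interval_sub_left (hi _ _) (hi _ _),
      intervalIntegral.integral_of_le hxy]
    simp

section
variable {ι : Type} [Fintype ι] [DecidableEq ι] {V : ι → Measure ℝ} [∀ j, IsFiniteMeasure (V j)]

lemma pair_div {F : ι → ℝ → ℝ} (hF : ∀ j, Continuous (F j))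
    (hV : ∀ j x y, x ≤ y → (V j).real (Ioc x y) = F j y - F j x)
    {i k : ι} {p q a b : ℝ} (hp : 0 < p) (hq : 0 < q) (hab : a ≤ b)
    (h1 : p + q ≤ F i b - F i a) (h2 : p + q ≤ F k b - F k a) :
    DivP V (Pi.single i p + Pi.single k q) a b 3 := by
  set A := F i b - F i a with hA
  set B := F k b - F k a with hB
  have hA0 : 0 < A := by linarith
  obtain ⟨u, ⟨hau, hub⟩, hu⟩ := (isCompact_Icc (a := a) (b := b)).exists_isMaxOn
    (nonempty_Icc.2 hab) (f := fun x => F k x * A - F i x * B)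
    (((hF k).mul continuous_const).sub ((hF i).mul continuous_const)).continuousOn
  obtain ⟨r, s, hrs, hrp, hsq⟩ : ∃ r s : ℝ, r + s = 1 ∧ (0 ≤ r ∧ r * (p + q) = p) ∧
      (0 ≤ s ∧ s * (p + q) = q) := by
    refine ⟨p / (p + q), q / (p + q), ?_, ⟨by positivity, ?_⟩, ⟨by positivity, ?_⟩⟩ <;> field_simp
  have hpA : p ≤ r * A := by
    rw [← hrp.2]; exact mul_le_mul_of_nonneg_left h1 hrp.1
  have hqB : q ≤ s * B := by
    rw [← hsq.2]; exact mul_le_mul_of_nonneg_left h2 hsq.1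
  have hs : s = 1 - r := by linarith
  have e0 := hV i a u hau
  have e1 : 0 ≤ (V i).real (Ioc a u) := measureReal_nonneg
  by_cases hc : F i u + r * A ≤ F i b
  · have hrA : 0 ≤ r * A := mul_nonneg hrp.1 hA0.le
    obtain ⟨v, ⟨huv, hvb⟩, hv⟩ := intermediate_value_Icc hub (hF i).continuousOn
      (show F i u + r * A ∈ Icc (F i u) (F i b) from ⟨by linarith, hc⟩)
    have hm : F k v * A - F i v * B ≤ F k u * A - F i u * B := hu ⟨hau.trans huv, hvb⟩
    have hG : F k v - F k u ≤ r * B := by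
      refine le_of_mul_le_mul_right ?_ hA0
      rw [hv] at hm
      linarith
    have d1 := DivP.single (V := V) k (hV k a u hau).ge
    have d2 := DivP.single (V := V) i (hV i u v huv).ge
    have d3 := DivP.single (V := V) k (hV k v b hvb).ge
    refine ((d1.add hau huv d2).add (hau.trans huv) hvb d3).mono ?_ le_rfl
    intro j
    have hx : Pi.single (M := fun _ : ι => ℝ) i p j ≤ Pi.single (M := fun _ : ι => ℝ) i (F i v - F i u) j :=
      Pi.single_mono i (by linarith) j
    have hy : Pi.single (M := fun _ : ι => ℝ) k q j ≤ Pi.single (M := fun _ : ι => ℝ) k ((F k u - F k a) + (F k b - F k v)) j :=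
      Pi.single_mono k (by rw [hs] at hqB; linarith) j
    rw [Pi.single_add] at hy
    simp only [Pi.add_apply] at hy ⊢
    linarith
  · have hsA : 0 ≤ s * A := mul_nonneg hsq.1 hA0.le
    obtain ⟨v, ⟨hav, hvu⟩, hv⟩ := intermediate_value_Icc hau (hF i).continuousOn
      (show F i u - s * A ∈ Icc (F i a) (F i u) from ⟨by rw [hs]; linarith, by linarith⟩)
    have hm : F k v * A - F i v * B ≤ F k u * A - F i u * B := hu ⟨hav, hvu.trans hub⟩
    have hG : s * B ≤ F k u - F k v := by
      refine le_of_mul_le_mul_right ?_ hA0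
      rw [hv] at hm
      linarith
    have d1 := DivP.single (V := V) i (hV i a v hav).ge
    have d2 := DivP.single (V := V) k (hV k v u hvu).ge
    have d3 := DivP.single (V := V) i (hV i u b hub).ge
    refine ((d1.add hav hvu d2).add (hav.trans hvu) hub d3).mono ?_ le_rfl
    intro j
    have hx : Pi.single (M := fun _ : ι => ℝ) k q j ≤ Pi.single (M := fun _ : ι => ℝ) k (F k u - F k v) j :=
      Pi.single_mono k (by linarith) j
    have hy : Pi.single (M := fun _ : ι => ℝ) i p j ≤ Pi.single (M := fun _ : ι => ℝ) i ((F i v - F i a) + (F i b - F i u)) j :=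
      Pi.single_mono i (by rw [hv, hs]; linarith) j
    rw [Pi.single_add] at hy
    simp only [Pi.add_apply] at hy ⊢
    linarith

lemma exists_cut {F : ι → ℝ → ℝ} (hF : ∀ j, Continuous (F j))
    {s : Finset ι} (hs : s.Nonempty) {w : ι → ℝ} {a b : ℝ} (hab : a ≤ b)
    (ha : ∀ j ∈ s, F j a - F j a ≤ w j) (hb : ∀ j ∈ s, w j ≤ F j b - F j a) :
    ∃ x ∈ Icc a b, ∃ i ∈ s, ∃ k ∈ s, ∃ t, F i x - F i a = t ∧ F k x - F k a = t ∧
      (∀ j ∈ s, F j x - F j a ≤ t) ∧ t ≤ w i ∧ w k ≤ t := by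
  let P : ι → Set ℝ := fun i => {x | (∀ j ∈ s, F j x - F j a ≤ F i x - F i a)}
  have hPc : ∀ i, IsClosed (P i) := by
    intro i
    simp only [P, ofPred_forall]
    refine isClosed_iInter fun j => isClosed_iInter fun _ => isClosed_le ?_ ?_
    · exact (hF j).sub continuous_const
    · exact (hF i).sub continuous_const
  have hPe : ∀ x, ∃ i ∈ s, x ∈ P i := fun x =>
    s.exists_max_image (fun j => F j x - F j a) hs
  have hQ : IsClosed (⋃ i ∈ s, P i ∩ {x | F i x - F i a ≤ w i}) :=
    s.finite_toSet.isClosed_biUnion fun i _ => (hPc i).inter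
      (isClosed_le ((hF i).sub continuous_const) continuous_const)
  have hR : IsClosed (⋃ i ∈ s, P i ∩ {x | w i ≤ F i x - F i a}) :=
    s.finite_toSet.isClosed_biUnion fun i _ => (hPc i).inter
      (isClosed_le continuous_const ((hF i).sub continuous_const))
  have := isPreconnected_closed_iff.1 (isPreconnected_Icc (a := a) (b := b)) _ _ hQ hR ?_ ?_ ?_
  · obtain ⟨x, hx, hx1, hx2⟩ := this
    simp only [mem_iUnion, mem_inter_iff, mem_ofPred_eq, exists_prop] at hx1 hx2
    obtain ⟨i, hi, hiP, hi'⟩ := hx1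
    obtain ⟨k, hk, hkP, hk'⟩ := hx2
    have e := le_antisymm (hiP k hk) (hkP i hi)
    exact ⟨x, hx, i, hi, k, hk, F i x - F i a, rfl, e, hiP, hi', hk'.trans e.le⟩
  · intro x _
    obtain ⟨i, hi, hx⟩ := hPe x
    rcases le_total (F i x - F i a) (w i) with h | h
    · exact Or.inl (mem_biUnion hi ⟨hx, h⟩)
    · exact Or.inr (mem_biUnion hi ⟨hx, h⟩)
  · obtain ⟨i, hi, hx⟩ := hPe a
    exact ⟨a, ⟨le_rfl, hab⟩, mem_biUnion hi ⟨hx, ha i hi⟩⟩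
  · obtain ⟨i, hi, hx⟩ := hPe b
    exact ⟨b, ⟨hab, le_rfl⟩, mem_biUnion hi ⟨hx, hb i hi⟩⟩

lemma main_div {F : ι → ℝ → ℝ} (hF : ∀ j, Continuous (F j))
    (hV : ∀ j x y, x ≤ y → (V j).real (Ioc x y) = F j y - F j x) (n : ℕ) :
    ∀ (s : Finset ι) (w : ι → ℝ) (a b : ℝ), s.card = n + 2 → a ≤ b → (∀ j ∈ s, 0 < w j) →
    (∀ j, j ∉ s → w j = 0) → (∀ j ∈ s, ∑ i ∈ s, w i ≤ F j b - F j a) →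
    DivP V w a b (3 * n + 3) := by
  induction n with
  | zero =>
    intro s w a b hs hab hw hw0 h
    obtain ⟨i, k, hik, rfl⟩ := Finset.card_eq_two.1 hs
    rw [Finset.sum_pair hik] at h
    refine (pair_div (V := V) hF hV (hw i (by simp)) (hw k (by simp)) hab (h i (by simp))
      (h k (by simp))).mono ?_ le_rfl
    intro j
    by_cases hj : j = i
    · subst hj; simp [hik]
    by_cases hj' : j = k
    · subst hj'; simp [hj]
    · simp [hj, hj', hw0 j]
  | succ n ih =>
    intro s w a b hs hab hw hw0 h
    have hsn : s.Nonempty := Finset.card_pos.1 (by omega)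
    have hle : ∀ j ∈ s, w j ≤ ∑ i ∈ s, w i := fun j hj =>
      Finset.single_le_sum (fun i hi => (hw i hi).le) hj
    obtain ⟨x, ⟨hax, hxb⟩, i, hi, k, hk, t, hit, hkt, ht, hti, hkw⟩ := exists_cut hF hsn hab
      (w := w) (fun j hj => by rw [sub_self]; exact (hw j hj).le)
      (fun j hj => (hle j hj).trans (h j hj))
    -- a perfect split
    have perfect : ∀ l ∈ s, F l x - F l a = t → w l = t → DivP V w a b (3 * (n + 1) + 3) := by
      intro l hl hlt hwl
      have d1 : DivP V (Pi.single l (w l)) a x 1 :=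
        DivP.single l (by rw [hV l a x hax]; linarith)
      have hsum := Finset.add_sum_erase s w hl
      have d2 := ih (s.erase l) (fun j => if j = l then 0 else w j) x b
        (by rw [Finset.card_erase_of_mem hl]; omega) hxb
        (fun j hj => by
          rw [if_neg (Finset.ne_of_mem_erase hj)]; exact hw j (Finset.mem_of_mem_erase hj))
        (fun j hj => by
          by_cases e : j = l
          · simp [e]
          · rw [if_neg e]; exact hw0 j fun hj' => hj (Finset.mem_erase.2 ⟨e, hj'⟩))
        (fun j hj => by
          rw [Finset.sum_congr rfl (fun i hi => if_neg (Finset.ne_of_mem_erase hi))]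
          have := h j (Finset.mem_of_mem_erase hj)
          have := ht j (Finset.mem_of_mem_erase hj)
          linarith)
      refine (d1.add hax hxb d2).mono ?_ (by omega)
      intro j
      by_cases e : j = l
      · subst e; simp
      · simp [e]
    by_cases e1 : w i = t
    · exact perfect i hi hit e1
    by_cases e2 : w k = t
    · exact perfect k hk hkt e2
    have hti' : t < w i := lt_of_le_of_ne hti (Ne.symm e1)
    have hkw' : w k < t := lt_of_le_of_ne hkw e2
    have hik : i ≠ k := by rintro rfl; linarith
    have d1 : DivP V (Pi.single k (w k) + Pi.single i (t - w k)) a x 3 :=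
      pair_div hF hV (hw k hk) (by linarith) hax (by linarith) (by linarith)
    have hie : i ∈ s.erase k := Finset.mem_erase.2 ⟨hik, hi⟩
    have hsum := Finset.add_sum_erase s w hk
    have hsum2 := Finset.add_sum_erase (s.erase k) w hie
    have d2 := ih (s.erase k)
      (fun j => if j = k then 0 else if j = i then w i - (t - w k) else w j) x b
      (by rw [Finset.card_erase_of_mem hk]; omega) hxb
      (fun j hj => by
        rw [if_neg (Finset.ne_of_mem_erase hj)]
        have := hw k hk
        split_ifs
        · linarith
        · exact hw j (Finset.mem_of_mem_erase hj))
      (fun j hj => by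
        by_cases e : j = k
        · simp [e]
        · have hjs : j ∉ s := fun hj' => hj (Finset.mem_erase.2 ⟨e, hj'⟩)
          rw [if_neg e, if_neg (by rintro rfl; exact hjs hi)]; exact hw0 j hjs)
      (fun j hj => by
        rw [← Finset.add_sum_erase _ _ hie, if_neg hik, if_pos rfl,
          Finset.sum_congr rfl (g := w) (fun l hl => by
            rw [if_neg (Finset.ne_of_mem_erase (Finset.mem_of_mem_erase hl)),
              if_neg (Finset.ne_of_mem_erase hl)])]
        have := h j (Finset.mem_of_mem_erase hj)
        have := ht j (Finset.mem_of_mem_erase hj)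
        linarith)
    refine (d1.add hax hxb d2).mono ?_ (by omega)
    intro j
    by_cases e : j = k
    · subst e; simp [hik.symm]
    · by_cases e' : j = i
      · subst e'; simp [e]
      · simp [e, e']

end

theorem proportional_entitlements_upper_bound
    (k : ℕ) (hk : 1 ≤ k)
    (V : Fin k → Measure ℝ)
    (hprob : ∀ j, IsProbabilityMeasure (V j))
    (hsupp : ∀ j, V j (Icc (0:ℝ) 1) = 1)
    (hac : ∀ j, V j ≪ volume)
    (w : Fin k → ℝ) (hw : ∀ j, 0 < w j) (hw1 : ∑ j, w j = 1) :
    ∃ (X : Fin k → Set ℝ) (m : Fin k → ℕ),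
      (∀ j, IsUnionOfIntervals (X j) (m j)) ∧
      Pairwise (Function.onFun Disjoint X) ∧
      (⋃ j, X j) = Icc (0:ℝ) 1 ∧
      (∀ j, (V j (X j)).toReal ≥ w j) ∧
      ∑ j, m j ≤ Nat.clog 2 k * (2 * k - 2) + 1 := by
  have hsub : Icc (0:ℝ) 1 ⊆ Ioc (-1) 1 := fun x hx => ⟨by linarith [hx.1], hx.2⟩
  have hone : ∀ j, (V j).real (Ioc (-1) 1) = 1 := by
    intro j
    have : V j (Ioc (-1) 1) = 1 := le_antisymm prob_le_one ((hsupp j).ge.trans (measure_mono hsub))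
    simp [Measure.real, this]
  have key : DivP V w (-1) 1 (Nat.clog 2 k * (2 * k - 2) + 1) := by
    rcases Nat.lt_or_ge k 2 with h2 | h2
    · obtain rfl : k = 1 := by omega
      refine (DivP.single (V := V) 0 (c := 1) (hone 0).ge).mono ?_ (by omega)
      intro j
      obtain rfl : j = 0 := Subsingleton.elim _ _
      simpa using hw1.le
    · have hna : ∀ j, NullSingletonClass (V j) := fun j => ⟨fun x => hac j (by simp)⟩
      choose F hF hV using fun j => exists_cdf (V j)
      obtain ⟨n, rfl⟩ := Nat.exists_eq_add_of_le' h2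
      refine (main_div (V := V) hF hV n Finset.univ w (-1) 1 (by simp) (by norm_num)
        (fun j _ => hw j) (by simp) (fun j _ => ?_)).mono (fun _ => le_rfl) ?_
      · rw [hw1, ← hV j _ _ (by norm_num), hone]
      · rcases Nat.eq_zero_or_pos n with rfl | hn
        · have : 1 ≤ Nat.clog 2 2 := Nat.clog_pos (by norm_num) (by norm_num)
          simp only [zero_add]
          omega
        · have : 2 ≤ Nat.clog 2 (n + 2) := by
            by_contra hc
            have h3 : n + 2 ≤ 2 ^ Nat.clog 2 (n + 2) := Nat.le_pow_clog (by norm_num) _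
            have : 2 ^ Nat.clog 2 (n + 2) ≤ 2 ^ 1 := Nat.pow_le_pow_right (by norm_num) (by omega)
            omega
          have := Nat.mul_le_mul_right (2 * (n + 2) - 2) this
          omega
  obtain ⟨X, m, h1, h2, h3, h4, h5, h6⟩ := key
  refine ⟨fun j => X j ∩ Icc 0 1, m, ?_, ?_, ?_, ?_, h6⟩
  · intro j
    obtain ⟨I, hI, hX⟩ := h1 j
    exact ⟨fun i => I i ∩ Icc 0 1, fun i => (hI i).inter ordConnected_Icc, by
      simp only [hX, iUnion_inter]⟩
  · intro i j hij
    exact (h3 hij).mono inter_subset_left inter_subset_left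
  · rw [← iUnion_inter, h4]
    exact inter_eq_right.2 hsub
  · intro j
    have hc : V j (Icc (0:ℝ) 1)ᶜ = 0 := (prob_compl_eq_zero_iff measurableSet_Icc).2 (hsupp j)
    have : V j (X j ∩ Icc 0 1) = V j (X j) := measure_inter_conull hc
    rw [this]
    exact h5 j
end

section
/- Given n agents with additive nonatomic probability measures on [0,1] grouped into k families with equal entitlements 1/k, there exists a unanimous-proportional allocation (every agent values his family's piece at least 1/k) whose total number of connected components is at most (n-1)(k-1)+1. -/
open MeasureTheory Set

namespace NS

abbrev Ch (p : ℕ) (α : Type*) := List α →₀ ZMod p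

section alg
variable {p : ℕ} {α β γ : Type*}

noncomputable def g1 (p : ℕ) (l : List α) : Ch p α := Finsupp.single l 1

noncomputable def lift (f : List α → Ch p β) : Ch p α →ₗ[ZMod p] Ch p β :=
  Finsupp.linearCombination (ZMod p) f

lemma lift_g1 (f : List α → Ch p β) (l : List α) : lift f (g1 p l) = f l := by
  simp [lift, g1]

lemma hext {M : Type*} [AddCommGroup M] [Module (ZMod p) M] {f g : Ch p α →ₗ[ZMod p] M}
    (h : ∀ l, f (g1 p l) = g (g1 p l)) : f = g := by
  apply Finsupp.lhom_ext'
  intro l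
  apply LinearMap.ext_ring
  exact h l

noncomputable def cone (a : α) : Ch p α →ₗ[ZMod p] Ch p α := lift fun l => g1 p (a :: l)

lemma cone_g1 (a : α) (l : List α) : cone a (g1 p l) = g1 p (a :: l) := lift_g1 _ _

noncomputable def bdL : List α → Ch p α
  | [] => 0
  | a :: l => g1 p l - cone a (bdL l)

noncomputable def bd : Ch p α →ₗ[ZMod p] Ch p α := lift bdL

lemma bd_nil : bd (g1 p ([] : List α)) = 0 := by simp [bd, lift_g1, bdL]
lemma bd_cons (a : α) (l : List α) :
    bd (g1 p (a :: l)) = g1 p l - cone a (bd (g1 p l)) := by simp [bd, lift_g1, bdL]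

lemma bd_cone (a : α) (c : Ch p α) : bd (cone a c) = c - cone a (bd c) := by
  have : bd ∘ₗ cone a = LinearMap.id - cone (p := p) a ∘ₗ bd := by
    apply hext
    intro l
    simp [cone_g1, bd_cons]
  simpa using congrArg (fun f => f c) this

lemma bd_bd (c : Ch p α) : bd (bd c) = 0 := by
  have : bd ∘ₗ bd = (0 : Ch p α →ₗ[ZMod p] Ch p α) := by
    apply hext
    intro l
    induction l with
    | nil => simp [bd_nil]
    | cons a l ih =>
      simp only [LinearMap.comp_apply, LinearMap.zero_apply] at ih ⊢
      simp [bd_cons, bd_cone, ih]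
  simpa using congrArg (fun f => f c) this

noncomputable def mp (f : α → β) : Ch p α →ₗ[ZMod p] Ch p β := lift fun l => g1 p (l.map f)

lemma mp_g1 (f : α → β) (l : List α) : mp f (g1 p l) = g1 p (l.map f) := lift_g1 _ _

lemma mp_cone (f : α → β) (a : α) (c : Ch p α) : mp f (cone a c) = cone (f a) (mp f c) := by
  have : mp f ∘ₗ cone a = cone (p := p) (f a) ∘ₗ mp f := by
    apply hext
    intro l
    simp [cone_g1, mp_g1]
  simpa using congrArg (fun f => f c) this

lemma bd_mp (f : α → β) (c : Ch p α) : bd (mp f c) = mp f (bd c) := by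
  have : bd ∘ₗ mp f = mp (p := p) f ∘ₗ bd := by
    apply hext
    intro l
    induction l with
    | nil => simp [mp_g1, bd_nil]
    | cons a l ih =>
      simp only [LinearMap.comp_apply] at ih ⊢
      simp [mp_g1, bd_cons, mp_cone, ← ih]
  simpa using congrArg (fun f => f c) this

/-- chains supported in a set of lists -/
noncomputable def Su (S : Set (List α)) : Submodule (ZMod p) (Ch p α) := Submodule.span _ (g1 p '' S)

lemma g1_mem {S : Set (List α)} {l : List α} (h : l ∈ S) : g1 p l ∈ Su (p := p) S :=
  Submodule.subset_span ⟨l, h, rfl⟩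

lemma Su_map {M : Type*} [AddCommGroup M] [Module (ZMod p) M] {S : Set (List α)}
    {f : Ch p α →ₗ[ZMod p] M} {W : Submodule (ZMod p) M}
    (h : ∀ l ∈ S, f (g1 p l) ∈ W) {c : Ch p α} (hc : c ∈ Su S) : f c ∈ W := by
  have : Su S ≤ W.comap f := by
    apply Submodule.span_le.2
    rintro _ ⟨l, hl, rfl⟩
    exact h l hl
  exact this hc

lemma Su_eq {M : Type*} [AddCommGroup M] [Module (ZMod p) M] {S : Set (List α)}
    {f g : Ch p α →ₗ[ZMod p] M}
    (h : ∀ l ∈ S, f (g1 p l) = g (g1 p l)) {c : Ch p α} (hc : c ∈ Su S) : f c = g c := by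
  have : (f - g) c ∈ (⊥ : Submodule (ZMod p) M) := by
    apply Su_map _ hc
    intro l hl
    simp [h l hl]
  simpa [sub_eq_zero] using this

lemma Su_mono {S S' : Set (List α)} (h : S ⊆ S') : Su (p := p) S ≤ Su S' :=
  Submodule.span_mono (Set.image_mono h)

lemma bd_len (n : ℕ) {c : Ch p α} (hc : c ∈ Su {l : List α | l.length = n + 1}) :
    bd c ∈ Su (p := p) {l : List α | l.length = n} := by
  refine Su_map ?_ hc
  clear hc c
  induction n with
  | zero =>
    intro l hl
    obtain ⟨a, rfl⟩ := List.length_eq_one_iff.1 hl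
    simp only [bd_cons, bd_nil, map_zero, sub_zero]
    exact g1_mem rfl
  | succ n ih =>
    intro l hl
    match l, hl with
    | a :: l, hl =>
      have hl' : l.length = n + 1 := by simpa using hl
      rw [bd_cons]
      refine Submodule.sub_mem _ (g1_mem hl') ?_
      refine Su_map ?_ (ih l hl')
      intro m hm
      rw [cone_g1]
      exact g1_mem (by simpa using hm)

/-- lists obtained from bd are sublists -/
lemma bd_sub (l : List α) : bd (g1 p l) ∈ Su (p := p) {m : List α | m.Sublist l} := by
  induction l with
  | nil => simp [bd_nil]
  | cons a l ih =>
    rw [bd_cons]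
    refine Submodule.sub_mem _ (g1_mem (by simp)) ?_
    refine Su_map ?_ ih
    intro m hm
    rw [cone_g1]
    exact g1_mem (List.Sublist.cons_cons a hm)

lemma bd_sub_len (n : ℕ) (l : List α) (hl : l.length = n + 1) :
    bd (g1 p l) ∈ Su (p := p) {m : List α | m.Sublist l ∧ m.length = n} := by
  induction l generalizing n with
  | nil => simp at hl
  | cons a l ih =>
    have hl' : l.length = n := by simpa using hl
    rw [bd_cons]
    refine Submodule.sub_mem _ (g1_mem ⟨by simp, hl'⟩) ?_
    cases n with
    | zero =>
      obtain rfl := List.length_eq_zero_iff.1 hl'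
      simp [bd_nil]
    | succ n =>
      refine Su_map ?_ (ih n hl')
      intro m hm
      rw [cone_g1]
      exact g1_mem ⟨List.Sublist.cons_cons a hm.1, by simpa using hm.2⟩

/-- subdivision -/
noncomputable def sd (b : List α → β) : ℕ → Ch p α →ₗ[ZMod p] Ch p β
  | 0 => lift fun _ => g1 p []
  | n + 1 => lift fun l => cone (b l) (sd b n (bd (g1 p l)))

lemma sd_zero (b : List α → β) (l : List α) : sd b 0 (g1 p l) = g1 p [] := lift_g1 _ _
lemma sd_succ (b : List α → β) (n : ℕ) (l : List α) :
    sd b (n+1) (g1 p l) = cone (b l) (sd b n (bd (g1 p l))) := lift_g1 _ _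

lemma bd_sd (b : List α → β) (n : ℕ) {c : Ch p α} (hc : c ∈ Su {l : List α | l.length = n + 1}) :
    bd (sd b (n+1) c) = sd b n (bd c) := by
  induction n generalizing c with
  | zero =>
    refine Su_eq (f := bd ∘ₗ sd b 1) (g := sd b 0 ∘ₗ bd) ?_ hc
    intro l hl
    obtain ⟨a, rfl⟩ := List.length_eq_one_iff.1 hl
    simp [sd_succ, sd_zero, bd_cons, bd_nil, cone_g1]
  | succ n ih =>
    refine Su_eq (f := bd ∘ₗ sd b (n+2)) (g := sd b (n+1) ∘ₗ bd) ?_ hc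
    intro l hl
    simp only [LinearMap.comp_apply]
    rw [sd_succ, bd_cone, ih (bd_len _ (g1_mem hl)), bd_bd]
    simp

lemma mp_sd (b : List α → β) (T : α → α) (T' : β → β) (h : ∀ l, b (l.map T) = T' (b l))
    (n : ℕ) (c : Ch p α) : mp T' (sd b n c) = sd b n (mp T c) := by
  have : mp T' ∘ₗ sd b n = sd (p := p) b n ∘ₗ mp T := by
    induction n with
    | zero =>
      apply hext
      intro l
      simp [sd_zero, mp_g1]
    | succ n ih =>
      apply hext
      intro l
      have ih' := fun c => congrArg (fun f => f c) ih
      simp only [LinearMap.comp_apply] at ih' ⊢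
      rw [mp_g1, sd_succ, sd_succ, mp_cone, ih', h, ← mp_g1, bd_mp]
  simpa using congrArg (fun f => f c) this

lemma sd_flag (b : List α → β) (n : ℕ) (l : List α) (hl : l.length = n) :
    sd b n (g1 p l) ∈ Su (p := p) {m : List β | ∃ fl : List (List α), m = fl.map b ∧
      fl.length = n ∧ fl.Pairwise (fun l1 l2 => l2.Sublist l1) ∧
      ∀ l' ∈ fl, l' ≠ [] ∧ l'.Sublist l} := by
  induction n generalizing l with
  | zero =>
    rw [sd_zero]
    exact g1_mem ⟨[], by simp⟩
  | succ n ih =>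
    rw [sd_succ]
    have h1 : sd b n (bd (g1 p l)) ∈ Su (p := p) {m : List β | ∃ fl : List (List α), m = fl.map b ∧
      fl.length = n ∧ fl.Pairwise (fun l1 l2 => l2.Sublist l1) ∧
      ∀ l' ∈ fl, l' ≠ [] ∧ l'.Sublist l} := by
      refine Su_map ?_ (bd_sub_len n l hl)
      intro m hm
      refine Su_mono ?_ (ih m hm.2)
      rintro _ ⟨fl, h1, h2, h3, h4⟩
      exact ⟨fl, h1, h2, h3, fun l' hl' => ⟨(h4 l' hl').1, (h4 l' hl').2.trans hm.1⟩⟩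
    refine Su_map ?_ h1
    rintro m ⟨fl, h1, h2, h3, h4⟩
    rw [cone_g1]
    refine g1_mem ⟨l :: fl, by simp [h1], by simp [h2], ?_, ?_⟩
    · rw [List.pairwise_cons]
      exact ⟨fun l' hl' => (h4 l' hl').2, h3⟩
    · intro l' hl'
      rcases List.mem_cons.1 hl' with rfl | h
      · exact ⟨by rintro rfl; simp at hl, List.Sublist.refl _⟩
      · exact h4 _ h

/-- the alternating operators -/
noncomputable def op {M : Type*} [AddCommGroup M] [Module (ZMod p) M]
    (τ : Module.End (ZMod p) M) (k : ℕ) : Module.End (ZMod p) M :=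
  if Even k then ∑ i ∈ Finset.range p, τ ^ i else τ - 1

lemma op_op {M : Type*} [AddCommGroup M] [Module (ZMod p) M]
    (τ : Module.End (ZMod p) M) (h : τ ^ p = 1) (k : ℕ) (c : M) : op τ (k+1) (op τ k c) = 0 := by
  have h1 : (∑ i ∈ Finset.range p, τ ^ i) * (τ - 1) = 0 := by rw [geom_sum_mul, h, sub_self]
  have h2 : (τ - 1) * (∑ i ∈ Finset.range p, τ ^ i) = 0 := by rw [mul_geom_sum, h, sub_self]
  rw [← Module.End.mul_apply]
  by_cases hk : Even k
  · have : ¬ Even (k+1) := by simpa [Nat.even_add_one] using hk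
    simp only [op, hk, this, if_true, if_false, h2, LinearMap.zero_apply]
  · have : Even (k+1) := by simpa [Nat.even_add_one] using hk
    simp only [op, hk, this, if_true, if_false, h1, LinearMap.zero_apply]

/-- naturality -/
lemma op_nat {M M' : Type*} [AddCommGroup M] [Module (ZMod p) M] [AddCommGroup M']
    [Module (ZMod p) M']
    (τ : Module.End (ZMod p) M) (τ' : Module.End (ZMod p) M') (φ : M →ₗ[ZMod p] M')
    (W : Submodule (ZMod p) M) (hW : ∀ c ∈ W, τ c ∈ W)
    (h : ∀ c ∈ W, φ (τ c) = τ' (φ c)) (k : ℕ) (c : M) (hc : c ∈ W) :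
    φ (op τ k c) = op τ' k (φ c) := by
  by_cases hk : Even k
  · simp only [op, hk, if_true, LinearMap.sum_apply, map_sum]
    refine Finset.sum_congr rfl fun i _ => ?_
    have : ∀ i, ∀ c ∈ W, φ ((τ ^ i) c) = (τ' ^ i) (φ c) := by
      intro i
      induction i with
      | zero => simp
      | succ i ih =>
        intro c hc
        rw [pow_succ, pow_succ, Module.End.mul_apply, Module.End.mul_apply, ih _ (hW c hc), h c hc]
    exact this i c hc
  · simp [op, hk, h c hc]

lemma op_mem {M : Type*} [AddCommGroup M] [Module (ZMod p) M]
    (τ : Module.End (ZMod p) M) (W : Submodule (ZMod p) M) (hW : ∀ c ∈ W, τ c ∈ W)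
    (k : ℕ) (c : M) (hc : c ∈ W) : op τ k c ∈ W := by
  by_cases hk : Even k
  · simp only [op, hk, if_true, LinearMap.sum_apply]
    refine Submodule.sum_mem _ fun i _ => ?_
    have : ∀ i, ∀ c ∈ W, ((τ ^ i) c) ∈ W := by
      intro i
      induction i with
      | zero => simp
      | succ i ih =>
        intro c hc
        rw [pow_succ, Module.End.mul_apply]
        exact ih _ (hW c hc)
    exact this i c hc
  · simp only [op, hk, if_false, LinearMap.sub_apply]
    exact Submodule.sub_mem _ (hW c hc) hc

lemma mp_pow (T : α → α) (i : ℕ) (l : List α) :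
    ((mp (p := p) T : Module.End (ZMod p) (Ch p α)) ^ i) (g1 p l) = g1 p (l.map T^[i]) := by
  induction i generalizing l with
  | zero => simp
  | succ i ih =>
    rw [pow_succ, Module.End.mul_apply, mp_g1, ih, List.map_map]
    rfl

lemma mp_pow_eq_one (T : α → α) (n : ℕ) (h : ∀ x, T^[n] x = x) :
    (mp (p := p) T : Module.End (ZMod p) (Ch p α)) ^ n = 1 := by
  apply hext
  intro l
  rw [mp_pow]
  have : T^[n] = id := funext h
  simp [this]

end alg

section cochain
variable {p : ℕ} [Fact p.Prime]

/-- lists with adjacent repeats -/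
def Dg (α : Type*) : Set (List α) := {l | ¬ l.IsChain (· ≠ ·)}

lemma bd_Dg {α : Type*} (l : List α) (hl : l ∈ Dg α) : bd (g1 p l) ∈ Su (p := p) (Dg α) := by
  induction l with
  | nil => simp [Dg] at hl
  | cons a l ih =>
    by_cases h : l ∈ Dg α
    · rw [bd_cons]
      refine Submodule.sub_mem _ (g1_mem h) ?_
      refine Su_map ?_ (ih h)
      intro m hm
      rw [cone_g1]
      apply g1_mem
      intro hc
      exact hm hc.of_cons
    · match l, hl, h with
      | [], hl, h => simp [Dg] at hl
      | b :: l, hl, h =>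
        have hab : a = b := by
          by_contra hab
          apply hl
          simp only [Dg, Set.mem_ofPred_eq, not_not] at h
          exact List.IsChain.cons_cons hab h
        subst hab
        rw [bd_cons, bd_cons]
        simp only [map_sub, cone_g1, sub_sub_cancel]
        have : bd (g1 p l) ∈ Su (p := p) Set.univ := by
          exact Su_mono (Set.subset_univ _) (bd_sub l)
        have h2 : (cone a ∘ₗ cone a) (bd (g1 p l)) ∈ Su (p := p) (Dg α) := by
          refine Su_map ?_ this
          intro m _
          simp only [LinearMap.comp_apply, cone_g1]
          apply g1_mem
          simp [Dg]
        exact h2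

noncomputable abbrev tau (p : ℕ) : Module.End (ZMod p) (Ch p (ZMod p)) := mp (fun x => x + 1)

lemma tau_pow (i : ℕ) (l : List (ZMod p)) : ((tau p) ^ i) (g1 p l) = g1 p (l.map (· + (i : ZMod p))) := by
  rw [tau, mp_pow]
  congr 2
  funext x
  induction i with
  | zero => simp
  | succ i ih => rw [Function.iterate_succ_apply', ih]; push_cast; ring

noncomputable def fn (f : List (ZMod p) → ZMod p) : Ch p (ZMod p) →ₗ[ZMod p] ZMod p :=
  Finsupp.linearCombination (ZMod p) f

lemma fn_g1 (f : List (ZMod p) → ZMod p) (l : List (ZMod p)) : fn f (g1 p l) = f l := by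
  simp [fn, g1]

lemma solve_even (b : Ch p (ZMod p) →ₗ[ZMod p] ZMod p) (hb0 : b (g1 p []) = 0)
    (hbD : ∀ l ∈ Dg (ZMod p), b (g1 p l) = 0)
    (hb : ∀ c, b (tau p c) = b c) :
    ∃ a : Ch p (ZMod p) →ₗ[ZMod p] ZMod p, a (g1 p []) = 0 ∧
      (∀ l ∈ Dg (ZMod p), a (g1 p l) = 0) ∧ ∀ c, a ((∑ i ∈ Finset.range p, (tau p)^i) c) = b c := by
  refine ⟨fn fun l => if l.head? = some 0 then b (g1 p l) else 0, by simp [fn_g1], ?_, ?_⟩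
  · intro l hl
    simp [fn_g1, hbD l hl]
  · intro c
    have : (fn fun l => if l.head? = some 0 then b (g1 p l) else 0) ∘ₗ
      (∑ i ∈ Finset.range p, (tau p)^i) = b := by
      apply hext
      intro l
      have hpow : ∀ i : ℕ, b (((tau p)^i) (g1 p l)) = b (g1 p l) := by
        intro i
        induction i with
        | zero => simp
        | succ i ih => rw [pow_succ', Module.End.mul_apply, hb, ih]
      simp only [tau_pow] at hpow
      simp only [LinearMap.comp_apply, LinearMap.sum_apply, map_sum, tau_pow, fn_g1, hpow]
      match l with
      | [] => simp [hb0]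
      | x :: l =>
        simp only [List.map_cons, List.head?_cons, Option.some.injEq]
        rw [Finset.sum_eq_single (-x).val]
        · simp
        · intro i hi hne
          rw [if_neg]
          intro h
          apply hne
          have : (i : ZMod p) = -x := by linear_combination h
          rw [← this, ZMod.val_natCast, Nat.mod_eq_of_lt (Finset.mem_range.1 hi)]
        · intro h
          exact absurd (Finset.mem_range.2 (ZMod.val_lt _)) h
    simpa using congrArg (fun f => f c) this

lemma Dg_map {α β : Type*} {f : α → β} {l : List α} (hl : l ∈ Dg α) : l.map f ∈ Dg β := by
  intro h
  apply hl
  rw [List.isChain_map] at h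
  exact h.imp fun a b hab h' => hab (by rw [h'])

lemma solve_odd (b : Ch p (ZMod p) →ₗ[ZMod p] ZMod p) (hb0 : b (g1 p []) = 0)
    (hbD : ∀ l ∈ Dg (ZMod p), b (g1 p l) = 0)
    (hb : ∀ c, b ((∑ i ∈ Finset.range p, (tau p)^i) c) = 0) :
    ∃ a : Ch p (ZMod p) →ₗ[ZMod p] ZMod p, a (g1 p []) = 0 ∧
      (∀ l ∈ Dg (ZMod p), a (g1 p l) = 0) ∧ ∀ c, a ((tau p - 1) c) = b c := by
  let A : List (ZMod p) → ZMod p := fun l => match l with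
    | [] => 0
    | x :: l => ∑ i ∈ Finset.range x.val, b (g1 p ((x :: l).map (· + ((i : ZMod p) - x))))
  refine ⟨fn A, by simp [fn_g1, A], ?_, ?_⟩
  · intro l hl
    rw [fn_g1]
    match l with
    | [] => rfl
    | x :: l =>
      refine Finset.sum_eq_zero fun i _ => ?_
      exact hbD _ (Dg_map hl)
  · intro c
    have : fn A ∘ₗ (tau p - 1) = b := by
      apply hext
      intro l
      simp only [LinearMap.comp_apply, LinearMap.sub_apply, map_sub, Module.End.one_apply]
      rw [tau, mp_g1, fn_g1, fn_g1]
      match l with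
      | [] => simp [A, hb0]
      | x :: l =>
        have e1 : A ((x :: l).map (fun x => x + 1)) = ∑ i ∈ Finset.range (x+1).val,
            b (g1 p ((x :: l).map (· + ((i : ZMod p) - x)))) := by
          simp only [A, List.map_cons]
          refine Finset.sum_congr rfl fun i _ => ?_
          congr 2
          simp only [List.map_map]
          congr 1
          · ring
          · congr 1
            funext y
            simp only [Function.comp]
            ring
        rw [e1]
        simp only [A]
        have hs := hb (g1 p ((x :: l).map (· - x)))
        simp only [LinearMap.sum_apply, map_sum, tau_pow, List.map_map] at hs
        have e2 : ∀ i : ℕ, ((fun y : ZMod p => y + (i : ZMod p)) ∘ fun y => y - x) = (· + ((i : ZMod p) - x)) := by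
          intro i; funext y; simp only [Function.comp]; ring
        simp only [e2] at hs
        have e3 : g1 p (x :: l) = g1 p ((x :: l).map (· + (((x.val : ℕ) : ZMod p) - x))) := by
          simp
        rw [e3]
        have hp : 0 < p := (Fact.out : p.Prime).pos
        by_cases hx : x.val + 1 = p
        · have hx0 : x + 1 = 0 := by
            have : ((x.val + 1 : ℕ) : ZMod p) = 0 := by rw [hx]; simp
            simpa using this
          rw [hx0]
          have : Finset.range p = Finset.range (x.val + 1) := by rw [hx]
          rw [this, Finset.sum_range_succ] at hs
          simp only [ZMod.val_zero, Finset.range_zero, Finset.sum_empty]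
          linear_combination -hs
        · have hlt : x.val + 1 < p := lt_of_le_of_ne (ZMod.val_lt x) hx
          have : (x + 1).val = x.val + 1 := by
            have h1 : x + 1 = ((x.val + 1 : ℕ) : ZMod p) := by simp
            rw [h1, ZMod.val_natCast, Nat.mod_eq_of_lt hlt]
          rw [this, Finset.sum_range_succ]
          ring
    simpa using congrArg (fun f => f c) this

lemma bd_comm_op (k : ℕ) (c : Ch p (ZMod p)) : bd (op (tau p) k c) = op (tau p) k (bd c) := by
  refine op_nat (tau p) (tau p) bd ⊤ (by simp) ?_ k c trivial
  intro c _
  exact bd_mp _ _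

lemma tau_pow_p : (tau p) ^ p = 1 := by
  apply hext
  intro l
  rw [tau_pow]
  simp

lemma cochains (n : ℕ) : ∃ a a' : Ch p (ZMod p) →ₗ[ZMod p] ZMod p,
    (a (g1 p []) = 0 ∧ (∀ l ∈ Dg (ZMod p), a (g1 p l) = 0)) ∧
    (a' (g1 p []) = 0 ∧ (∀ l ∈ Dg (ZMod p), a' (g1 p l) = 0)) ∧
    (∀ c, a (bd c) = a' (op (tau p) (n+1) c)) ∧
    (∀ y : ℕ → Ch p (ZMod p), (∃ x, y 0 = g1 p [x]) →
      (∀ k < n, bd (y (k+1)) = op (tau p) k (y k)) → a (op (tau p) n (y n)) = 1) := by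
  -- one extension step
  have step : ∀ (n : ℕ) (a : Ch p (ZMod p) →ₗ[ZMod p] ZMod p), a (g1 p []) = 0 →
      (∀ l ∈ Dg (ZMod p), a (g1 p l) = 0) → (∀ c, a (bd (op (tau p) (n+2) c)) = 0) →
      ∃ a' : Ch p (ZMod p) →ₗ[ZMod p] ZMod p, (a' (g1 p []) = 0 ∧
        (∀ l ∈ Dg (ZMod p), a' (g1 p l) = 0)) ∧ (∀ c, a (bd c) = a' (op (tau p) (n+1) c)) := by
    intro n a h0 hD hz
    have hb0 : (a ∘ₗ bd) (g1 p []) = 0 := by simp [bd_nil]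
    have hbD : ∀ l ∈ Dg (ZMod p), (a ∘ₗ bd) (g1 p l) = 0 := by
      intro l hl
      have := Su_map (f := a) (W := ⊥) (by simpa using hD) (bd_Dg (p := p) l hl)
      simpa using this
    by_cases hn : Even (n+1)
    · have hn2 : ¬ Even (n+2) := by simpa [Nat.even_add_one (n := n+1)] using hn
      obtain ⟨a', h1, h2, h3⟩ := solve_even (a ∘ₗ bd) hb0 hbD (by
        intro c
        have := hz c
        simp only [op, hn2, if_false, LinearMap.sub_apply, map_sub, Module.End.one_apply] at this
        exact sub_eq_zero.1 this)
      refine ⟨a', ⟨h1, h2⟩, fun c => ?_⟩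
      simp only [op, hn, if_true]
      rw [h3]; rfl
    · have hn2 : Even (n+2) := by simpa [Nat.even_add_one (n := n+1)] using hn
      obtain ⟨a', h1, h2, h3⟩ := solve_odd (a ∘ₗ bd) hb0 hbD (by
        intro c
        have := hz c
        simp only [op, hn2, if_true] at this
        exact this)
      refine ⟨a', ⟨h1, h2⟩, fun c => ?_⟩
      simp only [op, hn, if_false]
      rw [h3]; rfl
  induction n with
  | zero =>
    let a : Ch p (ZMod p) →ₗ[ZMod p] ZMod p := fn fun l => if l = [0] then 1 else 0
    have hsum : ∀ l : List (ZMod p), a (op (tau p) 0 (g1 p l)) = if l.length = 1 then 1 else 0 := by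
      intro l
      simp only [op, Even.zero, if_true, LinearMap.sum_apply, map_sum, tau_pow, a, fn_g1]
      match l with
      | [] => simp
      | x :: y :: l => simp
      | [x] =>
        simp only [List.map_cons, List.map_nil, List.length_singleton, if_true]
        rw [Finset.sum_eq_single (-x).val]
        · simp
        · intro i hi hne
          rw [if_neg]
          intro h
          apply hne
          have h' : x + (i : ZMod p) = 0 := by simpa using h
          have : (i : ZMod p) = -x := by linear_combination h'
          rw [← this, ZMod.val_natCast, Nat.mod_eq_of_lt (Finset.mem_range.1 hi)]
        · intro h
          exact absurd (Finset.mem_range.2 (ZMod.val_lt _)) h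
    have h0 : a (g1 p []) = 0 := by simp [a, fn_g1]
    have hD : ∀ l ∈ Dg (ZMod p), a (g1 p l) = 0 := by
      intro l hl
      simp only [a, fn_g1]
      rw [if_neg]
      rintro rfl
      simp [Dg] at hl
    obtain ⟨a', h1, h2⟩ := step 0 a h0 hD (by
      intro c
      have hop : op (tau p) (0+2) = op (tau p) 0 := by simp [op]
      rw [hop, bd_comm_op]
      have : (a ∘ₗ op (tau p) 0) ∘ₗ bd = 0 := by
        apply hext
        intro l
        match l with
        | [] => simp [bd_nil]
        | [x] => simp [bd_cons, bd_nil, hsum]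
        | [x, y] => simp [bd_cons, bd_nil, hsum, cone_g1]
        | x :: y :: z :: l =>
          have h := bd_sub_len (p := p) (l.length + 2) (x :: y :: z :: l) (by simp)
          have := Su_map (f := a ∘ₗ op (tau p) 0) (W := ⊥) (by
            intro m hm
            simp only [LinearMap.comp_apply, hsum, Submodule.mem_bot]
            rw [if_neg]
            have := hm.2
            omega) h
          simpa using this
      simpa using congrArg (fun f => f c) this)
    refine ⟨a, a', ⟨h0, hD⟩, h1, h2, ?_⟩
    rintro y ⟨x, hx⟩ -
    rw [hx, hsum]
    simp
  | succ n ih =>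
    obtain ⟨a, a', h1, h2, h3, h4⟩ := ih
    obtain ⟨a'', h5, h6⟩ := step (n+1) a' h2.1 h2.2 (by
      intro c
      have hop : op (tau p) (n+1+2) = op (tau p) (n+1) := by simp [op, Nat.even_add_one]
      rw [hop, bd_comm_op, ← h3, bd_bd, map_zero])
    refine ⟨a', a'', h2, h5, h6, ?_⟩
    intro y h0 hy
    rw [← h3, hy n (Nat.lt_succ_self _)]
    exact h4 y h0 fun k hk => hy k (by omega)

/-- algebraic core -/
lemma alg_core (n : ℕ) (y : ℕ → Ch p (ZMod p)) (h0 : ∃ x, y 0 = g1 p [x])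
    (hy : ∀ k < n, bd (y (k+1)) = op (tau p) k (y k)) :
    ¬ y n ∈ Su (p := p) (Dg (ZMod p)) := by
  intro hD
  obtain ⟨a, a', h1, h2, h3, h4⟩ := cochains (p := p) n
  have h5 := h4 y h0 hy
  have h6 : op (tau p) n (y n) ∈ Su (p := p) (Dg (ZMod p)) := by
    refine op_mem _ _ ?_ _ _ hD
    intro c hc
    refine Su_map ?_ hc
    intro l hl
    rw [tau, mp_g1]
    exact g1_mem (Dg_map hl)
  have h7 := Su_map (f := a) (W := ⊥) (by simpa using h1.2) h6
  rw [Submodule.mem_bot, h5] at h7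
  exact one_ne_zero h7

end cochain

section tucker
variable {p : ℕ}

structure Sq {α : Type*} (T : α → α) (n : ℕ) (h : ℕ → Ch p α) : Prop where
  zero : ∃ x, h 0 = g1 p [x]
  bd : ∀ k < n, bd (h (k+1)) = op (mp (p := p) T) k (h k)
  len : ∀ k ≤ n, h k ∈ Su (p := p) {l : List α | l.length = k + 1}

lemma Sq.sd {α β : Type*} {T : α → α} {T' : β → β} {n : ℕ} {h : ℕ → Ch p α} (H : Sq T n h)
    (b : List α → β) (hb : ∀ l, b (l.map T) = T' (b l)) :
    Sq T' n (fun k => sd b (k+1) (h k)) := by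
  refine ⟨?_, ?_, ?_⟩
  · obtain ⟨x, hx⟩ := H.zero
    refine ⟨b [x], ?_⟩
    simp [hx, sd_succ, sd_zero, bd_cons, bd_nil, cone_g1]
  · intro k hk
    rw [bd_sd b (k+1) (H.len (k+1) hk), H.bd k hk]
    refine op_nat (mp (p := p) T) (mp (p := p) T') (NS.sd b (k+1)) ⊤ (by simp) ?_ k _ trivial
    intro c _
    exact (mp_sd b T T' hb _ c).symm
  · intro k hk
    refine Su_map ?_ (H.len k hk)
    intro l hl
    refine Su_mono ?_ (sd_flag b (k+1) l hl)
    rintro _ ⟨fl, rfl, h2, -⟩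
    simpa using h2

variable [Fact p.Prime] {N : ℕ}

def shift (s : Finset (ZMod p × Fin N)) : Finset (ZMod p × Fin N) :=
  s.image fun x => (x.1 + 1, x.2)

def GoodS (s : Finset (ZMod p × Fin N)) : Prop :=
  s.Nonempty ∧ ∀ j, ∃ g, (g, j) ∉ s

lemma GoodS.card {s : Finset (ZMod p × Fin N)} (h : GoodS s) : s.card ≤ N * (p - 1) := by
  have : NeZero p := ⟨(Fact.out : p.Prime).ne_zero⟩
  choose g hg using h.2
  have h1 : s ⊆ Finset.univ \ (Finset.univ.image fun j => (g j, j)) := by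
    intro x hx
    simp only [Finset.mem_sdiff, Finset.mem_univ, true_and, Finset.mem_image, not_exists]
    rintro j rfl
    exact hg j hx
  have h2 := Finset.card_le_card h1
  rw [Finset.card_sdiff_of_subset (Finset.subset_univ _), Finset.card_image_of_injective _ (by
    intro a b hab; exact (Prod.ext_iff.1 hab).2)] at h2
  simp only [Finset.card_univ, Fintype.card_prod, ZMod.card, Fintype.card_fin] at h2
  rw [Nat.mul_sub, mul_comm N p]
  simpa using h2

lemma exists_r : ∃ r : Finset (ZMod p × Fin N) → ZMod p, ∀ s, GoodS s → r (shift s) = r s + 1 := by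
  classical
  have : NeZero p := ⟨(Fact.out : p.Prime).ne_zero⟩
  let sl : Finset (ZMod p × Fin N) → Fin N → Finset (ZMod p) := fun s j =>
    Finset.univ.filter fun g => (g, j) ∈ s
  have hpick : ∃ pick : Finset (Fin N) → Option (Fin N), ∀ J : Finset (Fin N), J.Nonempty → ∃ j ∈ J, pick J = some j := by
    refine ⟨fun J => if h : J.Nonempty then some h.choose else none, ?_⟩
    intro J h
    exact ⟨h.choose, h.choose_spec, by simp [h]⟩
  obtain ⟨pick, hpick⟩ := hpick
  refine ⟨fun s => match pick (s.image Prod.snd) with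
    | none => 0
    | some j => (∑ g ∈ sl s j, g) / ((sl s j).card : ZMod p), ?_⟩
  intro s hs
  have himg : (shift s).image Prod.snd = s.image Prod.snd := by
    simp only [shift, Finset.image_image]
    rfl
  obtain ⟨j, hj, hpj⟩ := hpick (s.image Prod.snd) (hs.1.image _)
  simp only [himg, hpj]
  have hsl : sl (shift s) j = (sl s j).map (addRightEmbedding 1) := by
    ext g
    simp only [sl, shift, Finset.mem_filter, Finset.mem_univ, true_and, Finset.mem_image,
      Finset.mem_map, addRightEmbedding_apply, Prod.mk.injEq, Prod.exists]
    constructor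
    · rintro ⟨a, b, h, rfl, rfl⟩; exact ⟨a, h, rfl⟩
    · rintro ⟨a, h, rfl⟩; exact ⟨a, j, h, rfl, rfl⟩
  rw [hsl, Finset.sum_map, Finset.card_map]
  simp only [addRightEmbedding_apply, Finset.sum_add_distrib, Finset.sum_const, nsmul_eq_mul, mul_one]
  have hc : ((sl s j).card : ZMod p) ≠ 0 := by
    rw [Ne, ZMod.natCast_eq_zero_iff]
    intro hd
    have h1 : 0 < (sl s j).card := by
      rw [Finset.card_pos]
      obtain ⟨x, hx, rfl⟩ := Finset.mem_image.1 hj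
      exact ⟨x.1, by simpa [sl] using hx⟩
    have h2 : (sl s j).card < p := by
      obtain ⟨g, hg⟩ := hs.2 j
      have : sl s j ⊂ Finset.univ := by
        rw [Finset.ssubset_univ_iff]
        intro h
        have := Finset.mem_univ g
        rw [← h] at this
        exact hg (by simpa [sl] using this)
      have := Finset.card_lt_card this
      simpa [ZMod.card] using this
    exact absurd (Nat.le_of_dvd h1 hd) (by omega)
  field_simp

lemma chain_and {α : Type*} {R S : α → α → Prop} {l : List α} (h1 : l.IsChain R)
    (h2 : l.IsChain S) : l.IsChain (fun a b => R a b ∧ S a b) := by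
  induction l with
  | nil => simp
  | cons a l ih =>
    rw [List.isChain_cons] at h1 h2 ⊢
    exact ⟨fun y hy => ⟨h1.1 y hy, h2.1 y hy⟩, ih h1.2 h2.2⟩

lemma chain_card {α : Type*} (L : List (Finset α)) (s : Finset α)
    (h : (s :: L).IsChain (fun a b => b ⊂ a)) (hn : ∀ t ∈ s :: L, t.Nonempty) :
    (s :: L).length ≤ s.card := by
  induction L generalizing s with
  | nil => simpa using (hn s (by simp)).card_pos
  | cons t L ih =>
    rw [List.isChain_cons_cons] at h
    have h1 := ih t h.2 (fun u hu => hn u (List.mem_cons_of_mem _ hu))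
    have h2 := Finset.card_lt_card h.1
    simp only [List.length_cons] at h1 ⊢
    omega

lemma tucker_core {E : Type*} (T : E → E) (n : ℕ) (h : ℕ → Ch p E) (H : Sq T n h)
    (lab : E → Finset (ZMod p × Fin N)) (hlab : ∀ v, lab (T v) = shift (lab v))
    (hg : ∀ k ≤ n, h k ∈ Su (p := p) {l : List E | l.length = k + 1 ∧ (∀ v ∈ l, (lab v).Nonempty) ∧
      ∀ j, ∃ g, ∀ v ∈ l, (g, j) ∉ lab v}) : n + 1 ≤ N * (p - 1) := by
  classical
  by_contra hcon
  let b : List E → Finset (ZMod p × Fin N) := fun l => l.toFinset.biUnion lab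
  have hbm : ∀ l x, x ∈ b l ↔ ∃ v ∈ l, x ∈ lab v := by
    intro l x; simp [b]
  have hb : ∀ l, b (l.map T) = shift (b l) := by
    intro l
    ext x
    simp only [hbm, shift, Finset.mem_image, List.mem_map]
    constructor
    · rintro ⟨_, ⟨v, hv, rfl⟩, hx⟩
      rw [hlab, shift, Finset.mem_image] at hx
      obtain ⟨y, hy, rfl⟩ := hx
      exact ⟨y, ⟨v, hv, hy⟩, rfl⟩
    · rintro ⟨y, ⟨v, hv, hy⟩, rfl⟩
      refine ⟨_, ⟨v, hv, rfl⟩, ?_⟩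
      rw [hlab, shift, Finset.mem_image]
      exact ⟨y, hy, rfl⟩
  have H2 := H.sd b hb
  let S : ℕ → Set (List (Finset (ZMod p × Fin N))) := fun k =>
    {m | m.length = k + 1 ∧ (∀ s ∈ m, GoodS s) ∧ m.Pairwise (fun s t => t ⊆ s)}
  have hS : ∀ k ≤ n, sd b (k+1) (h k) ∈ Su (p := p) (S k) := by
    intro k hk
    refine Su_map ?_ (hg k hk)
    rintro l ⟨hl1, hl2, hl3⟩
    refine Su_mono ?_ (sd_flag b (k+1) l hl1)
    rintro _ ⟨fl, rfl, h2, h3, h4⟩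
    refine ⟨by simpa using h2, ?_, ?_⟩
    · intro s hs
      obtain ⟨l', hl', rfl⟩ := List.mem_map.1 hs
      obtain ⟨h5, h6⟩ := h4 l' hl'
      constructor
      · obtain ⟨v, hv⟩ := List.exists_mem_of_ne_nil _ h5
        obtain ⟨x, hx⟩ := hl2 v (h6.subset hv)
        exact ⟨x, (hbm _ _).2 ⟨v, hv, hx⟩⟩
      · intro j
        obtain ⟨g, hg⟩ := hl3 j
        refine ⟨g, fun hx => ?_⟩
        obtain ⟨v, hv, hx⟩ := (hbm _ _).1 hx
        exact hg v (h6.subset hv) hx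
    · rw [List.pairwise_map]
      refine h3.imp ?_
      intro l1 l2 h12 x hx
      obtain ⟨v, hv, hx⟩ := (hbm _ _).1 hx
      exact (hbm _ _).2 ⟨v, h12.subset hv, hx⟩
  obtain ⟨r, hr⟩ := exists_r (p := p) (N := N)
  have hshift : ∀ s : Finset (ZMod p × Fin N), GoodS s → GoodS (shift s) := by
    intro s hs
    refine ⟨hs.1.image _, fun j => ?_⟩
    obtain ⟨g, hg⟩ := hs.2 j
    refine ⟨g + 1, fun hx => hg ?_⟩
    obtain ⟨⟨a, c⟩, hy, hxy⟩ := Finset.mem_image.1 hx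
    simp only [Prod.mk.injEq, add_left_inj] at hxy
    rw [← hxy.1, ← hxy.2]; exact hy
  let W : Submodule (ZMod p) (Ch p (Finset (ZMod p × Fin N))) := Su {m | ∀ s ∈ m, GoodS s}
  refine alg_core (p := p) n (fun k => mp r (sd b (k+1) (h k))) ?_ ?_ ?_
  · obtain ⟨x, hx⟩ := H2.zero
    exact ⟨r x, by simp [hx, mp_g1]⟩
  · intro k hk
    have := H2.bd k hk
    rw [bd_mp, this]
    refine op_nat (mp (p := p) shift) (tau p) (mp r) W ?_ ?_ k _ ?_
    · intro c hc
      refine Su_map ?_ hc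
      intro m hm
      rw [mp_g1]
      apply g1_mem
      intro s hs
      obtain ⟨t, ht, rfl⟩ := List.mem_map.1 hs
      exact hshift t (hm t ht)
    · intro c hc
      refine Su_eq (f := mp r ∘ₗ mp shift) (g := tau p ∘ₗ mp r) ?_ hc
      intro m hm
      simp only [LinearMap.comp_apply, tau, mp_g1, List.map_map]
      congr 1
      apply List.map_congr_left
      intro s hs
      exact hr s (hm s hs)
    · exact Su_mono (fun m hm => hm.2.1) (hS k hk.le)
  · refine Su_map ?_ (hS n le_rfl)
    rintro m ⟨h1, h2, h3⟩
    rw [mp_g1]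
    apply g1_mem
    intro hc
    rw [List.isChain_map] at hc
    match m, h1 with
    | s :: L, h1 =>
      have h4 : (s :: L).IsChain (fun a b => b ⊂ a) := by
        have h5 := h3.isChain
        have h6 := chain_and h5 hc
        refine h6.imp ?_
        intro a b hab
        exact Finset.ssubset_iff_subset_ne.2 ⟨hab.1, fun h => hab.2 (by rw [h])⟩
      have h7 := chain_card L s h4 (fun t ht => (h2 t ht).1)
      have h8 := (h2 s (by simp)).card
      omega

end tucker

section geom
set_option linter.unusedSectionVars false

noncomputable def bary {E : Type*} [AddCommGroup E] [Module ℝ E] (l : List E) : E :=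
  (l.length : ℝ)⁻¹ • l.sum

lemma bary_map {E : Type*} [AddCommGroup E] [Module ℝ E] (T : E →ₗ[ℝ] E) (l : List E) :
    bary (l.map T) = T (bary l) := by
  simp [bary, map_list_sum]

lemma sum_mem_convex {E : Type*} [AddCommGroup E] [Module ℝ E] {s : Set E} (hs : Convex ℝ s)
    (l : List E) (hl : l ≠ []) (h : ∀ v ∈ l, v ∈ s) : bary l ∈ s := by
  have hpos : 0 < l.length := List.length_pos_iff.2 hl
  have h1 : bary l = ∑ i : Fin l.length, (l.length : ℝ)⁻¹ • l[i] := by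
    rw [bary, ← Finset.smul_sum]
    congr 1
    exact (Fin.sum_univ_getElem l).symm
  rw [h1]
  refine hs.sum_mem (fun i _ => by positivity) ?_ (fun i _ => h _ (List.getElem_mem _))
  simp
  field_simp

lemma list_norm {E : Type*} [NormedAddCommGroup E] [NormedSpace ℝ E] (l : List E) (v : E) (D : ℝ)
    (h : ∀ w ∈ l, ‖w - v‖ ≤ D) : ‖l.sum - (l.length : ℝ) • v‖ ≤ l.length * D := by
  induction l with
  | nil => simp
  | cons a l ih =>
    have h1 := ih fun w hw => h w (List.mem_cons_of_mem _ hw)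
    have h2 := h a (by simp)
    have : (a :: l).sum - ((a :: l).length : ℝ) • v = (a - v) + (l.sum - (l.length : ℝ) • v) := by
      simp only [List.sum_cons, List.length_cons]
      push_cast
      module
    rw [this]
    refine (norm_add_le _ _).trans ?_
    simp only [List.length_cons]
    push_cast
    linarith

lemma bary_dist_vertex {E : Type*} [NormedAddCommGroup E] [NormedSpace ℝ E] (l : List E) (v : E)
    (hv : v ∈ l) (D : ℝ) (M : ℕ) (hM : l.length ≤ M) (hD : 0 ≤ D)
    (h : ∀ w ∈ l, dist w v ≤ D) : dist v (bary l) ≤ D * (1 - 1 / M) := by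
  obtain ⟨l1, l2, rfl⟩ := List.append_of_mem hv
  have h1 := list_norm (l1 ++ l2) v D (by
    intro w hw
    rw [← dist_eq_norm]
    apply h
    simp only [List.mem_append, List.mem_cons] at hw ⊢
    tauto)
  have hn : ((l1 ++ v :: l2).length : ℝ) = (l1 ++ l2).length + 1 := by
    simp; ring
  set n := (l1 ++ l2).length
  have e : bary (l1 ++ v :: l2) - v = ((n : ℝ) + 1)⁻¹ • ((l1 ++ l2).sum - (n : ℝ) • v) := by
    have hs : (l1 ++ v :: l2).sum = v + (l1 ++ l2).sum := by
      simp; abel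
    rw [bary, hn, hs]
    have : v = ((n : ℝ) + 1)⁻¹ • (((n : ℝ) + 1) • v) := by
      rw [smul_smul, inv_mul_cancel₀ (by positivity), one_smul]
    nth_rw 2 [this]
    rw [← smul_sub]
    congr 1
    module
  rw [dist_comm, dist_eq_norm, e, norm_smul, Real.norm_of_nonneg (by positivity)]
  have hn1 : ((n : ℝ) + 1) ≤ M := by
    rw [← hn]; exact_mod_cast hM
  have hn0 : (0 : ℝ) < (n : ℝ) + 1 := by positivity
  calc ((n : ℝ) + 1)⁻¹ * ‖(l1 ++ l2).sum - (n : ℝ) • v‖ ≤ ((n : ℝ) + 1)⁻¹ * (n * D) := by gcongr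
    _ = D * (1 - 1 / ((n : ℝ) + 1)) := by field_simp; ring
    _ ≤ D * (1 - 1 / M) := by gcongr

lemma bary_dist {E : Type*} [NormedAddCommGroup E] [NormedSpace ℝ E] (l l' : List E) (hl' : l' ≠ [])
    (hs : l'.Sublist l) (D : ℝ) (M : ℕ) (hM : l.length ≤ M) (hD : 0 ≤ D)
    (h : ∀ v ∈ l, ∀ w ∈ l, dist w v ≤ D) : dist (bary l') (bary l) ≤ D * (1 - 1 / M) := by
  have := sum_mem_convex (convex_closedBall (bary l) (D * (1 - 1 / M))) l' hl' (by
    intro v hv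
    exact bary_dist_vertex l v (hs.subset hv) D M hM hD (h v (hs.subset hv)))
  exact this

lemma pair_or {α : Type*} (R : α → α → Prop) (hR : ∀ a, R a a) (l : List α) (h : l.Pairwise R) :
    ∀ a ∈ l, ∀ b ∈ l, R a b ∨ R b a := by
  induction l with
  | nil => simp
  | cons x l ih =>
    rw [List.pairwise_cons] at h
    intro a ha b hb
    rcases List.mem_cons.1 ha with h1 | h1 <;> rcases List.mem_cons.1 hb with h2 | h2
    · subst h1; subst h2; exact Or.inl (hR _)
    · subst h1; exact Or.inl (h.1 b h2)
    · subst h2; exact Or.inr (h.1 a h1)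
    · exact ih h.2 a h1 b h2

/-- one subdivision step, supports -/
lemma sd_bary_supp {p : ℕ} {E : Type*} [NormedAddCommGroup E] [NormedSpace ℝ E]
    {ι : Type*} (K : ι → Set E) (hK : ∀ i, Convex ℝ (K i)) (n M : ℕ) (hn : n ≤ M) (D : ℝ) (hD : 0 ≤ D)
    {c : Ch p E} (hc : c ∈ Su (p := p) {l : List E | l.length = n ∧ (∃ i, ∀ v ∈ l, v ∈ K i) ∧
      ∀ v ∈ l, ∀ w ∈ l, dist w v ≤ D}) :
    sd bary n c ∈ Su (p := p) {l : List E | l.length = n ∧ (∃ i, ∀ v ∈ l, v ∈ K i) ∧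
      ∀ v ∈ l, ∀ w ∈ l, dist w v ≤ D * (1 - 1 / M)} := by
  refine Su_map ?_ hc
  rintro l ⟨h1, ⟨i, h2⟩, h3⟩
  refine Su_mono ?_ (sd_flag bary n l h1)
  rintro _ ⟨fl, rfl, f1, f2, f3⟩
  refine ⟨by simpa using f1, ⟨i, ?_⟩, ?_⟩
  · intro v hv
    obtain ⟨l', hl', rfl⟩ := List.mem_map.1 hv
    exact sum_mem_convex (hK i) l' (f3 l' hl').1 fun w hw => h2 w ((f3 l' hl').2.subset hw)
  · have key : ∀ l1 ∈ fl, ∀ l2 ∈ fl, l2.Sublist l1 → dist (bary l2) (bary l1) ≤ D * (1 - 1 / M) := by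
      intro l1 hl1 l2 hl2 h12
      refine bary_dist l1 l2 (f3 l2 hl2).1 h12 D M ?_ hD ?_
      · exact ((f3 l1 hl1).2.length_le).trans (by omega)
      · intro v hv w hw
        exact h3 v ((f3 l1 hl1).2.subset hv) w ((f3 l1 hl1).2.subset hw)
    intro v hv w hw
    obtain ⟨l1, hl1, rfl⟩ := List.mem_map.1 hv
    obtain ⟨l2, hl2, rfl⟩ := List.mem_map.1 hw
    have hor : l2.Sublist l1 ∨ l1.Sublist l2 := by
      exact pair_or (fun l1 l2 : List E => l2.Sublist l1) (fun l => List.Sublist.refl l) fl f2 l1 hl1 l2 hl2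
    rcases hor with h | h
    · exact key l1 hl1 l2 hl2 h
    · rw [dist_comm]; exact key l2 hl2 l1 hl1 h

/-- iterated subdivision -/
noncomputable def sdI {p : ℕ} {E : Type*} [AddCommGroup E] [Module ℝ E] (h : ℕ → Ch p E) :
    ℕ → ℕ → Ch p E
  | 0 => h
  | t + 1 => fun k => sd bary (k+1) (sdI h t k)

variable {p : ℕ} [Fact p.Prime] {M : ℕ}

abbrev EE (p M : ℕ) := Fin M → ZMod p → ℝ

def TT (p M : ℕ) : EE p M →ₗ[ℝ] EE p M where
  toFun v := fun i g => v i (g - 1)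
  map_add' _ _ := rfl
  map_smul' _ _ := rfl

def ev (p M : ℕ) (k : ℕ) (g : ZMod p) : EE p M := fun i g' => if i.val = k ∧ g' = g then 1 else 0

lemma TT_ev (k : ℕ) (g : ZMod p) : TT p M (ev p M k g) = ev p M k (g + 1) := by
  funext i g'
  simp only [TT, ev, LinearMap.coe_mk, AddHom.coe_mk, sub_eq_iff_eq_add]

lemma TT_iter (n : ℕ) (v : EE p M) : (TT p M)^[n] v = fun i g => v i (g - n) := by
  induction n with
  | zero => simp
  | succ n ih =>
    rw [Function.iterate_succ_apply', ih]
    funext i g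
    simp only [TT, LinearMap.coe_mk, AddHom.coe_mk]
    congr 1
    push_cast
    ring

noncomputable def hh (p M : ℕ) : ℕ → Ch p (EE p M)
  | 0 => g1 p [ev p M 0 0]
  | k + 1 => cone (ev p M (k+1) 0) (op (mp (p := p) (TT p M)) k (hh p M k))

lemma hh_supp (k : ℕ) : hh p M k ∈ Su (p := p) {l : List (EE p M) | l.length = k + 1 ∧
    ∃ g : ℕ → ZMod p, ∀ v ∈ l, ∃ i ≤ k, v = ev p M i (g i)} := by
  induction k with
  | zero =>
    refine g1_mem ⟨rfl, fun _ => 0, ?_⟩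
    intro v hv
    exact ⟨0, le_rfl, by simpa using hv⟩
  | succ k ih =>
    have h1 : op (mp (p := p) (TT p M)) k (hh p M k) ∈ Su (p := p) {l : List (EE p M) | l.length = k + 1 ∧
      ∃ g : ℕ → ZMod p, ∀ v ∈ l, ∃ i ≤ k, v = ev p M i (g i)} := by
      refine op_mem _ _ ?_ k _ ih
      intro c hc
      refine Su_map ?_ hc
      rintro l ⟨h1, g, h2⟩
      rw [mp_g1]
      refine g1_mem ⟨by simpa using h1, fun i => g i + 1, ?_⟩
      intro v hv
      obtain ⟨w, hw, rfl⟩ := List.mem_map.1 hv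
      obtain ⟨i, hi, rfl⟩ := h2 w hw
      exact ⟨i, hi, TT_ev _ _⟩
    refine Su_map ?_ h1
    rintro l ⟨h1, g, h2⟩
    rw [cone_g1]
    refine g1_mem ⟨by simpa using h1, fun i => if i = k + 1 then 0 else g i, ?_⟩
    intro v hv
    rcases List.mem_cons.1 hv with rfl | hv
    · exact ⟨k+1, le_rfl, by simp⟩
    · obtain ⟨i, hi, rfl⟩ := h2 v hv
      exact ⟨i, by omega, by simp only; rw [if_neg (by omega)]⟩

lemma hh_Sq (n : ℕ) : Sq (p := p) (TT p M) n (hh p M) := by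
  have hp : (mp (p := p) (TT p M) : Module.End (ZMod p) (Ch p (EE p M))) ^ p = 1 := by
    apply mp_pow_eq_one
    intro v
    rw [TT_iter]
    simp
  have hcomm : ∀ k c, bd (op (mp (p := p) (TT p M)) k c) = op (mp (p := p) (TT p M)) k (bd c) := by
    intro k c
    exact op_nat (mp (p := p) (TT p M)) (mp (p := p) (TT p M)) bd ⊤ (by simp)
      (fun c _ => bd_mp _ _) k c trivial
  have key : ∀ k, bd (hh p M (k+1)) = op (mp (p := p) (TT p M)) k (hh p M k) := by
    intro k
    induction k with
    | zero =>
      have : bd (op (mp (p := p) (TT p M)) 0 (hh p M 0)) = 0 := by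
        rw [hcomm]
        simp [hh, bd_cons, bd_nil, op, mp_pow]
        rw [← Nat.cast_smul_eq_nsmul (ZMod p)]
        simp
      have e : hh p M (0+1) = cone (ev p M (0+1) 0) (op (mp (p := p) (TT p M)) 0 (hh p M 0)) := rfl
      rw [e, bd_cone, this, map_zero, sub_zero]
    | succ k ih =>
      rw [hh, bd_cone, hcomm, ih, op_op _ hp, map_zero, sub_zero]
  refine ⟨⟨_, rfl⟩, fun k _ => key k, fun k _ => ?_⟩
  exact Su_mono (fun l hl => hl.1) (hh_supp k)

/-- cells -/
def KK (p M : ℕ) (g : Fin M → ZMod p) : Set (EE p M) :=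
  {v | (∀ i g', 0 ≤ v i g') ∧ (∑ i, v i (g i) = 1) ∧ ∀ i g', g' ≠ g i → v i g' = 0}

lemma KK_convex (g : Fin M → ZMod p) : Convex ℝ (KK p M g) := by
  rintro v ⟨h1, h2, h3⟩ w ⟨h1', h2', h3'⟩ a b ha hb hab
  refine ⟨fun i g' => ?_, ?_, fun i g' hg => ?_⟩
  · have := h1 i g'
    have := h1' i g'
    simp only [Pi.add_apply, Pi.smul_apply, smul_eq_mul]
    positivity
  · simp only [Pi.add_apply, Pi.smul_apply, smul_eq_mul, Finset.sum_add_distrib,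
      ← Finset.mul_sum, h2, h2', mul_one, hab]
  · simp [h3 i g' hg, h3' i g' hg]

lemma KK_le_one {g : Fin M → ZMod p} {v : EE p M} (hv : v ∈ KK p M g) (i : Fin M) (g' : ZMod p) :
    v i g' ≤ 1 := by
  by_cases h : g' = g i
  · subst h
    rw [← hv.2.1]
    exact Finset.single_le_sum (f := fun i => v i (g i)) (fun i _ => hv.1 i _) (Finset.mem_univ i)
  · rw [hv.2.2 i g' h]; norm_num


lemma KK_compact (g : Fin M → ZMod p) : IsCompact (KK p M g) := by
  have h1 : IsClosed (KK p M g) := by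
    have : KK p M g = (⋂ i, ⋂ g', {v : EE p M | 0 ≤ v i g'}) ∩ {v : EE p M | ∑ i, v i (g i) = 1} ∩
      (⋂ i, ⋂ g', {v : EE p M | g' ≠ g i → v i g' = 0}) := by
      ext v
      simp [KK, and_assoc]
    rw [this]
    refine IsClosed.inter (IsClosed.inter ?_ ?_) ?_
    · exact isClosed_iInter fun i => isClosed_iInter fun g' => isClosed_le (by fun_prop) (by fun_prop)
    · exact isClosed_eq (by fun_prop) (by fun_prop)
    · refine isClosed_iInter fun i => isClosed_iInter fun g' => ?_
      by_cases h : g' = g i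
      · simp [h]
      · simp only [ne_eq, h, not_false_eq_true, forall_const]
        exact isClosed_eq (by fun_prop) (by fun_prop)
  refine IsCompact.of_isClosed_subset (isCompact_univ_pi (s := fun _ : Fin M => Set.pi Set.univ (fun _ : ZMod p => Set.Icc (0:ℝ) 1)) fun i => isCompact_univ_pi fun g' => isCompact_Icc) h1 ?_
  intro v hv i _ g' _
  exact ⟨hv.1 i g', KK_le_one hv i g'⟩

lemma KK_dist {g : Fin M → ZMod p} {v w : EE p M} (hv : v ∈ KK p M g) (hw : w ∈ KK p M g) :
    dist v w ≤ 1 := by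
  refine (dist_pi_le_iff (by norm_num)).2 fun i => (dist_pi_le_iff (by norm_num)).2 fun g' => ?_
  rw [Real.dist_eq, abs_le]
  have := hv.1 i g'
  have := hw.1 i g'
  have := KK_le_one hv i g'
  have := KK_le_one hw i g'
  constructor <;> linarith

lemma ev_mem {k : ℕ} (hk : k < M) (g : ℕ → ZMod p) : ev p M k (g k) ∈ KK p M (fun i => g i) := by
  refine ⟨fun i g' => ?_, ?_, fun i g' h => ?_⟩
  · simp only [ev]; split_ifs <;> norm_num
  · rw [Finset.sum_eq_single ⟨k, hk⟩]
    · simp [ev]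
    · intro b _ hb
      simp only [ev]
      rw [if_neg]
      rintro ⟨h, -⟩
      exact hb (Fin.ext h)
    · simp
  · simp only [ev]
    rw [if_neg]
    rintro ⟨rfl, h'⟩
    exact h h'

lemma fine (n : ℕ) (hn : n + 1 = M) (δ : ℝ) (hδ : 0 < δ) : ∃ h : ℕ → Ch p (EE p M),
    Sq (p := p) (TT p M) n h ∧ ∀ k ≤ n, h k ∈ Su (p := p) {l : List (EE p M) | l.length = k + 1 ∧
      (∃ g, ∀ v ∈ l, v ∈ KK p M g) ∧ ∀ v ∈ l, ∀ w ∈ l, dist w v < δ} := by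
  have hM : (0 : ℝ) < M := by rw [← hn]; positivity
  have hM1 : (1 : ℝ) ≤ M := by rw [← hn]; push_cast; linarith [(Nat.cast_nonneg n : (0:ℝ) ≤ n)]
  set q : ℝ := 1 - 1 / M
  have hq0 : 0 ≤ q := by
    have : 1 / (M : ℝ) ≤ 1 := by rw [div_le_one hM]; exact hM1
    simp only [q]; linarith
  have hq1 : q < 1 := by
    have : 0 < 1 / (M : ℝ) := by positivity
    simp only [q]; linarith
  have hit : ∀ t, Sq (p := p) (TT p M) n (sdI (hh p M) t) ∧ ∀ k ≤ n, sdI (hh p M) t k ∈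
      Su (p := p) {l : List (EE p M) | l.length = k + 1 ∧
      (∃ g, ∀ v ∈ l, v ∈ KK p M g) ∧ ∀ v ∈ l, ∀ w ∈ l, dist w v ≤ q ^ t} := by
    intro t
    induction t with
    | zero =>
      refine ⟨hh_Sq n, fun k hk => Su_mono ?_ (hh_supp k)⟩
      rintro l ⟨h1, g, h2⟩
      have h3 : ∀ v ∈ l, v ∈ KK p M (fun i => g i) := by
        intro v hv
        obtain ⟨i, hi, rfl⟩ := h2 v hv
        exact ev_mem (by omega) g
      refine ⟨h1, ⟨_, h3⟩, fun v hv w hw => ?_⟩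
      rw [pow_zero]
      exact KK_dist (h3 w hw) (h3 v hv)
    | succ t ih =>
      refine ⟨ih.1.sd bary (bary_map (TT p M)), fun k hk => ?_⟩
      rw [pow_succ]
      exact sd_bary_supp (KK p M) KK_convex (k+1) M (by omega) _ (by positivity) (ih.2 k hk)
  obtain ⟨t, ht⟩ := exists_pow_lt_of_lt_one hδ hq1
  refine ⟨_, (hit t).1, fun k hk => Su_mono ?_ ((hit t).2 k hk)⟩
  rintro l ⟨h1, h2, h3⟩
  exact ⟨h1, h2, fun v hv w hw => (h3 v hv w hw).trans_lt ht⟩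

end geom

section hobby
variable {p : ℕ} [Fact p.Prime] {M : ℕ}

noncomputable def cc (v : EE p M) (i : ℕ) : ℝ :=
  ∑ i' ∈ Finset.univ.filter (fun i' : Fin M => i'.val < i), ∑ g, v i' g

noncomputable def FF (G : ℝ → ℝ) (γ : ZMod p) (v : EE p M) : ℝ :=
  ∑ i : Fin M, (G (cc v i + v i γ) - G (cc v i))

lemma FF_cont (G : ℝ → ℝ) (hG : Continuous G) (γ : ZMod p) :
    Continuous (FF G γ : EE p M → ℝ) := by
  unfold FF cc
  fun_prop

lemma cc_TT (v : EE p M) (i : ℕ) : cc (TT p M v) i = cc v i := by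
  unfold cc
  refine Finset.sum_congr rfl fun i' _ => ?_
  exact Equiv.sum_comp (Equiv.subRight (1 : ZMod p)) (fun g => v i' g)

lemma FF_TT (G : ℝ → ℝ) (γ : ZMod p) (v : EE p M) : FF G γ (TT p M v) = FF G (γ - 1) v := by
  unfold FF
  simp only [cc_TT]
  rfl

lemma row_sum {g : Fin M → ZMod p} {v : EE p M} (hv : v ∈ KK p M g) (i : Fin M) :
    ∑ g', v i g' = v i (g i) := by
  refine Finset.sum_eq_single _ (fun b _ hb => hv.2.2 i b hb) (by simp)

lemma cc_zero (v : EE p M) : cc v 0 = 0 := by simp [cc]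

lemma cc_succ {g : Fin M → ZMod p} {v : EE p M} (hv : v ∈ KK p M g) (i : Fin M) :
    cc v (i + 1) = cc v i + v i (g i) := by
  unfold cc
  have : Finset.univ.filter (fun i' : Fin M => i'.val < i.val + 1) =
      insert i (Finset.univ.filter (fun i' : Fin M => i'.val < i.val)) := by
    ext j
    simp only [Finset.mem_filter, Finset.mem_univ, true_and, Finset.mem_insert, Fin.ext_iff]
    omega
  rw [this, Finset.sum_insert (by simp), row_sum hv]
  ring

lemma cc_last {g : Fin M → ZMod p} {v : EE p M} (hv : v ∈ KK p M g) : cc v M = 1 := by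
  unfold cc
  rw [← hv.2.1, Finset.filter_true_of_mem (fun i _ => i.2)]
  exact Finset.sum_congr rfl fun i _ => row_sum hv i

lemma cc_mono {g : Fin M → ZMod p} {v : EE p M} (hv : v ∈ KK p M g) : Monotone (cc v) := by
  intro a b hab
  unfold cc
  refine Finset.sum_le_sum_of_subset_of_nonneg ?_ ?_
  · intro i
    simp only [Finset.mem_filter, Finset.mem_univ, true_and]
    omega
  · intro i _ _
    exact Finset.sum_nonneg fun g' _ => hv.1 i g'

lemma FF_eq (G : ℝ → ℝ) {g : Fin M → ZMod p} {v : EE p M} (hv : v ∈ KK p M g) (γ : ZMod p) :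
    FF G γ v = ∑ i ∈ Finset.univ.filter (fun i : Fin M => g i = γ),
      (G (cc v (i + 1)) - G (cc v i)) := by
  rw [Finset.sum_filter, FF]
  refine Finset.sum_congr rfl fun i _ => ?_
  split_ifs with h
  · subst h
    rw [cc_succ hv]
  · rw [hv.2.2 i γ (fun h' => h h'.symm)]
    simp

lemma FF_sum (G : ℝ → ℝ) {g : Fin M → ZMod p} {v : EE p M} (hv : v ∈ KK p M g) :
    ∑ γ, FF G γ v = G 1 - G 0 := by
  simp only [FF_eq G hv]
  rw [Finset.sum_fiberwise]
  rw [Fin.sum_univ_eq_sum_range (fun i => G (cc v (i+1)) - G (cc v i)) M,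
    Finset.sum_range_sub (fun i => G (cc v i)), cc_zero, cc_last hv]

lemma TT_dist (v w : EE p M) : dist (TT p M v) (TT p M w) = dist v w := by
  have key : ∀ v w : EE p M, dist (TT p M v) (TT p M w) ≤ dist v w := by
    intro v w
    refine (dist_pi_le_iff dist_nonneg).2 fun i => (dist_pi_le_iff dist_nonneg).2 fun g' => ?_
    exact (dist_le_pi_dist (v i) (w i) (g' - 1)).trans (dist_le_pi_dist v w i)
  have keyn : ∀ n, ∀ v w : EE p M, dist ((TT p M)^[n] v) ((TT p M)^[n] w) ≤ dist v w := by
    intro n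
    induction n with
    | zero => simp
    | succ n ih =>
      intro v w
      rw [Function.iterate_succ_apply, Function.iterate_succ_apply]
      exact (ih _ _).trans (key _ _)
  refine le_antisymm (key v w) ?_
  have h := keyn (p - 1) (TT p M v) (TT p M w)
  have hp : (p - 1) + 1 = p := Nat.sub_add_cancel (Fact.out : p.Prime).one_lt.le
  rw [← Function.iterate_succ_apply, ← Function.iterate_succ_apply, Nat.succ_eq_add_one, hp,
    TT_iter, TT_iter] at h
  simpa using h

lemma TT_surj (w : EE p M) : ∃ u, TT p M u = w := by
  refine ⟨fun i g => w i (g + 1), ?_⟩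
  funext i g
  simp [TT]

theorem hobby (N : ℕ) (G : Fin N → ℝ → ℝ) (hG : ∀ j, Continuous (G j)) (hM : N * (p - 1) + 1 = M) :
    ∃ (g : Fin M → ZMod p) (v : EE p M), v ∈ KK p M g ∧
      ∀ j γ, FF (G j) γ v = (G j 1 - G j 0) / p := by
  classical
  by_contra hcon
  push Not at hcon
  have hp0 : (0 : ℝ) < p := by exact_mod_cast (Fact.out : p.Prime).pos
  let U : ZMod p × Fin N → Set (EE p M) := fun x => {v | (G x.2 1 - G x.2 0) / p < FF (G x.2) x.1 v}
  have hU : ∀ x, IsOpen (U x) := fun x => isOpen_lt continuous_const (FF_cont _ (hG _) _)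
  have hK : IsCompact (⋃ g, KK p M g) := isCompact_iUnion KK_compact
  have hsumc : ∀ j : Fin N, ∑ _γ : ZMod p, (G j 1 - G j 0) / p = G j 1 - G j 0 := by
    intro j
    simp [ZMod.card]
    field_simp
  have hcov : (⋃ g, KK p M g) ⊆ ⋃ x, U x := by
    intro v hv
    obtain ⟨g, hv⟩ := Set.mem_iUnion.1 hv
    obtain ⟨j, γ, hne⟩ := hcon g v hv
    by_contra hno
    have hle : ∀ γ, FF (G j) γ v ≤ (G j 1 - G j 0) / p := by
      intro γ
      by_contra h
      exact hno (Set.mem_iUnion.2 ⟨(γ, j), not_le.1 h⟩)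
    have hs : ∑ γ, FF (G j) γ v = ∑ _γ : ZMod p, (G j 1 - G j 0) / p := by
      rw [FF_sum _ hv, hsumc]
    exact hne ((Finset.sum_eq_sum_iff_of_le fun γ _ => hle γ).1 hs γ (Finset.mem_univ _))
  obtain ⟨δ, hδ, hL⟩ := lebesgue_number_lemma_of_metric hK hU hcov
  let lab : EE p M → Finset (ZMod p × Fin N) := fun v =>
    Finset.univ.filter fun x => Metric.ball v δ ⊆ U x
  have hlab : ∀ v, lab (TT p M v) = shift (lab v) := by
    intro v
    have h1 : ∀ (x : ZMod p) (j : Fin N), Metric.ball (TT p M v) δ ⊆ U (x + 1, j) ↔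
        Metric.ball v δ ⊆ U (x, j) := by
      intro x j
      constructor
      · intro h w hw
        have := @h (TT p M w) (by rw [Metric.mem_ball, TT_dist]; exact hw)
        simpa [U, FF_TT] using this
      · intro h w hw
        obtain ⟨u, rfl⟩ := TT_surj w
        have := @h u (by rw [Metric.mem_ball, TT_dist] at hw; exact hw)
        simpa [U, FF_TT] using this
    ext ⟨x, j⟩
    simp only [lab, shift, Finset.mem_filter, Finset.mem_univ, true_and, Finset.mem_image,
      Prod.exists, Prod.mk.injEq]
    constructor
    · intro h
      refine ⟨x - 1, j, ?_, by ring, rfl⟩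
      rw [← h1]
      simpa using h
    · rintro ⟨y, j', h, rfl, rfl⟩
      exact (h1 _ _).2 h
  obtain ⟨h, hSq, hsup⟩ := fine (p := p) (N * (p - 1)) hM δ hδ
  have := tucker_core (TT p M) (N * (p-1)) h hSq lab hlab (by
    intro k hk
    refine Su_mono ?_ (hsup k hk)
    rintro l ⟨h1, ⟨g, h2⟩, h3⟩
    refine ⟨h1, ?_, ?_⟩
    · intro v hv
      obtain ⟨x, hx⟩ := hL v (Set.mem_iUnion.2 ⟨g, h2 v hv⟩)
      exact ⟨x, by simpa [lab] using hx⟩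
    · intro j
      by_contra hall
      push Not at hall
      obtain ⟨v0, hv0⟩ : ∃ v, v ∈ l := List.exists_mem_of_ne_nil l (by rintro rfl; simp at h1)
      have hlt : ∀ γ, (G j 1 - G j 0) / p < FF (G j) γ v0 := by
        intro γ
        obtain ⟨v, hv, hx⟩ := hall γ
        have hx' : Metric.ball v δ ⊆ U (γ, j) := by simpa [lab] using hx
        exact hx' (h3 v hv v0 hv0)
      have := Finset.sum_lt_sum_of_nonempty (s := (Finset.univ : Finset (ZMod p)))
        Finset.univ_nonempty (fun γ _ => hlt γ)
      rw [hsumc, FF_sum _ (h2 v0 hv0)] at this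
      exact lt_irrefl _ this)
  omega

end hobby

section split

def Split (k : ℕ) : Prop := ∀ (N : ℕ) (μ : Fin N → Measure ℝ), (∀ j, IsFiniteMeasure (μ j)) →
  (∀ j, NullSingletonClass (μ j)) → ∃ (ℓ : ℝ → Fin k) (B : Finset ℝ), B.card ≤ N * (k - 1) ∧
    (∀ x y, x ≤ y → (∀ b ∈ B, ¬ (x ≤ b ∧ b < y)) → ℓ x = ℓ y) ∧ Measurable ℓ ∧
    ∀ j g, (μ j).real (Ioc 0 1 ∩ ℓ ⁻¹' {g}) = (μ j).real (Ioc 0 1) / k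

lemma split_one : Split 1 := by
  intro N μ _ _
  refine ⟨fun _ => 0, ∅, by simp, fun _ _ _ _ => rfl, measurable_const, ?_⟩
  intro j g
  have : (fun _ : ℝ => (0 : Fin 1)) ⁻¹' {g} = Set.univ := by
    ext x; simp [Subsingleton.elim g 0]
  simp [this]

lemma split_mul {a b : ℕ} (ha : 0 < a) (hb : 0 < b) (hA : Split a) (hB : Split b) : Split (a * b) := by
  classical
  intro N μ hf hna
  obtain ⟨ℓ, B, hc, hconst, hm, hval⟩ := hA N μ hf hna
  have h2 : ∀ g : Fin a, ∃ (ℓ' : ℝ → Fin b) (B' : Finset ℝ), B'.card ≤ N * (b - 1) ∧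
    (∀ x y, x ≤ y → (∀ b ∈ B', ¬ (x ≤ b ∧ b < y)) → ℓ' x = ℓ' y) ∧ Measurable ℓ' ∧
    ∀ j g', (μ j).real (Ioc 0 1 ∩ ℓ ⁻¹' {g} ∩ ℓ' ⁻¹' {g'}) = (μ j).real (Ioc 0 1) / (a * b) := by
    intro g
    obtain ⟨ℓ', B', h1, h2, h3, h4⟩ := hB N (fun j => (μ j).restrict (ℓ ⁻¹' {g}))
      (fun j => by have := hf j; infer_instance) (fun j => by have := hna j; infer_instance)
    refine ⟨ℓ', B', h1, h2, h3, fun j g' => ?_⟩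
    have := h4 j g'
    rw [measureReal_restrict_apply (measurableSet_Ioc.inter (h3 (measurableSet_singleton g'))),
      measureReal_restrict_apply measurableSet_Ioc, hval] at this
    rw [Set.inter_right_comm, this, div_div]
  choose ℓ' B' h1 h2 h3 h4 using h2
  refine ⟨fun x => finProdFinEquiv (ℓ x, ℓ' (ℓ x) x), B ∪ Finset.univ.biUnion B', ?_, ?_, ?_, ?_⟩
  · refine (Finset.card_union_le _ _).trans ?_
    have : (Finset.univ.biUnion B').card ≤ a * (N * (b - 1)) := by
      refine Finset.card_biUnion_le.trans ?_
      refine (Finset.sum_le_card_nsmul _ _ _ fun g _ => h1 g).trans ?_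
      simp
    refine (add_le_add hc this).trans (le_of_eq ?_)
    obtain ⟨a, rfl⟩ := Nat.exists_eq_succ_of_ne_zero ha.ne'
    obtain ⟨b, rfl⟩ := Nat.exists_eq_succ_of_ne_zero hb.ne'
    have : (a.succ) * b.succ - 1 = a + a.succ * b := by
      have : a.succ * b.succ = (a + a.succ * b) + 1 := by simp only [Nat.succ_eq_add_one]; ring
      omega
    rw [this]
    simp only [Nat.succ_eq_add_one, Nat.add_sub_cancel]
    ring
  · intro x y hxy hno
    have e1 : ℓ x = ℓ y := hconst x y hxy fun b hb => hno b (Finset.mem_union_left _ hb)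
    have e2 : ℓ' (ℓ x) x = ℓ' (ℓ x) y := h2 _ x y hxy fun b hb => hno b
      (Finset.mem_union_right _ (Finset.mem_biUnion.2 ⟨_, Finset.mem_univ _, hb⟩))
    simp only [e1] at e2 ⊢
    rw [e2]
  · have : Measurable (fun x => (ℓ x, ℓ' (ℓ x) x)) := by
      refine hm.prodMk ?_
      have : Measurable (Function.uncurry fun (x : ℝ) (g : Fin a) => ℓ' g x) :=
        measurable_from_prod_countable_left h3
      exact this.comp (measurable_id.prodMk hm)
    exact (Measurable.of_discrete (f := finProdFinEquiv)).comp this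
  · intro j g
    have : Ioc (0:ℝ) 1 ∩ (fun x => finProdFinEquiv (ℓ x, ℓ' (ℓ x) x)) ⁻¹' {g} =
        Ioc 0 1 ∩ ℓ ⁻¹' {(finProdFinEquiv.symm g).1} ∩
          ℓ' (finProdFinEquiv.symm g).1 ⁻¹' {(finProdFinEquiv.symm g).2} := by
      ext x
      simp only [Set.mem_inter_iff, Set.mem_preimage, Set.mem_singleton_iff, and_assoc]
      refine and_congr_right fun _ => ?_
      rw [← Equiv.eq_symm_apply, Prod.ext_iff]
      simp only
      constructor
      · rintro ⟨h, h'⟩; exact ⟨h, by rw [← h]; rw [h']⟩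
      · rintro ⟨h, h'⟩; exact ⟨h, by rw [h]; exact h'⟩
    rw [this, h4]
    push_cast
    rfl

lemma split_prime {p : ℕ} (hp : p.Prime) : Split p := by
  classical
  intro N μ hf hna
  have : Fact p.Prime := ⟨hp⟩
  let M := N * (p - 1) + 1
  let G : Fin N → ℝ → ℝ := fun j b => ∫ _x in (0:ℝ)..b, (1:ℝ) ∂(μ j)
  have hint : ∀ j a b, IntervalIntegrable (fun _ => (1:ℝ)) (μ j) a b := by
    intro j a b
    have := hf j
    exact (integrable_const 1).intervalIntegrable
  have hG : ∀ j, Continuous (G j) := by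
    intro j
    have := hna j
    exact intervalIntegral.continuous_primitive (fun a b => hint j a b) 0
  have hGd : ∀ j a b, a ≤ b → G j b - G j a = (μ j).real (Ioc a b) := by
    intro j a b hab
    simp only [G]
    rw [intervalIntegral.integral_interval_sub_left (hint _ _ _) (hint _ _ _),
      intervalIntegral.integral_of_le hab]
    simp
  obtain ⟨g, v, hv, hfair⟩ := hobby (p := p) (M := M) N G hG rfl
  have hmono := cc_mono hv
  have h0 := cc_zero v
  have hl := cc_last hv
  set c := cc v with hcdef
  let I : ℝ → Fin M := fun x => ⟨((Finset.range (M-1)).filter fun j => c (j+1) < x).card, by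
    refine lt_of_le_of_lt (Finset.card_filter_le _ _) ?_
    simp [M]⟩
  have hI : ∀ (i : Fin M) x, x ∈ Ioc (c i) (c (i+1)) → I x = i := by
    intro i x hx
    apply Fin.ext
    have : (Finset.range (M-1)).filter (fun j => c (j+1) < x) = Finset.range i := by
      ext j
      simp only [Finset.mem_filter, Finset.mem_range]
      constructor
      · rintro ⟨_, h⟩
        by_contra hji
        have := hmono (show (i:ℕ) + 1 ≤ j + 1 by omega)
        linarith [hx.2]
      · intro h
        refine ⟨by have := i.2; omega, ?_⟩
        exact lt_of_le_of_lt (hmono (show j + 1 ≤ (i:ℕ) by omega)) hx.1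
    simp only [I, this, Finset.card_range]
  have hex : ∀ x ∈ Ioc (0:ℝ) 1, ∃ i : Fin M, x ∈ Ioc (c i) (c (i+1)) := by
    intro x hx
    have hP : ∃ n, x ≤ c (n+1) := ⟨M - 1, by
      have : M - 1 + 1 = M := by simp [M]
      rw [this, hl]; exact hx.2⟩
    have hs := Nat.find_spec hP
    have hlt : Nat.find hP < M := by
      have : Nat.find hP ≤ M - 1 := Nat.find_min' hP (by
        have : M - 1 + 1 = M := by simp [M]
        rw [this, hl]; exact hx.2)
      have : 0 < M := by simp [M]
      omega
    refine ⟨⟨Nat.find hP, hlt⟩, ?_, hs⟩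
    simp only
    by_cases hz : Nat.find hP = 0
    · rw [hz, h0]; exact hx.1
    · have := Nat.find_min hP (m := Nat.find hP - 1) (by omega)
      rw [Nat.sub_add_cancel (by omega)] at this
      exact not_le.1 this
  have hImeas : Measurable I := by
    have h1 : Measurable (fun x => (I x : ℕ)) := by
      have : (fun x => (I x : ℕ)) = fun x => ∑ j ∈ Finset.range (M-1), if c (j+1) < x then 1 else 0 := by
        funext x
        simp only [I, Finset.card_filter]
      rw [this]
      refine Finset.measurable_sum _ fun j _ => ?_
      exact Measurable.ite measurableSet_Ioi measurable_const measurable_const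
    refine measurable_to_countable' fun i => ?_
    have : I ⁻¹' {i} = (fun x => (I x : ℕ)) ⁻¹' {(i : ℕ)} := by
      ext x; simp [Fin.ext_iff]
    rw [this]
    exact h1 (measurableSet_singleton _)
  let e : ZMod p ≃ Fin p := (ZMod.finEquiv p).symm.toEquiv
  refine ⟨fun x => e (g (I x)), (Finset.range (M-1)).image fun j => c (j+1), ?_, ?_, ?_, ?_⟩
  · refine Finset.card_image_le.trans ?_
    simp [M]
  · intro x y hxy hno
    have : I x = I y := by
      apply Fin.ext
      simp only [I]
      congr 1
      apply Finset.filter_congr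
      intro j hj
      constructor
      · intro h; linarith
      · intro h
        by_contra h'
        exact hno _ (Finset.mem_image_of_mem _ hj) ⟨not_lt.1 h', h⟩
    simp only [this]
  · exact (Measurable.of_discrete (f := fun i => e (g i))).comp hImeas
  · intro j γ
    have hset : Ioc (0:ℝ) 1 ∩ (fun x => e (g (I x))) ⁻¹' {γ} =
        ⋃ i ∈ Finset.univ.filter (fun i : Fin M => g i = e.symm γ), Ioc (c i) (c (i+1)) := by
      ext x
      simp only [Set.mem_inter_iff, Set.mem_preimage, Set.mem_singleton_iff, Set.mem_iUnion,
        Finset.mem_filter, Finset.mem_univ, true_and, exists_prop, ← Equiv.eq_symm_apply]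
      constructor
      · rintro ⟨hx, h⟩
        obtain ⟨i, hi⟩ := hex x hx
        rw [hI i x hi] at h
        exact ⟨i, h, hi⟩
      · rintro ⟨i, h, hi⟩
        refine ⟨⟨?_, ?_⟩, by rw [hI i x hi]; exact h⟩
        · refine lt_of_le_of_lt ?_ hi.1
          rw [← h0]; exact hmono (Nat.zero_le _)
        · refine hi.2.trans ?_
          rw [← hl]; exact hmono i.2
    have := hf j
    rw [hset, measureReal_biUnion_finset]
    · have h1 := hfair j (e.symm γ)
      rw [FF_eq _ hv, hGd j 0 1 zero_le_one] at h1
      rw [← h1]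
      refine Finset.sum_congr rfl fun i _ => ?_
      exact (hGd j _ _ (hmono (Nat.le_succ _))).symm
    · intro i _ i' _ hne
      refine Set.disjoint_left.2 fun x hx hx' => hne ?_
      rw [← hI i x hx, ← hI i' x hx']
    · intro i _
      exact measurableSet_Ioc

lemma split_all (k : ℕ) (hk : 0 < k) : Split k := by
  induction k using Nat.recOnMul with
  | zero => omega
  | one => exact split_one
  | prime q hq => exact split_prime hq
  | mul a b iha ihb =>
    have ha : 0 < a := Nat.pos_of_mul_pos_right hk
    have hb : 0 < b := Nat.pos_of_mul_pos_left hk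
    exact split_mul ha hb (iha ha) (ihb hb)

end split

end NS

/-- unanimous-proportional allocation with at most (n-1)(k-1)+1
components, for equal entitlements. -/
theorem unanimous_proportional_upper_bound
    (n k : ℕ) (hn : 1 ≤ n) (hk : 1 ≤ k)
    (V : Fin n → Measure ℝ)
    (hprob : ∀ i, IsProbabilityMeasure (V i))
    (hsupp : ∀ i, V i (Icc (0:ℝ) 1) = 1)
    (hac : ∀ i, V i ≪ volume)
    (f : Fin n → Fin k) :
    ∃ (X : Fin k → Set ℝ) (m : Fin k → ℕ),
      (∀ j, IsUnionOfIntervals (X j) (m j)) ∧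
      Pairwise (Function.onFun Disjoint X) ∧
      (⋃ j, X j) = Icc (0:ℝ) 1 ∧
      (∀ i : Fin n, (V i (X (f i))).toReal ≥ 1 / (k : ℝ)) ∧
      ∑ j, m j ≤ (n - 1) * (k - 1) + 1 := by
  classical
  obtain ⟨N, rfl⟩ : ∃ N, n = N + 1 := ⟨n - 1, by omega⟩
  have hna : ∀ i, NullSingletonClass (V i) := fun i => ⟨fun x => hac i (by simp)⟩
  have hkpos : (0:ℝ) < k := by exact_mod_cast hk
  have hone : ∀ i, (V i).real (Ioc 0 1) = 1 := by
    intro i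
    have := hna i
    rw [measureReal_def, measure_congr (Ioc_ae_eq_Icc (μ := V i)), hsupp]
    simp
  obtain ⟨ℓ, B, hc, hconst, hm, hval⟩ := NS.split_all k hk N (fun j => V j.castSucc)
    (fun j => by have := hprob j.castSucc; infer_instance) (fun j => hna _)
  have hsum : ∑ g, (V (Fin.last N)).real (Ioc 0 1 ∩ ℓ ⁻¹' {g}) = 1 := by
    have := hprob (Fin.last N)
    rw [← measureReal_biUnion_finset]
    · refine Eq.trans ?_ (hone (Fin.last N))
      congr 1
      ext x
      simp
    · intro i _ i' _ hne
      refine Set.disjoint_left.2 fun x hx hx' => hne ?_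
      exact hx.2.symm.trans hx'.2
    · intro i _
      exact measurableSet_Ioc.inter (hm (measurableSet_singleton i))
  obtain ⟨g, hg⟩ : ∃ g, 1 / (k:ℝ) ≤ (V (Fin.last N)).real (Ioc 0 1 ∩ ℓ ⁻¹' {g}) := by
    by_contra! h
    have : ∑ g, (V (Fin.last N)).real (Ioc 0 1 ∩ ℓ ⁻¹' {g}) < ∑ _g : Fin k, 1 / (k:ℝ) :=
      Finset.sum_lt_sum_of_nonempty ⟨⟨0, hk⟩, Finset.mem_univ _⟩ fun g _ => h g
    rw [hsum] at this
    simp [hkpos.ne'] at this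
  let σ := Equiv.swap (f (Fin.last N)) g
  let A : ℝ → Finset ℝ := fun x => insert 0 (B.filter fun b => 0 < b ∧ b < x)
  have hAne : ∀ x, (A x).Nonempty := fun x => Finset.insert_nonempty _ _
  let π : ℝ → ℝ := fun x => (A x).max' (hAne x)
  have hAmono : ∀ x y, x ≤ y → A x ⊆ A y := by
    intro x y hxy
    refine Finset.insert_subset_insert _ fun b hb => ?_
    simp only [Finset.mem_filter] at hb ⊢
    exact ⟨hb.1, hb.2.1, hb.2.2.trans_le hxy⟩
  have hπmono : Monotone π := fun x y hxy => Finset.max'_subset _ (hAmono x y hxy)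
  have hπlt : ∀ x, 0 < x → π x < x := by
    intro x hx
    refine (Finset.max'_lt_iff _ _).2 fun b hb => ?_
    simp only [A, Finset.mem_insert, Finset.mem_filter] at hb
    rcases hb with rfl | hb
    · exact hx
    · exact hb.2.2
  have hπmem : ∀ x, π x ∈ insert 0 B := by
    intro x
    have := Finset.max'_mem (A x) (hAne x)
    exact Finset.insert_subset_insert _ (Finset.filter_subset _ _) this
  have hℓ' : ∀ x y, 0 < x → x ≤ y → π x = π y → ℓ x = ℓ y := by
    intro x y hx hxy h
    refine hconst x y hxy fun b hb hbb => ?_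
    have h1 : b ≤ π y := Finset.le_max' _ _ (by
      simp only [A, Finset.mem_insert, Finset.mem_filter]
      exact Or.inr ⟨hb, hx.trans_le hbb.1, hbb.2⟩)
    have := hπlt x hx
    linarith [hbb.1]
  have hℓ : ∀ x y, 0 < x → 0 < y → π x = π y → ℓ x = ℓ y := by
    intro x y hx hy h
    rcases le_total x y with hxy | hxy
    · exact hℓ' x y hx hxy h
    · exact (hℓ' y x hy hxy h.symm).symm
  obtain ⟨lab, hlab⟩ : ∃ lab : ℝ → Fin k, ∀ x, 0 < x → lab (π x) = σ (ℓ x) := by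
    refine ⟨fun b => if h : ∃ x, 0 < x ∧ π x = b then σ (ℓ h.choose) else ⟨0, hk⟩, fun x hx => ?_⟩
    have h : ∃ y, 0 < y ∧ π y = π x := ⟨x, hx, rfl⟩
    simp only [dif_pos h]
    rw [hℓ _ _ h.choose_spec.1 hx h.choose_spec.2]
  have hsub : ∀ i h, σ h = f i → 1 / (k:ℝ) ≤ (V i).real (Ioc 0 1 ∩ ℓ ⁻¹' {h}) →
      (V i {x | x ∈ Icc (0:ℝ) 1 ∧ lab (π x) = f i}).toReal ≥ 1 / (k:ℝ) := by
    intro i h hσ hle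
    have := hprob i
    refine hle.trans (measureReal_mono (μ := V i) ?_)
    rintro x ⟨hx, hx'⟩
    refine ⟨⟨hx.1.le, hx.2⟩, ?_⟩
    rw [hlab x hx.1, ← hσ]
    congr 1
  refine ⟨fun j => {x | x ∈ Icc (0:ℝ) 1 ∧ lab (π x) = j},
    fun j => ((insert 0 B).filter fun b => lab b = j).card, ?_, ?_, ?_, ?_, ?_⟩
  · intro j
    let e := ((insert 0 B).filter fun b => lab b = j).equivFin
    refine ⟨fun t => {x | x ∈ Icc (0:ℝ) 1 ∧ π x = (e.symm t : ℝ)}, ?_, ?_⟩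
    · intro t
      refine ⟨?_⟩
      rintro x ⟨hx, hx'⟩ y ⟨hy, hy'⟩ z ⟨hz, hz'⟩
      refine ⟨⟨hx.1.trans hz, hz'.trans hy.2⟩, le_antisymm ?_ ?_⟩
      · rw [← hy']; exact hπmono hz'
      · rw [← hx']; exact hπmono hz
    · ext x
      simp only [Set.mem_ofPred_eq, Set.mem_iUnion]
      constructor
      · rintro ⟨hx, h⟩
        exact ⟨e ⟨π x, Finset.mem_filter.2 ⟨hπmem x, h⟩⟩, hx, by simp⟩
      · rintro ⟨t, hx, h⟩
        refine ⟨hx, ?_⟩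
        rw [h]
        exact (Finset.mem_filter.1 (e.symm t).2).2
  · intro i j hij
    refine Set.disjoint_left.2 fun x hx hx' => hij ?_
    exact hx.2.symm.trans hx'.2
  · ext x
    simp
  · intro i
    refine Fin.lastCases ?_ (fun i => ?_) i
    · exact hsub _ g (Equiv.swap_apply_right _ _) hg
    · refine hsub _ (σ (f i.castSucc)) (by simp [σ]) ?_
      have := hval i (σ (f i.castSucc))
      rw [this, hone]
  · rw [← Finset.card_eq_sum_card_fiberwise (fun _ _ => Finset.mem_univ _)]
    refine (Finset.card_insert_le _ _).trans ?_
    simpa using hc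
end

section
/- Given n agents with additive nonatomic probability measures on [0,1] grouped into k families with positive entitlements w_1,...,w_k summing to 1, there exists an allocation with every agent valuing his family's piece at least w_j (unanimous-proportional) using at most ceil(log2 k) * (2n-2) + 1 connected components. -/
open MeasureTheory Set

def altP (b : ℕ) (I : Finset ℕ) (l : ℕ → ℤ) : Prop :=
  ∀ p ∈ I, (0 < l p ↔ Even ((I.filter (fun q => (l q).natAbs < (l p).natAbs)).card + b))

open Classical in
/-- parity-alternation indicator -/
noncomputable def altD (b : ℕ) (I : Finset ℕ) (l : ℕ → ℤ) : ZMod 2 :=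
  if (Set.InjOn (fun p => (l p).natAbs) (I : Set ℕ)) ∧ altP b I l then 1 else 0

lemma altP_insert (b : ℕ) (I : Finset ℕ) (l : ℕ → ℤ) (a : ℕ) (_ : a ∉ I)
    (h : ∀ x ∈ I, (l x).natAbs < (l a).natAbs) :
    altP b (insert a I) l ↔ altP b I l ∧ (0 < l a ↔ Even (I.card + b)) := by
  have h1 : ∀ p ∈ I, (insert a I).filter (fun q => (l q).natAbs < (l p).natAbs)
      = I.filter (fun q => (l q).natAbs < (l p).natAbs) := by
    intro p hp
    rw [Finset.filter_insert, if_neg]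
    have := h p hp
    omega
  have h2 : (insert a I).filter (fun q => (l q).natAbs < (l a).natAbs) = I := by
    rw [Finset.filter_insert, if_neg (by omega)]
    exact Finset.filter_true_of_mem h
  unfold altP
  rw [Finset.forall_mem_insert, h2]
  constructor
  · rintro ⟨h3, h4⟩
    exact ⟨fun p hp => by rw [← h1 p hp]; exact h4 p hp, h3⟩
  · rintro ⟨h3, h4⟩
    exact ⟨h4, fun p hp => by rw [h1 p hp]; exact h3 p hp⟩

open Classical in
lemma altP_sum (l : ℕ → ℤ) (I : Finset ℕ) :
    (Set.InjOn (fun p => (l p).natAbs) (I : Set ℕ)) →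
    ∑ u ∈ I, (if altP 0 (I.erase u) l then (1 : ZMod 2) else 0)
      = (if altP 0 I l then 1 else 0) + (if altP 1 I l then 1 else 0) := by
  induction I using Finset.induction_on_max_value (fun p => (l p).natAbs) with
  | empty =>
    intro _
    simp [altP]
    decide
  | insert a s ha hmax ih =>
    intro hinj
    have hlt : ∀ x ∈ s, (l x).natAbs < (l a).natAbs := by
      intro x hx
      refine lt_of_le_of_ne (hmax x hx) ?_
      intro he
      have := hinj (by simp [hx]) (by simp) he
      subst this
      exact ha hx
    have ih' := ih (hinj.mono (by simp))
    rw [Finset.sum_insert ha, Finset.erase_insert ha]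
    have e : ∀ u ∈ s, (if altP 0 ((insert a s).erase u) l then (1 : ZMod 2) else 0)
        = (if (0 < l a ↔ ¬ Even s.card) then 1 else 0) * (if altP 0 (s.erase u) l then 1 else 0) := by
      intro u hu
      have hua : a ≠ u := by rintro rfl; exact ha hu
      rw [Finset.erase_insert_of_ne hua,
        altP_insert 0 (s.erase u) l a (by simp [ha]) (fun x hx => hlt x (Finset.mem_of_mem_erase hx))]
      have hc : Even ((s.erase u).card + 0) ↔ ¬ Even s.card := by
        rw [Finset.card_erase_of_mem hu]
        have : 0 < s.card := Finset.card_pos.mpr ⟨u, hu⟩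
        obtain ⟨c, hc⟩ : ∃ c, s.card = c + 1 := ⟨s.card - 1, by omega⟩
        rw [hc]
        simp [Nat.even_add_one]
      rw [hc]
      by_cases h1 : altP 0 (s.erase u) l <;> by_cases h2 : (0 < l a ↔ ¬ Even s.card) <;> simp [h1, h2]
    rw [Finset.sum_congr rfl e, ← Finset.mul_sum, ih']
    rw [altP_insert 0 s l a ha hlt, altP_insert 1 s l a ha hlt]
    have hz : (1 : ZMod 2) + 1 = 0 := by decide
    by_cases h1 : altP 0 s l <;> by_cases h2 : altP 1 s l <;> by_cases h3 : 0 < l a <;>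
      by_cases h4 : Even s.card <;> simp [h1, h2, h3, h4, Nat.even_add_one, hz]

open Classical in
lemma altD_eq (b : ℕ) (I : Finset ℕ) (l : ℕ → ℤ) :
    altD b I l = if (Set.InjOn (fun p => (l p).natAbs) (I : Set ℕ)) ∧ altP b I l then 1 else 0 := rfl

lemma altD_congr (b : ℕ) (I : Finset ℕ) (l l' : ℕ → ℤ) (h : ∀ p ∈ I, l p = l' p) :
    altD b I l = altD b I l' := by
  classical
  rw [altD_eq, altD_eq]
  have h1 : Set.InjOn (fun p => (l p).natAbs) (I : Set ℕ) ↔ Set.InjOn (fun p => (l' p).natAbs) (I : Set ℕ) := by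
    apply Set.EqOn.injOn_iff
    intro p hp
    simp [h p hp]
  have h2 : altP b I l ↔ altP b I l' := by
    unfold altP
    refine forall₂_congr fun p hp => ?_
    rw [h p hp, Finset.filter_congr (q := fun q => (l' q).natAbs < (l' p).natAbs)]
    intro q hq
    rw [h q hq]
  simp only [h1, h2]

lemma altD_neg (I : Finset ℕ) (l : ℕ → ℤ) (h0 : ∀ p ∈ I, l p ≠ 0) :
    altD 0 I (fun p => - l p) = altD 1 I l := by
  classical
  rw [altD_eq, altD_eq]
  have h2 : altP 0 I (fun p => - l p) ↔ altP 1 I l := by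
    unfold altP
    refine forall₂_congr fun p hp => ?_
    simp only [Int.natAbs_neg, add_zero, Nat.even_add_one]
    have := h0 p hp
    have e : 0 < - l p ↔ ¬ 0 < l p := by omega
    rw [e]
    tauto
  simp only [Int.natAbs_neg, h2]

lemma altD_erase_eq (l : ℕ → ℤ) (I : Finset ℕ) (p q : ℕ) (hp : p ∈ I) (hq : q ∈ I) (_ : p ≠ q)
    (h : l p = l q) : altD 0 (I.erase p) l = altD 0 (I.erase q) l := by
  classical
  -- transport along the swap
  have key : ∀ b (J J' : Finset ℕ) (e : Equiv.Perm ℕ), J' = J.map e.toEmbedding → (∀ x, l (e x) = l x) →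
      altD b J l = altD b J' l := by
    intro b J J' e hJ he
    rw [altD_eq, altD_eq]
    subst hJ
    have h1 : Set.InjOn (fun p => (l p).natAbs) (J : Set ℕ) ↔
        Set.InjOn (fun p => (l p).natAbs) ((J.map e.toEmbedding : Finset ℕ) : Set ℕ) := by
      constructor
      · intro hi x hx y hy hxy
        simp only [Finset.coe_map, Set.mem_image, Finset.mem_coe] at hx hy
        obtain ⟨x, hx, rfl⟩ := hx
        obtain ⟨y, hy, rfl⟩ := hy
        simp only [Equiv.coe_toEmbedding, he] at hxy
        rw [hi hx hy hxy]
      · intro hi x hx y hy hxy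
        have := hi (x₁ := e x) (by simpa using hx) (x₂ := e y) (by simpa using hy) (by simpa [he] using hxy)
        exact e.injective this
    have h2 : altP b J l ↔ altP b (J.map e.toEmbedding) l := by
      unfold altP
      rw [Finset.forall_mem_map]
      refine forall₂_congr fun p hp => ?_
      rw [Finset.filter_map, Finset.card_map]
      simp only [Equiv.coe_toEmbedding, he, Function.comp_def]
    simp only [h1, h2]
  refine key 0 _ _ (Equiv.swap p q) ?_ ?_
  · ext x
    simp only [Finset.mem_erase, Finset.mem_map, Equiv.coe_toEmbedding]
    constructor
    · rintro ⟨h1, h2⟩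
      refine ⟨Equiv.swap p q x, ⟨?_, ?_⟩, by simp⟩
      · rw [Ne, Equiv.swap_apply_eq_iff]; simpa using h1
      · rw [Equiv.swap_apply_def]; split_ifs <;> assumption
    · rintro ⟨y, ⟨h1, h2⟩, rfl⟩
      refine ⟨?_, ?_⟩
      · rw [Ne, Equiv.swap_apply_eq_iff]; simpa using h1
      · rw [Equiv.swap_apply_def]; split_ifs <;> assumption
  · intro x
    rw [Equiv.swap_apply_def]
    split_ifs with h1 h2
    · rw [h1, h]
    · rw [h2, h]
    · rfl

lemma altD_sum (l : ℕ → ℤ) (I : Finset ℕ)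
    (hc : ∀ p ∈ I, ∀ q ∈ I, (l p).natAbs = (l q).natAbs → l p = l q) :
    ∑ u ∈ I, altD 0 (I.erase u) l = altD 0 I l + altD 1 I l := by
  classical
  by_cases hinj : Set.InjOn (fun p => (l p).natAbs) (I : Set ℕ)
  · have := altP_sum l I hinj
    simp only [altD_eq, hinj, true_and]
    rw [← this]
    refine Finset.sum_congr rfl fun u hu => ?_
    have : Set.InjOn (fun p => (l p).natAbs) ((I.erase u : Finset ℕ) : Set ℕ) :=
      hinj.mono (by simp)
    simp only [this, true_and]
  · have hinj2 := hinj
    simp only [altD_eq 0 I l, altD_eq 1 I l, hinj, false_and, if_false, add_zero]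
    unfold Set.InjOn at hinj
    push Not at hinj
    obtain ⟨p, hp, q, hq, hpq, hne⟩ := hinj
    have hp' : p ∈ I := hp
    have hq' : q ∈ I := hq
    have e := altD_erase_eq l I p q hp' hq' hne (hc p hp' q hq' hpq)
    have hz : ∀ u ∈ I, u ∉ ({p, q} : Finset ℕ) → altD 0 (I.erase u) l = 0 := by
      intro u hu hu2
      simp only [Finset.mem_insert, Finset.mem_singleton, not_or] at hu2
      rw [altD_eq, if_neg]
      rintro ⟨h1, -⟩
      exact hne (h1 (by simp [hp']; exact fun h => hu2.1 h.symm) (by simp [hq']; exact fun h => hu2.2 h.symm) hpq)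
    rw [← Finset.sum_subset (s₁ := {p, q}) (by intro x; simp; rintro (rfl | rfl) <;> assumption) hz]
    rw [Finset.sum_pair hne, e]
    exact CharTwo.add_self_eq_zero _

/-- the chain of sign vectors -/
def tkX {L : ℕ} (w : Equiv.Perm (Fin L) × (Fin L → ℤˣ)) (k : ℕ) : Fin L → ℤ :=
  fun i => if (w.1 i : ℕ) ≤ k then ((w.2 i : ℤˣ) : ℤ) else 0

open Classical in
noncomputable def tkO (L d : ℕ) : Finset (Equiv.Perm (Fin L) × (Fin L → ℤˣ)) :=
  Finset.univ.filter (fun w => (∀ i : Fin L, d ≤ (i : ℕ) → w.1 i = i) ∧ (∀ i : Fin L, d ≤ (i : ℕ) + 1 → w.2 i = 1))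

noncomputable def tkE (L d : ℕ) (lam : (Fin L → ℤ) → ℤ) : ZMod 2 :=
  ∑ w ∈ tkO L d, (altD 0 (Finset.range d) (fun k => lam (tkX w k)) + altD 1 (Finset.range d) (fun k => lam (tkX w k)))

/-- swapping ranks leaves the other members of the chain alone -/
lemma tkX_swap {L : ℕ} (w : Equiv.Perm (Fin L) × (Fin L → ℤˣ)) (a b : Fin L) (hab : (b : ℕ) = a + 1)
    (k : ℕ) (hk : k ≠ a) : tkX (w.1.trans (Equiv.swap a b), w.2) k = tkX w k := by
  funext i
  simp only [tkX, Equiv.trans_apply]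
  have : ((Equiv.swap a b (w.1 i) : Fin L) : ℕ) ≤ k ↔ ((w.1 i : Fin L) : ℕ) ≤ k := by
    rw [Equiv.swap_apply_def]
    split_ifs with h1 h2
    · rw [h1]; omega
    · rw [h2]; omega
    · rfl
  simp only [this]

lemma tkX_flip {L : ℕ} (w : Equiv.Perm (Fin L) × (Fin L → ℤˣ)) (c : Fin L)
    (k : ℕ) (hk : k < c) : tkX (w.1, Function.update w.2 (w.1.symm c) (- w.2 (w.1.symm c))) k = tkX w k := by
  funext i
  simp only [tkX]
  split_ifs with h
  · rw [Function.update_of_ne]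
    rintro rfl
    simp at h
    omega
  · rfl

lemma tkE_step {L d : ℕ} (hd : d < L) (hd0 : 0 < d) (lam : (Fin L → ℤ) → ℤ)
    (hneg : ∀ w : Equiv.Perm (Fin L) × (Fin L → ℤˣ), ∀ k, lam (- tkX w k) = - lam (tkX w k))
    (h0 : ∀ w : Equiv.Perm (Fin L) × (Fin L → ℤˣ), ∀ k, lam (tkX w k) ≠ 0)
    (hc : ∀ w : Equiv.Perm (Fin L) × (Fin L → ℤˣ), ∀ p q, (lam (tkX w p)).natAbs = (lam (tkX w q)).natAbs →
      lam (tkX w p) = lam (tkX w q)) :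
    tkE L (d + 1) lam = tkE L d lam := by
  classical
  unfold tkE
  have e1 : ∀ w ∈ tkO L (d + 1), (altD 0 (Finset.range (d + 1)) (fun k => lam (tkX w k)) + altD 1 (Finset.range (d + 1)) (fun k => lam (tkX w k)))
     = ∑ u ∈ Finset.range (d + 1), altD 0 ((Finset.range (d + 1)).erase u) (fun k => lam (tkX w k)) := by
    intro w _
    rw [altD_sum]
    intro p _ q _ h
    exact hc w p q h
  rw [Finset.sum_congr rfl e1, Finset.sum_comm, Finset.sum_range_succ]
  have z2 : ∀ x : ZMod 2, x + x = 0 := fun x => CharTwo.add_self_eq_zero x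
  have e2 : ∀ u ∈ Finset.range d, ∑ w ∈ tkO L (d + 1), altD 0 ((Finset.range (d + 1)).erase u) (fun k => lam (tkX w k)) = 0 := by
    intro u hu
    rw [Finset.mem_range] at hu
    let a : Fin L := ⟨u, by omega⟩
    let b : Fin L := ⟨u + 1, by omega⟩
    have hab : a ≠ b := by simp [a, b]
    refine Finset.sum_involution (fun w _ => (w.1.trans (Equiv.swap a b), w.2)) ?_ ?_ ?_ ?_
    · intro w hw
      rw [altD_congr 0 _ (fun k => lam (tkX (w.1.trans (Equiv.swap a b), w.2) k)) (fun k => lam (tkX w k))]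
      · exact z2 _
      · intro p hp
        rw [tkX_swap w a b rfl p (Finset.ne_of_mem_erase hp)]
    · intro w hw _ he
      have := congrArg (fun v => v.1 (w.1.symm a)) he
      simp at this
      exact hab this.symm
    · intro w hw
      simp only [tkO, Finset.mem_filter, Finset.mem_univ, true_and] at hw ⊢
      refine ⟨fun i hi => ?_, hw.2⟩
      rw [Equiv.trans_apply, hw.1 i hi, Equiv.swap_apply_of_ne_of_ne]
      · intro h; rw [h] at hi; simp [a] at hi; omega
      · intro h; rw [h] at hi; simp [b] at hi; omega
    · intro w hw
      ext i <;> simp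
  rw [Finset.sum_eq_zero e2, zero_add]
  have er : (Finset.range (d + 1)).erase d = Finset.range d := by
    ext x; simp; omega
  rw [er]
  let c : Fin L := ⟨d, hd⟩
  rw [← Finset.sum_filter_add_sum_filter_not (tkO L (d + 1)) (fun w => w.1 c = c)]
  have e3 : ∑ w ∈ (tkO L (d + 1)).filter (fun w => ¬ w.1 c = c), altD 0 (Finset.range d) (fun k => lam (tkX w k)) = 0 := by
    refine Finset.sum_involution (fun w _ => (w.1, Function.update w.2 (w.1.symm c) (- w.2 (w.1.symm c)))) ?_ ?_ ?_ ?_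
    · intro w hw
      rw [altD_congr 0 _ (fun k => lam (tkX (w.1, Function.update w.2 (w.1.symm c) (- w.2 (w.1.symm c))) k)) (fun k => lam (tkX w k))]
      · exact z2 _
      · intro p hp
        rw [tkX_flip w c p (by simpa [c] using hp)]
    · intro w hw _ he
      have := congrArg (fun v => v.2 (w.1.symm c)) he
      simp at this
    · intro w hw
      simp only [tkO, Finset.mem_filter, Finset.mem_univ, true_and] at hw ⊢
      refine ⟨⟨hw.1.1, fun i hi => ?_⟩, hw.2⟩
      rw [Function.update_of_ne]
      · exact hw.1.2 i hi
      · rintro rfl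
        apply hw.2
        by_cases h : (w.1.symm c : ℕ) = d
        · have : w.1.symm c = c := Fin.ext h
          nth_rewrite 1 [← this]
          simp
        · have := hw.1.1 (w.1.symm c) (by omega)
          simp at this
          exact absurd (congrArg Fin.val this.symm) h
    · intro w hw
      ext i
      · simp
      · simp
  rw [e3, add_zero]
  let c' : Fin L := ⟨d - 1, by omega⟩
  rw [← Finset.sum_filter_add_sum_filter_not ((tkO L (d + 1)).filter (fun w => w.1 c = c)) (fun w => w.2 c' = 1)]
  have f1 : ((tkO L (d + 1)).filter (fun w => w.1 c = c)).filter (fun w => w.2 c' = 1) = tkO L d := by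
    ext w
    simp only [tkO, Finset.mem_filter, Finset.mem_univ, true_and]
    constructor
    · rintro ⟨⟨⟨h1, h2⟩, h3⟩, h4⟩
      refine ⟨fun i hi => ?_, fun i hi => ?_⟩
      · by_cases h : (i : ℕ) = d
        · have : i = c := Fin.ext h
          rw [this, h3]
        · exact h1 i (by omega)
      · by_cases h : (i : ℕ) = d - 1
        · have : i = c' := Fin.ext h
          rw [this, h4]
        · exact h2 i (by omega)
    · rintro ⟨h1, h2⟩
      exact ⟨⟨⟨fun i hi => h1 i (by omega), fun i hi => h2 i (by omega)⟩, h1 c le_rfl⟩, h2 c' (by simp [c']; omega)⟩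
  rw [f1, Finset.sum_add_distrib]
  congr 1
  refine Finset.sum_bij' (fun w _ => (w.1, fun i => if (i : ℕ) < d then - w.2 i else w.2 i))
    (fun w _ => (w.1, fun i => if (i : ℕ) < d then - w.2 i else w.2 i)) ?_ ?_ ?_ ?_ ?_
  · intro w hw
    simp only [tkO, Finset.mem_filter, Finset.mem_univ, true_and] at hw ⊢
    obtain ⟨⟨⟨h1, h2⟩, h3⟩, h4⟩ := hw
    refine ⟨fun i hi => ?_, fun i hi => ?_⟩
    · by_cases h : (i : ℕ) = d
      · have : i = c := Fin.ext h
        rw [this, h3]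
      · exact h1 i (by omega)
    · split_ifs with h
      · have : i = c' := Fin.ext (by simp [c']; omega)
        rw [this]
        rcases Int.units_eq_one_or (w.2 c') with h5 | h5
        · exact absurd h5 h4
        · rw [h5]; simp
      · exact h2 i (by omega)
  · intro w hw
    simp only [tkO, Finset.mem_filter, Finset.mem_univ, true_and] at hw ⊢
    obtain ⟨h1, h2⟩ := hw
    refine ⟨⟨⟨fun i hi => h1 i (by omega), fun i hi => ?_⟩, h1 c le_rfl⟩, ?_⟩
    · rw [if_neg (by omega)]
      exact h2 i (by omega)
    · rw [if_pos (by simp [c']; omega), h2 c' (by simp [c']; omega)]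
      decide
  · intro w hw
    ext i
    · simp
    · simp only; split_ifs <;> simp
  · intro w hw
    ext i
    · simp
    · simp only; split_ifs <;> simp
  · intro w hw
    rw [← altD_neg _ _ (fun p _ => h0 _ _)]
    apply altD_congr
    intro p hp
    rw [Finset.mem_range] at hp
    rw [← hneg]
    congr 1
    simp only [tkO, Finset.mem_filter, Finset.mem_univ, true_and] at hw
    obtain ⟨⟨⟨h1, h2⟩, h3⟩, h4⟩ := hw
    funext i
    simp only [tkX, Pi.neg_apply]
    by_cases h : (w.1 i : ℕ) ≤ p
    · rw [if_pos h, if_pos h]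
      have : (i : ℕ) < d := by
        by_contra hcon
        by_cases h6 : (i : ℕ) = d
        · have : i = c := Fin.ext h6
          rw [this, h3] at h
          simp [c] at h
          omega
        · rw [h1 i (by omega)] at h
          omega
      rw [if_pos this]
      simp
    · rw [if_neg h, if_neg h]
      simp

/-- octahedral Tucker lemma -/
lemma tucker {L : ℕ} (hL : 0 < L) (lam : (Fin L → ℤ) → ℤ)
    (hneg : ∀ x : Fin L → ℤ, (∀ i, x i = 0 ∨ x i = 1 ∨ x i = -1) → x ≠ 0 → lam (-x) = - lam x)
    (hb : ∀ x : Fin L → ℤ, (∀ i, x i = 0 ∨ x i = 1 ∨ x i = -1) → x ≠ 0 →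
      1 ≤ (lam x).natAbs ∧ (lam x).natAbs + 1 ≤ L) :
    ∃ x y : Fin L → ℤ, (∀ i, x i = 0 ∨ x i = 1 ∨ x i = -1) ∧ (∀ i, y i = 0 ∨ y i = 1 ∨ y i = -1) ∧
      x ≠ 0 ∧ y ≠ 0 ∧ (∀ i, x i ≠ 0 → y i = x i) ∧ lam x = - lam y := by
  classical
  by_contra hcon
  push Not at hcon
  have hv : ∀ w : Equiv.Perm (Fin L) × (Fin L → ℤˣ), ∀ k, ∀ i, tkX w k i = 0 ∨ tkX w k i = 1 ∨ tkX w k i = -1 := by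
    intro w k i
    simp only [tkX]
    split_ifs
    · right
      rcases Int.units_eq_one_or (w.2 i) with h | h <;> simp [h]
    · simp
  have hn0 : ∀ w : Equiv.Perm (Fin L) × (Fin L → ℤˣ), ∀ k, tkX w k ≠ 0 := by
    intro w k h
    have := congrFun h (w.1.symm ⟨0, hL⟩)
    simp [tkX] at this
  have h0 : ∀ w : Equiv.Perm (Fin L) × (Fin L → ℤˣ), ∀ k, lam (tkX w k) ≠ 0 := by
    intro w k h
    have := (hb _ (hv w k) (hn0 w k)).1
    rw [h] at this
    simp at this
  have hc1 : ∀ w : Equiv.Perm (Fin L) × (Fin L → ℤˣ), ∀ p q, p ≤ q → lam (tkX w p) ≠ - lam (tkX w q) := by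
    intro w p q hpq
    refine hcon _ _ (hv w p) (hv w q) (hn0 w p) (hn0 w q) ?_
    intro i hi
    simp only [tkX] at hi ⊢
    have : (w.1 i : ℕ) ≤ p := by
      by_contra h
      simp [h] at hi
    rw [if_pos this, if_pos (by omega)]
  have hc : ∀ w : Equiv.Perm (Fin L) × (Fin L → ℤˣ), ∀ p q, (lam (tkX w p)).natAbs = (lam (tkX w q)).natAbs →
      lam (tkX w p) = lam (tkX w q) := by
    intro w p q h
    rcases Int.natAbs_eq_natAbs_iff.mp h with h | h
    · exact h
    · rcases le_total p q with h2 | h2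
      · exact absurd h (hc1 w p q h2)
      · exact absurd (by omega) (hc1 w q p h2)
  have base : tkE L 1 lam = 1 := by
    have hO : tkO L 1 = {(1, 1)} := by
      ext w
      simp only [tkO, Finset.mem_filter, Finset.mem_univ, true_and, Finset.mem_singleton]
      constructor
      · rintro ⟨h1, h2⟩
        ext i
        · congr 1
          by_cases hi : 1 ≤ (i : ℕ)
          · simp [h1 i hi]
          · by_contra hne
            have : 1 ≤ (w.1 i : ℕ) := by
              by_contra h4
              apply hne
              apply Fin.ext
              simp
              omega
            have h5 := h1 _ this
            have := w.1.injective h5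
            apply hne
            simpa using this
        · simp [h2 i (by omega)]
      · rintro rfl
        simp
    unfold tkE
    rw [hO, Finset.sum_singleton]
    simp only [altD_eq, altP]
    by_cases h : 0 < lam (tkX (1, 1) 0) <;> simp [h, Finset.filter_singleton]
  have all : ∀ d, 1 ≤ d → d ≤ L → tkE L d lam = 1 := by
    intro d hd
    induction d, hd using Nat.le_induction with
    | base => intro _; exact base
    | succ d hd ih =>
      intro h
      rw [tkE_step (by omega) (by omega) lam (fun w k => hneg _ (hv w k) (hn0 w k)) h0 hc]
      exact ih (by omega)
  have h1 := all L hL le_rfl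
  have h2 : tkE L L lam = 0 := by
    unfold tkE
    refine Finset.sum_eq_zero fun w _ => ?_
    have hni : ¬ Set.InjOn (fun p => (lam (tkX w p)).natAbs) ((Finset.range L : Finset ℕ) : Set ℕ) := by
      intro hi
      have := Finset.card_le_card_of_injOn (s := Finset.range L) (t := Finset.Icc 1 (L - 1)) _ (by
        intro p hp
        have := hb _ (hv w p) (hn0 w p)
        simp only [Finset.coe_Icc, Set.mem_Icc]
        omega) hi
      simp at this
      omega
    simp only [altD_eq, hni, false_and, if_false, add_zero]
  rw [h1] at h2
  exact absurd h2 (by decide)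

def tl (x : ℕ → ℤ) : ℕ → ℤ
  | 0 => 0
  | k + 1 => if x k = 0 then tl x k else x k

def tc (x : ℕ → ℤ) : ℕ → ℕ
  | 0 => 0
  | k + 1 => if x k = 0 then tc x k else if x k = tl x k then tc x k else tc x k + 1

def td (x : ℕ → ℤ) : ℕ → ℤ
  | 0 => 1
  | k + 1 => if x k = 0 then td x k else (-1) ^ k * x k

def tz (x : ℕ → ℤ) : ℕ → ℕ
  | 0 => 0
  | k + 1 => if x k = 0 then tz x k + 1 else tz x k

def tg (x : ℕ → ℤ) : ℕ → ℕ
  | 0 => 0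
  | k + 1 => if td x (k + 1) = td x (k + 2) then tg x k else tg x k + 1

lemma tl_neg (x : ℕ → ℤ) (k : ℕ) : tl (fun i => - x i) k = - tl x k := by
  induction k with
  | zero => simp [tl]
  | succ k ih => simp only [tl, ih, neg_eq_zero]; split_ifs <;> rfl

lemma tc_neg (x : ℕ → ℤ) (k : ℕ) : tc (fun i => - x i) k = tc x k := by
  induction k with
  | zero => simp [tc]
  | succ k ih => simp only [tc, ih, neg_eq_zero, tl_neg, neg_inj]

lemma tl_val (x : ℕ → ℤ) (hx : ∀ i, x i = 0 ∨ x i = 1 ∨ x i = -1) (k : ℕ) :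
    tl x k = 0 ∨ tl x k = 1 ∨ tl x k = -1 := by
  induction k with
  | zero => simp [tl]
  | succ k ih => simp only [tl]; split_ifs; exacts [ih, hx k]

lemma tl_pos (x : ℕ → ℤ) (k : ℕ) : (∃ i < k, x i ≠ 0) → tl x k ≠ 0 ∧ 1 ≤ tc x k := by
  have aux : ∀ k, tc x k = 0 → tl x k = 0 := by
    intro k
    induction k with
    | zero => simp [tl]
    | succ k ih =>
      simp only [tc, tl]
      split_ifs with h1 h2
      · exact ih
      · intro h; rw [h2]; exact ih h
      · intro h; exact h.elim
  have aux2 : (∃ i < k, x i ≠ 0) → tl x k ≠ 0 := by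
    induction k with
    | zero => rintro ⟨i, hi, _⟩; omega
    | succ k ih =>
      rintro ⟨i, hi, h⟩
      simp only [tl]
      split_ifs with h1
      · apply ih
        refine ⟨i, ?_, h⟩
        by_contra h2
        have : i = k := by omega
        subst this; exact h h1
      · exact h1
  intro h
  have := aux2 h
  refine ⟨this, ?_⟩
  by_contra h2
  exact this (aux k (by omega))

lemma tc_mono (x y : ℕ → ℤ) (h : ∀ i, x i ≠ 0 → y i = x i) (k : ℕ) :
    tc x k ≤ tc y k ∧ (tc x k = tc y k → tl x k = tl y k) := by
  induction k with
  | zero => simp [tc, tl]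
  | succ k ih =>
    have hk := h k
    simp only [tc, tl]
    obtain ⟨h1, h2⟩ := ih
    by_cases hx : x k = 0
    · simp only [hx, if_true]
      by_cases hy : y k = 0
      · simp only [hy, if_true]; exact ⟨h1, h2⟩
      · simp only [hy, if_false]
        split_ifs with h3
        · refine ⟨h1, fun h => ?_⟩
          rw [h2 h, h3]
        · exact ⟨by omega, by omega⟩
    · have hxy := hk hx
      rw [hxy]
      simp only [hx, if_false, implies_true, and_true]
      by_cases he : tc x k = tc y k
      · rw [h2 he, he]
      · split_ifs <;> omega

lemma tz_le (x : ℕ → ℤ) (k : ℕ) : tc x k + tz x k ≤ k := by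
  induction k with
  | zero => simp [tc, tz]
  | succ k ih =>
    simp only [tc, tz]
    split_ifs <;> omega

lemma td_val (x : ℕ → ℤ) (hx : ∀ i, x i = 0 ∨ x i = 1 ∨ x i = -1) (k : ℕ) :
    td x k = 1 ∨ td x k = -1 := by
  induction k with
  | zero => simp [td]
  | succ k ih =>
    simp only [td]
    split_ifs with h
    · exact ih
    · rcases neg_one_pow_eq_or ℤ k with h2 | h2 <;> rcases hx k with h3 | h3 | h3 <;> simp_all

lemma tg_le (x : ℕ → ℤ) (hx : ∀ i, x i = 0 ∨ x i = 1 ∨ x i = -1) (k : ℕ) :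
    tg x k + tc x (k + 1) ≤ k + 1 ∧ (tg x k + tc x (k + 1) = k + 1 → tl x (k + 1) = (-1) ^ k * td x (k + 1)) := by
  induction k with
  | zero =>
    by_cases h : x 0 = 0
    · simp [tg, tc, h]
    · simp [tg, tc, tl, td, h]
  | succ k ih =>
    obtain ⟨h1, h2⟩ := ih
    have e1 : tg x (k + 1) = if td x (k + 1) = td x (k + 2) then tg x k else tg x k + 1 := rfl
    have e2 : tc x (k + 1 + 1) = if x (k + 1) = 0 then tc x (k + 1) else if x (k + 1) = tl x (k + 1) then tc x (k + 1) else tc x (k + 1) + 1 := rfl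
    have e3 : td x (k + 2) = if x (k + 1) = 0 then td x (k + 1) else (-1) ^ (k + 1) * x (k + 1) := rfl
    have e4 : tl x (k + 1 + 1) = if x (k + 1) = 0 then tl x (k + 1) else x (k + 1) := rfl
    have hd := td_val x hx (k + 1)
    have hl := tl_val x hx (k + 1)
    rcases neg_one_pow_eq_or ℤ k with h5 | h5 <;> rcases hx (k + 1) with h3 | h3 | h3 <;>
      rw [e1, e2, e4, e3] <;> simp only [h3, pow_succ, h5] at * <;> grind

lemma halving (n L : ℕ) (hL : 0 < L) (a : Fin n → ℕ → ℝ) (ha : ∀ j k, 0 ≤ a j k) (η : ℝ)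
    (hη : ∀ j k, a j k ≤ η) (hη0 : 0 ≤ η) (s : ℕ → ℤ) (hs : ∀ k, s k = 1 ∨ s k = -1) :
    ∃ δ : ℕ → ℤ, (∀ k, δ k = 1 ∨ δ k = -1) ∧
      ((Finset.range (L - 1)).filter (fun k => δ k ≠ δ (k + 1))).card ≤ n ∧
      ∀ j, |∑ k ∈ Finset.range L, ((s k * δ k : ℤ) : ℝ) * a j k| ≤ 2 * n * η := by
  classical
  by_cases hLn : L ≤ n
  · refine ⟨fun _ => 1, by simp, by simp, fun j => ?_⟩
    calc |∑ k ∈ Finset.range L, ((s k * 1 : ℤ) : ℝ) * a j k|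
        ≤ ∑ k ∈ Finset.range L, |((s k * 1 : ℤ) : ℝ) * a j k| := Finset.abs_sum_le_sum_abs _ _
      _ ≤ ∑ k ∈ Finset.range L, η := by
          refine Finset.sum_le_sum fun k _ => ?_
          have := ha j k
          rcases hs k with h | h <;> simp [h, abs_of_nonneg this, hη j k]
      _ = L * η := by simp
      _ ≤ 2 * n * η := by
          have : (L : ℝ) ≤ n := by exact_mod_cast hLn
          nlinarith
  push Not at hLn
  by_contra hcon
  push Not at hcon
  -- extension to ℕ
  let xe : (Fin L → ℤ) → ℕ → ℤ := fun x k => if h : k < L then x ⟨k, h⟩ else 0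
  have xe_neg : ∀ x, xe (-x) = fun i => - xe x i := by
    intro x; funext i; simp only [xe]; split_ifs <;> simp
  have xe_val : ∀ x : Fin L → ℤ, (∀ i, x i = 0 ∨ x i = 1 ∨ x i = -1) → ∀ i, xe x i = 0 ∨ xe x i = 1 ∨ xe x i = -1 := by
    intro x hx i; simp only [xe]; split_ifs
    · exact hx _
    · simp
  have xe_ne : ∀ x : Fin L → ℤ, x ≠ 0 → ∃ i < L, xe x i ≠ 0 := by
    intro x hx
    obtain ⟨i, hi⟩ := Function.ne_iff.mp hx
    exact ⟨i, i.2, by simpa [xe] using hi⟩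
  let P : ℤ → Fin n → (Fin L → ℤ) → ℝ := fun σ j x =>
    ∑ k ∈ Finset.range L, if (-1) ^ k * s k * xe x k = σ then a j k else 0
  let H : Fin n → ℝ := fun j => (∑ k ∈ Finset.range L, a j k) / 2
  have hPM : ∀ j x, P 1 j x + P (-1) j x ≤ 2 * H j := by
    intro j x
    simp only [P, H]
    rw [← Finset.sum_add_distrib, mul_div_cancel₀ _ (by norm_num : (2 : ℝ) ≠ 0)]
    refine Finset.sum_le_sum fun k _ => ?_
    have := ha j k
    split_ifs with h1 h2
    · rw [h1] at h2; norm_num at h2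
    all_goals linarith
  have hPneg : ∀ σ j x, P σ j (-x) = P (-σ) j x := by
    intro σ j x
    simp only [P, xe_neg]
    refine Finset.sum_congr rfl fun k _ => ?_
    have : (-1) ^ k * s k * - xe x k = σ ↔ (-1) ^ k * s k * xe x k = -σ := by
      rw [mul_neg]; omega
    simp only [this]
  have hPmono : ∀ σ j x y, σ ≠ 0 → (∀ i, x i ≠ 0 → y i = x i) → P σ j x ≤ P σ j y := by
    intro σ j x y hσ hxy
    refine Finset.sum_le_sum fun k _ => ?_
    split_ifs with h1 h2
    · exact le_rfl
    · exfalso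
      apply h2
      rw [← h1]
      have hk : xe x k ≠ 0 := by rintro h; rw [h] at h1; simp at h1; exact hσ h1.symm
      congr 1
      simp only [xe] at hk ⊢
      split_ifs with h3
      · simp [h3] at hk
        exact hxy _ hk
      · simp [h3] at hk
    · exact ha j k
    · exact le_rfl
  let A : (Fin L → ℤ) → Set (Fin n) := fun x => {j | H j < P 1 j x ∨ H j < P (-1) j x}
  have hAneg : ∀ x, A (-x) = A x := by
    intro x; ext j; simp only [A, Set.mem_ofPred_eq, hPneg, neg_neg]; tauto
  by_cases hn : n = 0
  · subst hn
    exact absurd (hcon (fun _ => 1) (by simp) (by simp)) (by rintro ⟨j, _⟩; exact j.elim0)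
  haveI : Nonempty (Fin n) := ⟨⟨0, by omega⟩⟩
  let g : Set (Fin n) → Fin n := fun B => if h : B.Nonempty then h.some else Classical.arbitrary _
  have hg : ∀ B : Set (Fin n), B.Nonempty → g B ∈ B := by
    intro B hB
    simp only [g, dif_pos hB]
    exact hB.some_mem
  let lam : (Fin L → ℤ) → ℤ := fun x =>
    if (A x).Nonempty then (if H (g (A x)) < P 1 (g (A x)) x then ((g (A x) : ℕ) : ℤ) + 1 else -(((g (A x) : ℕ) : ℤ) + 1))
    else tl (xe x) L * (n + tc (xe x) L)
  have hbound : ∀ x : Fin L → ℤ, (∀ i, x i = 0 ∨ x i = 1 ∨ x i = -1) → ¬ (A x).Nonempty → n + tc (xe x) L + 1 ≤ L := by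
    intro x hx hA
    by_contra hlt
    have hv := xe_val x hx
    have htg := (tg_le (xe x) hv (L - 1)).1
    rw [Nat.sub_add_cancel hL] at htg
    have htz := tz_le (xe x) L
    have hcard : ∀ m, ((Finset.range m).filter (fun k => td (xe x) (k + 1) ≠ td (xe x) (k + 1 + 1))).card = tg (xe x) m := by
      intro m
      induction m with
      | zero => simp [tg]
      | succ m ih =>
        rw [Finset.range_add_one, Finset.filter_insert]
        simp only [tg]
        by_cases h : td (xe x) (m + 1) = td (xe x) (m + 2)
        · rw [if_neg (by simpa using h), if_pos h, ih]
        · rw [if_pos h, if_neg h, Finset.card_insert_of_notMem (by simp), ih]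
    have hzc : ∀ m j, ∑ k ∈ Finset.range m, (if xe x k = 0 then a j k else 0) ≤ tz (xe x) m * η := by
      intro m j
      induction m with
      | zero => simp [tz]
      | succ m ih =>
        rw [Finset.sum_range_succ]
        simp only [tz]
        have := hη j m
        split_ifs
        · push_cast; linarith
        · linarith
    obtain ⟨j, hj⟩ := hcon (fun k => td (xe x) (k + 1)) (fun k => td_val _ hv _) (by
      rw [hcard]; omega)
    have hA' : P 1 j x ≤ H j ∧ P (-1) j x ≤ H j := by
      rw [Set.not_nonempty_iff_eq_empty] at hA
      have : j ∉ A x := by rw [hA]; simp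
      simpa [A] using this
    have hzn : (tz (xe x) L : ℝ) ≤ n := by
      have : tz (xe x) L ≤ n := by omega
      exact_mod_cast this
    have hz := hzc L j
    have hz2 : (tz (xe x) L : ℝ) * η ≤ n * η := mul_le_mul_of_nonneg_right hzn hη0
    have key : ∀ σ : ℤ, (σ = 1 ∨ σ = -1) → ∑ k ∈ Finset.range L, (1 + σ * ((s k * td (xe x) (k + 1) : ℤ) : ℝ)) * a j k
        ≤ 2 * P σ j x + 2 * ∑ k ∈ Finset.range L, (if xe x k = 0 then a j k else 0) := by
      intro σ hσ
      simp only [P]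
      rw [Finset.mul_sum, Finset.mul_sum, ← Finset.sum_add_distrib]
      refine Finset.sum_le_sum fun k _ => ?_
      have ha' := ha j k
      have e3 : td (xe x) (k + 1) = if xe x k = 0 then td (xe x) k else (-1) ^ k * xe x k := rfl
      have hd := td_val (xe x) hv k
      rw [e3]
      rcases hv k with h | h | h <;> rcases hs k with h1 | h1 <;> rcases hσ with rfl | rfl <;>
        rcases neg_one_pow_eq_or ℤ k with h5 | h5 <;> rcases hd with h6 | h6 <;> simp [h, h1, h5, h6] <;> linarith
    have k1 := key 1 (by simp)
    have k2 := key (-1) (by simp)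
    have hH : ∑ k ∈ Finset.range L, a j k = 2 * H j := by simp only [H]; ring
    simp only [add_mul, one_mul, Finset.sum_add_distrib, hH, Int.cast_one, Int.cast_neg, neg_mul, Finset.sum_neg_distrib] at k1 k2
    have : |∑ k ∈ Finset.range L, ((s k * td (xe x) (k + 1) : ℤ) : ℝ) * a j k| ≤ 2 * n * η := by
      rw [abs_le]
      constructor <;> nlinarith [hA'.1, hA'.2]
    linarith
  obtain ⟨x, y, hx, hy, hx0, hy0, hxy, hl⟩ := tucker hL lam (by
      intro x hx hx0
      simp only [lam, hAneg, hPneg]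
      by_cases h : (A x).Nonempty
      · rw [if_pos h, if_pos h]
        have h1 := hg _ h
        have h2 := hPM (g (A x)) x
        simp only [A, Set.mem_ofPred_eq] at h1
        by_cases h3 : H (g (A x)) < P 1 (g (A x)) x
        · rw [if_pos h3, if_neg]
          intro h4
          linarith
        · rw [if_neg h3, if_pos, neg_neg]
          exact h1.resolve_left h3
      · rw [if_neg h, if_neg h, xe_neg, tl_neg, tc_neg, neg_mul]) (by
      intro x hx hx0
      simp only [lam]
      by_cases h : (A x).Nonempty
      · rw [if_pos h]
        have := (g (A x)).2
        split_ifs <;> omega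
      · rw [if_neg h]
        have h1 := hbound x hx h
        have h2 := tl_pos (xe x) L (xe_ne x hx0)
        rcases tl_val (xe x) (xe_val x hx) L with h3 | h3 | h3
        · exact absurd h3 h2.1
        · rw [h3]; omega
        · rw [h3]; omega)
  have vx := tl_val (xe x) (xe_val x hx) L
  have vy := tl_val (xe y) (xe_val y hy) L
  have px := tl_pos (xe x) L (xe_ne x hx0)
  have py := tl_pos (xe y) L (xe_ne y hy0)
  simp only [lam] at hl
  by_cases h1 : (A x).Nonempty <;> by_cases h2 : (A y).Nonempty
  · rw [if_pos h1, if_pos h2] at hl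
    have m1 := hg _ h1
    have m2 := hg _ h2
    have hgg : g (A x) = g (A y) := by
      apply Fin.ext
      split_ifs at hl <;> omega
    rw [hgg] at hl m1
    have q1 := hPmono 1 (g (A y)) x y (by norm_num) hxy
    have q2 := hPmono (-1) (g (A y)) x y (by norm_num) hxy
    have q3 := hPM (g (A y)) y
    simp only [A, Set.mem_ofPred_eq] at m1 m2
    split_ifs at hl with h3 h4 h4
    · omega
    · exact h4 (lt_of_lt_of_le h3 q1)
    · have := m1.resolve_left h3
      change H (g (A y)) < _ at h4
      have h5 : H (g (A y)) < P (-1) (g (A y)) x := this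
      linarith
    · omega
  · rw [if_pos h1, if_neg h2] at hl
    have := (g (A x)).2
    rcases vy with h3 | h3 | h3
    · exact py.1 h3
    all_goals
      rw [h3] at hl
      split_ifs at hl <;> omega
  · rw [if_neg h1, if_pos h2] at hl
    have := (g (A y)).2
    rcases vx with h3 | h3 | h3
    · exact px.1 h3
    all_goals
      rw [h3] at hl
      split_ifs at hl <;> omega
  · rw [if_neg h1, if_neg h2] at hl
    have hm := (tc_mono (xe x) (xe y) (by
      intro i hi
      simp only [xe] at hi ⊢
      split_ifs with h3
      · simp [h3] at hi; exact hxy _ hi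
      · simp [h3] at hi) L).2
    have hcc : tc (xe x) L = tc (xe y) L := by
      rcases vx with h3 | h3 | h3
      · exact absurd h3 px.1
      all_goals
        rcases vy with h4 | h4 | h4
        · exact absurd h4 py.1
        all_goals
          rw [h3, h4] at hl
          omega
    have := hm hcc
    rw [hcc, this] at hl
    rcases vy with h4 | h4 | h4
    · exact py.1 h4
    all_goals
      rw [h4] at hl
      omega

def cyN (M k : ℕ) : ℕ := if k = M then 0 else k + 1

def cyI (M : ℕ) (g : ℕ → ℤ) : ℕ := ((Finset.range M).filter (fun k => g k ≠ g (k + 1))).card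

def cyJ (M : ℕ) (g : ℕ → ℤ) : ℕ := ∑ k ∈ Finset.range (M + 1), if g k = g (cyN M k) then 0 else 1

lemma cyI_succ (M : ℕ) (g : ℕ → ℤ) : cyI (M + 1) g = cyI M g + if g M = g (M + 1) then 0 else 1 := by
  unfold cyI
  rw [Finset.range_add_one, Finset.filter_insert]
  by_cases h : g M = g (M + 1)
  · rw [if_neg (by simpa using h), if_pos h]; rfl
  · rw [if_pos h, if_neg h, Finset.card_insert_of_notMem (by simp)]

lemma cyI_even (M : ℕ) (g : ℕ → ℤ) (u v : ℤ) (hg : ∀ k, g k = u ∨ g k = v) :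
    (Even (cyI M g) ↔ g M = g 0) := by
  induction M with
  | zero => simp [cyI]
  | succ M ih =>
    rw [cyI_succ]
    by_cases h : g M = g (M + 1)
    · rw [if_pos h, ← h]; simpa using ih
    · rw [if_neg h, Nat.even_add_one, ih]
      have h0 := hg 0
      have h1 := hg M
      have h2 := hg (M + 1)
      grind

lemma cyJ_eq (M : ℕ) (g : ℕ → ℤ) : cyJ M g = cyI M g + if g M = g 0 then 0 else 1 := by
  unfold cyJ cyI
  rw [Finset.sum_range_succ, Finset.card_filter]
  congr 1
  · apply Finset.sum_congr rfl
    intro k hk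
    have : k ≠ M := by simp at hk; omega
    simp [cyN, this]
  · simp [cyN]

lemma cyJ_even (M : ℕ) (g : ℕ → ℤ) (u v : ℤ) (hg : ∀ k, g k = u ∨ g k = v) :
    Even (cyJ M g) := by
  rw [cyJ_eq]
  have := cyI_even M g u v hg
  split_ifs with h
  · simpa using this.2 h
  · rw [Nat.even_add_one, this]; exact h

def cyE (M : ℕ) (m e : ℕ → ℤ) : ℕ :=
  ∑ k ∈ Finset.range (M + 1), if e k ≠ e (cyN M k) ∧ m k = m (cyN M k) then 1 else 0

lemma cyE_le (M : ℕ) (m e : ℕ → ℤ) : cyE M m e ≤ cyJ M e := by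
  unfold cyE cyJ
  apply Finset.sum_le_sum
  intro k _
  split_ifs <;> simp_all

lemma cyE_eps (n M : ℕ) (a : Fin n → ℕ → ℝ) (ha : ∀ j k, 0 ≤ a j k) (η : ℝ)
    (hη : ∀ j k, a j k ≤ η) (hη0 : 0 ≤ η) (m : ℕ → ℤ) :
    ∃ e : ℕ → ℤ, (∀ k, e k = 1 ∨ e k = -1) ∧
      (cyE M m e ≤ n + 1) ∧ (0 < cyJ M m → cyE M m e ≤ n) ∧
      ∀ j, |∑ k ∈ Finset.range (M + 1), (e k : ℝ) * a j k| ≤ 2 * n * η := by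
  by_cases hc : Even n ∨ cyJ M m = 0 ∨ m M ≠ m 0
  · obtain ⟨δ, h1, h2, h3⟩ := halving n (M + 1) (by omega) a ha η hη hη0 (fun _ => 1) (by simp)
    have h2' : cyI M δ ≤ n := h2
    refine ⟨δ, h1, ?_, ?_, by simpa using h3⟩
    · refine (cyE_le M m δ).trans ?_
      rw [cyJ_eq]; split_ifs <;> omega
    · intro hJ
      rcases hc with hc | hc | hc
      · have e1 := cyJ_even M δ 1 (-1) h1
        have : cyJ M δ ≤ n + 1 := by rw [cyJ_eq]; split_ifs <;> omega
        have h4 := cyE_le M m δ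
        rcases hc with ⟨x, hx⟩
        rcases e1 with ⟨y, hy⟩
        omega
      · omega
      · refine le_trans ?_ h2'
        unfold cyE cyI
        rw [Finset.sum_range_succ, Finset.card_filter]
        have : (if δ M ≠ δ (cyN M M) ∧ m M = m (cyN M M) then 1 else 0) = 0 := by simp [cyN, hc]
        rw [this, add_zero]
        apply Finset.sum_le_sum
        intro k hk
        have : k ≠ M := by simp at hk; omega
        simp only [cyN, this, if_false]
        split_ifs <;> simp_all
  · push Not at hc
    obtain ⟨hn, hJ, hw⟩ := hc
    rw [Nat.not_even_iff_odd] at hn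
    have : cyI M m ≠ 0 := by rw [cyJ_eq, if_pos hw] at hJ; simpa using hJ
    obtain ⟨k0, hk0⟩ := Finset.card_ne_zero.1 this
    simp only [Finset.mem_filter, Finset.mem_range] at hk0
    obtain ⟨hk0, hm0⟩ := hk0
    let s : ℕ → ℤ := fun k => if k ≤ k0 then 1 else -1
    have hs : ∀ k, s k = 1 ∨ s k = -1 := by intro k; simp only [s]; split_ifs <;> simp
    obtain ⟨δ, h1, h2, h3⟩ := halving n (M + 1) (by omega) a ha η hη hη0 s hs
    have h2' : cyI M δ ≤ n := h2
    have hes : ∀ k, s k * δ k = 1 ∨ s k * δ k = -1 := by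
      intro k; rcases hs k with h | h <;> rcases h1 k with h' | h' <;> simp [h, h']
    have key : cyE M m (fun k => s k * δ k) ≤ n := by
      have A : cyE M m (fun k => s k * δ k) + (if δ k0 = δ (k0 + 1) then 0 else 1) ≤
          cyI M δ + if s M * δ M = s 0 * δ 0 then 0 else 1 := by
        unfold cyE cyI
        rw [Finset.sum_range_succ, Finset.card_filter]
        beta_reduce
        have e1 : (if δ k0 = δ (k0 + 1) then 0 else 1) =
            ∑ k ∈ Finset.range M, if k = k0 then (if δ k = δ (k + 1) then 0 else 1) else 0 := by
          rw [Finset.sum_ite_eq' ]; simp [hk0]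
        have e2 : (if s M * δ M ≠ s (cyN M M) * δ (cyN M M) ∧ m M = m (cyN M M) then 1 else 0) ≤
          (if s M * δ M = s 0 * δ 0 then 0 else 1) := by
          simp only [cyN, if_true]; split_ifs <;> simp_all
        rw [e1]
        have e3 : (∑ x ∈ Finset.range M, if s x * δ x ≠ s (cyN M x) * δ (cyN M x) ∧ m x = m (cyN M x) then 1 else 0) +
          (∑ k ∈ Finset.range M, if k = k0 then (if δ k = δ (k + 1) then 0 else 1) else 0) ≤ 
          ∑ i ∈ Finset.range M, if δ i ≠ δ (i + 1) then 1 else 0 := by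
          rw [← Finset.sum_add_distrib]
          apply Finset.sum_le_sum
          intro k hk
          have hkM : k ≠ M := by simp at hk; omega
          simp only [cyN, hkM, if_false]
          by_cases hkk : k = k0
          · subst hkk
            simp only [hm0, and_false, if_false, if_true, zero_add]
            split_ifs <;> simp_all
          · have : s k = s (k + 1) := by
              simp only [s]; split_ifs <;> first | rfl | omega
            have h5 := hs k
            simp only [hkk, if_false, add_zero, ← this]
            rcases h5 with h5 | h5 <;> simp only [h5] <;> split_ifs <;> simp_all
        omega
      have B := cyI_even M δ 1 (-1) h1
      have hsM : s M = -1 := by simp only [s]; rw [if_neg (by omega)]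
      have hs0 : s 0 = 1 := by simp [s]
      rw [hsM, hs0] at A
      by_cases h : δ M = δ 0
      · have : Even (cyI M δ) := B.2 h
        have : cyI M δ ≠ n := by rintro h; rw [h] at this; exact (Nat.not_even_iff_odd.2 hn) this
        split_ifs at A <;> omega
      · have : -1 * δ M = 1 * δ 0 := by
          rcases h1 M with h' | h' <;> rcases h1 0 with h'' | h'' <;> simp_all
        rw [if_pos this] at A
        omega
    exact ⟨fun k => s k * δ k, hes, by omega, fun _ => key, h3⟩

lemma sw_step (n M : ℕ) (hn : 2 ≤ n) (a : Fin n → ℕ → ℝ) (ha : ∀ j k, 0 ≤ a j k) (η : ℝ)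
    (hη : ∀ j k, a j k ≤ η) (hη0 : 0 ≤ η) (m : ℕ → ℤ) (c : ℤ) (hm : ∀ k, m k = c ∨ m k = c + 1)
    (hJ : cyJ M m ≤ 2 * n - 2) :
    ∃ m' : ℕ → ℤ, (∀ k, m' k = c / 2 ∨ m' k = c / 2 + 1) ∧ cyJ M m' ≤ 2 * n - 2 ∧
      ∀ j, |∑ k ∈ Finset.range (M + 1), (m' k : ℝ) * a j k -
        (∑ k ∈ Finset.range (M + 1), (m k : ℝ) * a j k) / 2| ≤ n * η := by
  obtain ⟨e, he, hE1, hE2, herr⟩ := cyE_eps n M (fun j k => ((m k % 2 : ℤ) : ℝ) * a j k)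
    (fun j k => mul_nonneg (by exact_mod_cast Int.emod_nonneg _ (by norm_num)) (ha j k)) η
    (fun j k => by
      have := hη j k
      rcases Int.emod_two_eq_zero_or_one (m k) with h | h <;> simp [h, hη0, this]) hη0 m
  let mp : ℤ → ℕ → ℤ := fun σ k => (m k + σ * e k * (m k % 2)) / 2
  have hσ : ∀ σ : ℤ, (σ = 1 ∨ σ = -1) → ∀ k, σ * e k = 1 ∨ σ * e k = -1 := by
    intro σ h k; rcases h with h | h <;> rcases he k with h' | h' <;> simp [h, h']
  have hval : ∀ σ : ℤ, (σ = 1 ∨ σ = -1) → ∀ k, mp σ k = c / 2 ∨ mp σ k = c / 2 + 1 := by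
    intro σ h k
    simp only [mp]
    rcases hσ σ h k with h' | h' <;> rw [h'] <;> rcases hm k with h'' | h'' <;> rw [h''] <;> omega
  have hdouble : ∀ σ : ℤ, (σ = 1 ∨ σ = -1) → ∀ k, 2 * mp σ k = m k + σ * e k * (m k % 2) := by
    intro σ h k
    simp only [mp]
    rcases hσ σ h k with h' | h' <;> rw [h'] <;> omega
  have hsum : cyJ M (mp 1) + cyJ M (mp (-1)) ≤ cyJ M m + 2 * cyE M m e := by
    unfold cyJ cyE
    rw [← Finset.sum_add_distrib, Finset.mul_sum, ← Finset.sum_add_distrib]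
    apply Finset.sum_le_sum
    intro k _
    generalize cyN M k = k'
    have h1 := hm k
    have h2 := hm k'
    have d1 := hdouble 1 (by simp) k
    have d2 := hdouble 1 (by simp) k'
    have d3 := hdouble (-1) (by simp) k
    have d4 := hdouble (-1) (by simp) k'
    clear_value mp
    rcases he k with h | h <;> rcases he k' with h' | h' <;> rw [h] at d1 d3 <;> rw [h'] at d2 d4 <;>
      rw [h, h'] <;> by_cases hmm : m k = m k' <;> simp [hmm] <;> (try split_ifs) <;> omega
  have herr' : ∀ σ : ℤ, (σ = 1 ∨ σ = -1) → ∀ j, |∑ k ∈ Finset.range (M + 1), (mp σ k : ℝ) * a j k -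
        (∑ k ∈ Finset.range (M + 1), (m k : ℝ) * a j k) / 2| ≤ n * η := by
    intro σ h j
    have e1 : ∑ k ∈ Finset.range (M + 1), (mp σ k : ℝ) * a j k -
        (∑ k ∈ Finset.range (M + 1), (m k : ℝ) * a j k) / 2 = 
        σ / 2 * ∑ k ∈ Finset.range (M + 1), (e k : ℝ) * (((m k % 2 : ℤ) : ℝ) * a j k) := by
      rw [Finset.mul_sum, Finset.sum_div, ← Finset.sum_sub_distrib]
      apply Finset.sum_congr rfl
      intro k _
      have : (2 : ℝ) * mp σ k = m k + σ * e k * ((m k % 2 : ℤ) : ℝ) := by exact_mod_cast hdouble σ h k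
      linear_combination (a j k / 2) * this
    have e2 : |(σ : ℝ) / 2| = 1 / 2 := by
      rcases h with h | h <;> simp [h, abs_div]
    rw [e1, abs_mul, e2]
    have := herr j
    linarith
  have ev1 := cyJ_even M (mp 1) _ _ (hval 1 (by simp))
  have ev2 := cyJ_even M (mp (-1)) _ _ (hval (-1) (by simp))
  have : cyJ M (mp 1) ≤ 2 * n - 2 ∨ cyJ M (mp (-1)) ≤ 2 * n - 2 := by
    rcases ev1 with ⟨x, hx⟩
    rcases ev2 with ⟨y, hy⟩
    by_cases h0 : 0 < cyJ M m
    · have := hE2 h0; omega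
    · omega
  rcases this with h | h
  · exact ⟨mp 1, hval 1 (by simp), h, herr' 1 (by simp)⟩
  · exact ⟨mp (-1), hval (-1) (by simp), h, herr' (-1) (by simp)⟩

lemma sw_iter (n M : ℕ) (hn : 2 ≤ n) (a : Fin n → ℕ → ℝ) (ha : ∀ j k, 0 ≤ a j k) (η : ℝ)
    (hη : ∀ j k, a j k ≤ η) (hη0 : 0 ≤ η) (c : ℤ) (t : ℕ) :
    ∃ m : ℕ → ℤ, (∀ k, m k = c / 2 ^ t ∨ m k = c / 2 ^ t + 1) ∧ cyJ M m ≤ 2 * n - 2 ∧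
      ∀ j, |∑ k ∈ Finset.range (M + 1), (m k : ℝ) * a j k -
        (c / 2 ^ t : ℝ) * ∑ k ∈ Finset.range (M + 1), a j k| ≤ 2 * n * η := by
  induction t with
  | zero =>
    refine ⟨fun _ => c, by simp, by simp [cyJ], fun j => ?_⟩
    rw [← Finset.mul_sum]
    simp
    positivity
  | succ t ih =>
    obtain ⟨m, h1, h2, h3⟩ := ih
    obtain ⟨m', h1', h2', h3'⟩ := sw_step n M hn a ha η hη hη0 m _ h1 h2
    refine ⟨m', ?_, h2', fun j => ?_⟩
    · rw [pow_succ, ← Int.ediv_ediv_of_nonneg (by positivity)]; exact h1'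
    · have e1 := h3 j
      have e2 := h3' j
      rw [abs_le] at e1 e2 ⊢
      have : (c / 2 ^ (t + 1) : ℝ) = (c / 2 ^ t) / 2 := by rw [pow_succ]; field_simp
      rw [this]
      constructor <;> linarith [e1.1, e1.2, e2.1, e2.2]

lemma sw_discrete (n M : ℕ) (hn : 2 ≤ n) (a : Fin n → ℕ → ℝ) (ha : ∀ j k, 0 ≤ a j k) (η : ℝ)
    (hη : ∀ j k, a j k ≤ η) (hη0 : 0 < η) (r : ℝ) (hr0 : 0 ≤ r) (hr1 : r < 1) :
    ∃ m : ℕ → ℤ, (∀ k, m k = 0 ∨ m k = 1) ∧ cyI M m ≤ 2 * n - 2 ∧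
      ∀ j, |∑ k ∈ Finset.range (M + 1), (m k : ℝ) * a j k -
        r * ∑ k ∈ Finset.range (M + 1), a j k| ≤ (2 * n + 1) * η := by
  obtain ⟨t, ht⟩ := pow_unbounded_of_one_lt ((M + 1 : ℝ)) (by norm_num : (1 : ℝ) < 2)
  obtain ⟨m, h1, h2, h3⟩ := sw_iter n M hn a ha η hη hη0.le ⌊r * 2 ^ t⌋ t
  have hp : (0 : ℝ) < 2 ^ t := by positivity
  have f1 := Int.floor_le (r * 2 ^ t)
  have f2 := Int.lt_floor_add_one (r * 2 ^ t)
  have f0 : 0 ≤ ⌊r * 2 ^ t⌋ := Int.floor_nonneg.2 (by positivity)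
  have f3 : ⌊r * 2 ^ t⌋ < 2 ^ t := by
    rw [Int.floor_lt]; push_cast; nlinarith
  have hz : ⌊r * 2 ^ t⌋ / 2 ^ t = 0 := Int.ediv_eq_zero_of_lt f0 f3
  refine ⟨m, ?_, ?_, fun j => ?_⟩
  · simpa [hz] using h1
  · rw [cyJ_eq] at h2; omega
  · set A := ∑ k ∈ Finset.range (M + 1), a j k with hA
    have hA0 : 0 ≤ A := Finset.sum_nonneg fun k _ => ha j k
    have hA1 : A ≤ (M + 1) * η := by
      calc A ≤ ∑ k ∈ Finset.range (M + 1), η := Finset.sum_le_sum fun k _ => hη j k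
        _ = _ := by simp
    have hA2 : A ≤ 2 ^ t * η := by nlinarith
    have g1 : r - (⌊r * 2 ^ t⌋ / 2 ^ t : ℝ) ≤ 1 / 2 ^ t := by
      rw [sub_le_iff_le_add, ← add_div, le_div_iff₀ hp]; linarith
    have g2 : (⌊r * 2 ^ t⌋ / 2 ^ t : ℝ) ≤ r := by
      rw [div_le_iff₀ hp]; exact f1
    have g3 : (r - (⌊r * 2 ^ t⌋ / 2 ^ t : ℝ)) * A ≤ η := by
      calc _ ≤ 1 / 2 ^ t * (2 ^ t * η) := by gcongr; 
        _ = η := by field_simp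
    have g4 : 0 ≤ (r - (⌊r * 2 ^ t⌋ / 2 ^ t : ℝ)) * A := mul_nonneg (by linarith) hA0
    have := h3 j
    rw [abs_le] at this ⊢
    constructor <;> nlinarith [this.1, this.2]

noncomputable def swN {p : ℕ} (t : Fin p → ℝ) (x : ℝ) : ℕ := ∑ l, if t l ≤ x then 1 else 0

def swU {p : ℕ} (b : ℕ) (t : Fin p → ℝ) : Set ℝ := {x | Odd (swN t x + b)}

lemma swN_mono {p : ℕ} (t : Fin p → ℝ) : Monotone (swN t) := by
  intro x y h
  unfold swN
  apply Finset.sum_le_sum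
  intro l _
  split_ifs with h1 h2 <;> first | omega | (exact absurd (h1.trans h) h2)

lemma swN_le {p : ℕ} (t : Fin p → ℝ) (x : ℝ) : swN t x ≤ p := by
  unfold swN
  calc _ ≤ ∑ l : Fin p, 1 := by
        apply Finset.sum_le_sum
        intro l _
        split_ifs <;> omega
    _ = p := by simp

lemma swU_meas {p : ℕ} (b : ℕ) (t : Fin p → ℝ) : MeasurableSet (swU b t) :=
  (swN_mono t).measurable (MeasurableSet.of_discrete (s := {k | Odd (k + b)}))

lemma swU_cont {p : ℕ} (b : ℕ) (ν : Measure ℝ) [IsFiniteMeasure ν] (h : ν ≪ volume) :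
    Continuous (fun t : Fin p → ℝ => ν.real (swU b t)) := by
  rw [continuous_iff_continuousAt]
  intro t
  have key : Filter.Tendsto (fun t' : Fin p → ℝ => ν (swU b t')) (nhds t) (nhds (ν (swU b t))) := by
    apply tendsto_measure_of_ae_tendsto_indicator_of_isFiniteMeasure _ (swU_meas b t) (fun _ => swU_meas b _)
    have h0 : ν (range t) = 0 := h ((finite_range t).measure_zero volume)
    filter_upwards [measure_eq_zero_iff_ae_notMem.1 h0] with x hx
    have : ∀ l, ∀ᶠ t' : Fin p → ℝ in nhds t, (t' l ≤ x ↔ t l ≤ x) := by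
      intro l
      have hl : t l ≠ x := fun hh => hx ⟨l, hh⟩
      have hc : Filter.Tendsto (fun t' : Fin p → ℝ => t' l) (nhds t) (nhds (t l)) :=
        (continuous_apply l).continuousAt
      rcases lt_or_gt_of_ne hl with hl | hl
      · filter_upwards [hc.eventually_lt_const hl] with t' ht'
        simp [hl.le, ht'.le]
      · filter_upwards [hc.eventually_const_lt hl] with t' ht'
        exact ⟨fun h => absurd h (not_le.2 ht'), fun h => absurd h (not_le.2 hl)⟩
    filter_upwards [Filter.eventually_all.2 this] with t' ht'
    simp only [swU, swN, mem_ofPred_eq, ht']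
  exact (ENNReal.tendsto_toReal (measure_ne_top _ _)).comp key

lemma sw_pad (g : ℕ → ℝ) (p : ℕ) : ∀ (S : Finset ℕ), S.card ≤ p → (∀ k ∈ S, g k ∈ Icc (0:ℝ) 1) →
    ∃ t : Fin p → ℝ, (∀ l, t l ∈ Icc (0:ℝ) 1) ∧
      ∀ x < 1, swN t x = ∑ k ∈ S, if g k ≤ x then 1 else 0 := by
  induction p with
  | zero =>
    intro S hS _
    have : S = ∅ := by simpa using hS
    subst this
    exact ⟨fun _ => 0, fun l => l.elim0, fun x _ => by simp [swN]⟩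
  | succ p ih =>
    intro S hS hg
    rcases S.eq_empty_or_nonempty with rfl | ⟨s, hs⟩
    · exact ⟨fun _ => 1, fun _ => by simp, fun x hx => by simp [swN, hx]⟩
    · obtain ⟨t, ht, h⟩ := ih (S.erase s) (by rw [Finset.card_erase_of_mem hs]; omega)
        (fun k hk => hg k (Finset.mem_of_mem_erase hk))
      refine ⟨Fin.cons (g s) t, ?_, fun x hx => ?_⟩
      · intro l
        refine Fin.cases ?_ ?_ l
        · simpa using hg s hs
        · intro l; simpa using ht l
      · have := h x hx
        unfold swN at this ⊢
        rw [Fin.sum_univ_succ, ← Finset.add_sum_erase S _ hs]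
        simp only [Fin.cons_zero, Fin.cons_succ, this]

lemma sw_small (ν : Measure ℝ) [IsFiniteMeasure ν] (h : ν ≪ volume) (η : ℝ) (hη : 0 < η) :
    ∃ M0 : ℕ, ∀ M ≥ M0, ∀ k : ℕ, ν.real (Ico ((k : ℝ) / (M + 1)) ((k + 1 : ℝ) / (M + 1))) ≤ η := by
  obtain ⟨δ, hδ, H⟩ := exists_pos_setLIntegral_lt_of_measure_lt
    (Measure.lintegral_rnDeriv_lt_top ν volume).ne (ε := ENNReal.ofReal η) (by simpa using hη)
  obtain ⟨M0, hM0⟩ := ENNReal.exists_inv_nat_lt hδ.ne'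
  refine ⟨M0, fun M hM k => ?_⟩
  have := H (Ico ((k : ℝ) / (M + 1)) ((k + 1 : ℝ) / (M + 1))) ?_
  · rw [Measure.setLIntegral_rnDeriv h] at this
    exact ENNReal.toReal_le_of_le_ofReal hη.le this.le
  · refine lt_of_le_of_lt ?_ hM0
    rw [Real.volume_Ico]
    have e : ((k + 1 : ℝ) / (M + 1)) - ((k : ℝ) / (M + 1)) = ((M + 1 : ℕ) : ℝ)⁻¹ := by
      push_cast; field_simp; ring
    rw [e, ENNReal.ofReal_inv_of_pos (by positivity), ENNReal.ofReal_natCast]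
    apply ENNReal.inv_le_inv.2
    exact_mod_cast (by omega : M0 ≤ M + 1)

lemma sw_grid (ν : Measure ℝ) [IsFiniteMeasure ν] (U : Set ℝ) (hU : MeasurableSet U) (D : ℝ) (hD : 0 < D)
    (K : ℕ) :
    ∑ k ∈ Finset.range K, ν.real (U ∩ Ico ((k : ℝ) / D) ((k + 1 : ℝ) / D)) = ν.real (U ∩ Ico 0 (K / D)) := by
  induction K with
  | zero => simp
  | succ K ih =>
    rw [Finset.sum_range_succ, ih, ← measureReal_union, ← inter_union_distrib_left,
      Ico_union_Ico_eq_Ico (by positivity) (by gcongr; linarith)]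
    · push_cast; rfl
    · apply Disjoint.mono inter_subset_right inter_subset_right
      rw [Set.disjoint_left]
      intro x hx hx'
      exact absurd hx.2 (not_lt.2 hx'.1)
    · exact hU.inter measurableSet_Ico

lemma sw_approx (n : ℕ) (hn : 2 ≤ n) (ν : Fin n → Measure ℝ) [∀ i, IsFiniteMeasure (ν i)]
    (hac : ∀ i, ν i ≪ volume) (hsupp : ∀ i, ν i (Icc (0:ℝ) 1)ᶜ = 0) (r : ℝ) (hr0 : 0 ≤ r) (hr1 : r < 1)
    (η : ℝ) (hη : 0 < η) :
    ∃ (t : Fin (2 * n - 2) → ℝ) (b : ℕ), b < 2 ∧ (∀ l, t l ∈ Icc (0:ℝ) 1) ∧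
      ∀ i, |(ν i).real (swU b t) - r * (ν i).real univ| ≤ (2 * n + 1) * η := by
  choose M0 hM0 using fun i => sw_small (ν i) (hac i) η hη
  let M := Finset.univ.sup M0
  have hM : ∀ i k, (ν i).real (Ico ((k : ℕ) / (M + 1) : ℝ) ((k + 1 : ℝ) / (M + 1))) ≤ η := fun i k =>
    hM0 i M (Finset.le_sup (Finset.mem_univ i)) k
  have hMp : (0 : ℝ) < M + 1 := by positivity
  have null : ∀ i (A : Set ℝ), MeasurableSet A → ∑ k ∈ Finset.range (M + 1), (ν i).real (A ∩ Ico ((k : ℝ) / (M + 1)) ((k + 1 : ℝ) / (M + 1))) = (ν i).real A := by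
    intro i A hA
    rw [sw_grid (ν i) A hA (M + 1) hMp]
    have : ((M + 1 : ℕ) : ℝ) / (M + 1) = 1 := by push_cast; field_simp
    rw [this]
    apply measureReal_congr
    have h1 : ν i {1} = 0 := hac i (by simp)
    filter_upwards [measure_eq_zero_iff_ae_notMem.1 h1, measure_eq_zero_iff_ae_notMem.1 (hsupp i)] with x hx hx'
    simp only [mem_compl_iff, not_not, mem_singleton_iff] at hx hx'
    have : x ∈ Ico (0 : ℝ) 1 := ⟨hx'.1, lt_of_le_of_ne hx'.2 hx⟩
    exact propext ⟨fun h => h.1, fun h => ⟨h, this⟩⟩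
  obtain ⟨m, hm, hI, herr⟩ := sw_discrete n M hn
    (fun i k => (ν i).real (Ico ((k : ℕ) / (M + 1) : ℝ) ((k + 1 : ℝ) / (M + 1))))
    (fun _ _ => measureReal_nonneg) η hM hη r hr0 hr1
  obtain ⟨t, ht, htN⟩ := sw_pad (fun k => (k + 1 : ℝ) / (M + 1)) (2 * n - 2)
    ((Finset.range M).filter (fun k => m k ≠ m (k + 1))) hI (by
      intro k hk
      simp only [Finset.mem_filter, Finset.mem_range] at hk
      refine ⟨by positivity, ?_⟩
      rw [div_le_one hMp]
      exact_mod_cast (by omega : k + 1 ≤ M + 1))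
  have hcell : ∀ k ∈ Finset.range (M + 1), ∀ x ∈ Ico ((k : ℝ) / (M + 1)) ((k + 1 : ℝ) / (M + 1)),
      swN t x = cyI k m := by
    intro k hk x hx
    have hkM : k ≤ M := by simp at hk; omega
    have hx1 : x < 1 := by
      refine lt_of_lt_of_le hx.2 ?_
      rw [div_le_one hMp]; exact_mod_cast (by omega : k + 1 ≤ M + 1)
    rw [htN x hx1, ← Finset.card_filter, Finset.filter_filter]
    unfold cyI
    congr 1
    ext k'
    simp only [Finset.mem_filter, Finset.mem_range]
    have : ((k' + 1 : ℝ) / (M + 1) ≤ x) ↔ k' < k := by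
      constructor
      · intro h
        have h2 := lt_of_le_of_lt h hx.2
        rw [div_lt_div_iff_of_pos_right hMp] at h2
        have : (k' : ℝ) < k := by linarith
        exact_mod_cast this
      · intro h
        refine le_trans ?_ hx.1
        gcongr
        exact_mod_cast h
    rw [this]
    constructor
    · rintro ⟨_, h1, h2⟩; exact ⟨h2, h1⟩
    · rintro ⟨h1, h2⟩; exact ⟨by omega, h2, h1⟩
  obtain ⟨b, hb2, hb⟩ : ∃ b : ℕ, b < 2 ∧ (b : ℤ) = m 0 := by
    rcases hm 0 with h | h
    · exact ⟨0, by omega, by simp [h]⟩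
    · exact ⟨1, by omega, by simp [h]⟩
  refine ⟨t, b, hb2, ht, fun i => ?_⟩
  have e1 : (ν i).real (swU b t) = ∑ k ∈ Finset.range (M + 1), (m k : ℝ) * (ν i).real (Ico ((k : ℕ) / (M + 1) : ℝ) ((k + 1 : ℝ) / (M + 1))) := by
    rw [← null i _ (swU_meas b t)]
    apply Finset.sum_congr rfl
    intro k hk
    have hE := cyI_even k m 0 1 hm
    have hmem : ∀ x ∈ Ico ((k : ℝ) / (M + 1)) ((k + 1 : ℝ) / (M + 1)), (x ∈ swU b t ↔ m k = 1) := by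
      intro x hx
      simp only [swU, mem_ofPred_eq, hcell k hk x hx]
      rw [Nat.odd_iff]
      rw [Nat.even_iff] at hE
      have := hm k
      omega
    rcases hm k with h | h
    · rw [h]
      have : swU b t ∩ Ico ((k : ℝ) / (M + 1)) ((k + 1 : ℝ) / (M + 1)) = ∅ := by
        ext x
        simp only [mem_inter_iff, mem_empty_iff_false, iff_false]
        rintro ⟨h1, h2⟩
        have := (hmem x h2).1 h1
        omega
      rw [this]; simp
    · rw [h]
      have : swU b t ∩ Ico ((k : ℝ) / (M + 1)) ((k + 1 : ℝ) / (M + 1)) = Ico ((k : ℝ) / (M + 1)) ((k + 1 : ℝ) / (M + 1)) := by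
        rw [inter_eq_right]
        intro x hx
        exact (hmem x hx).2 h
      rw [this]; simp
  have e2 := null i univ MeasurableSet.univ
  simp only [univ_inter] at e2
  rw [e1, ← e2]
  exact herr i

lemma sw_exact (n : ℕ) (hn : 2 ≤ n) (ν : Fin n → Measure ℝ) [∀ i, IsFiniteMeasure (ν i)]
    (hac : ∀ i, ν i ≪ volume) (hsupp : ∀ i, ν i (Icc (0:ℝ) 1)ᶜ = 0) (r : ℝ) (hr0 : 0 ≤ r) (hr1 : r < 1) :
    ∃ (t : Fin (2 * n - 2) → ℝ) (b : ℕ), 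
      ∀ i, (ν i).real (swU b t) = r * (ν i).real univ := by
  let h : ℕ → (Fin (2 * n - 2) → ℝ) → ℝ := fun b t => ∑ i, |(ν i).real (swU b t) - r * (ν i).real univ|
  have hc : ∀ b, Continuous (h b) := by
    intro b
    refine continuous_finsetSum _ fun i _ => ?_
    exact ((swU_cont b (ν i) (hac i)).sub continuous_const).abs
  have h0 : ∀ b t, 0 ≤ h b t := fun b t => Finset.sum_nonneg fun _ _ => abs_nonneg _
  have hK : IsCompact (univ.pi fun _ : Fin (2 * n - 2) => Icc (0:ℝ) 1) :=
    isCompact_univ_pi fun _ => isCompact_Icc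
  obtain ⟨t, htK, hmin⟩ := hK.exists_isMinOn ⟨fun _ => 0, fun _ _ => ⟨le_refl _, zero_le_one⟩⟩
    (((hc 0).min (hc 1)).continuousOn)
  have hz : min (h 0 t) (h 1 t) ≤ 0 := by
    apply le_of_forall_pos_le_add
    intro ε hε
    rw [zero_add]
    have hnp : (0 : ℝ) < n * (2 * n + 1) := by
      have : (0 : ℝ) < n := by exact_mod_cast (by omega : 0 < n)
      positivity
    obtain ⟨t', b, hb, ht', H⟩ := sw_approx n hn ν hac hsupp r hr0 hr1 (ε / (n * (2 * n + 1))) (by positivity)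
    have h1 : h b t' ≤ ε := by
      calc h b t' ≤ ∑ i : Fin n, (2 * n + 1) * (ε / (n * (2 * n + 1))) := Finset.sum_le_sum fun i _ => H i
        _ = (n * (2 * n + 1)) * (ε / (n * (2 * n + 1))) := by simp; ring
        _ = ε := by field_simp
    have h2 : min (h 0 t) (h 1 t) ≤ min (h 0 t') (h 1 t') := hmin (fun l _ => ht' l)
    refine h2.trans (le_trans ?_ h1)
    interval_cases b
    · exact min_le_left _ _
    · exact min_le_right _ _
  have : ∃ b, h b t ≤ 0 := by
    rcases min_le_iff.1 hz with h | h
    · exact ⟨0, h⟩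
    · exact ⟨1, h⟩
  obtain ⟨b, hb⟩ := this
  refine ⟨t, b, fun i => ?_⟩
  have := (Finset.sum_eq_zero_iff_of_nonneg (fun _ _ => abs_nonneg _)).1 (le_antisymm hb (h0 b t)) i (Finset.mem_univ i)
  rw [abs_eq_zero] at this
  linarith

lemma sw_final {ι : Type*} [Fintype ι] (hn : 2 ≤ Fintype.card ι) (ν : ι → Measure ℝ) [∀ i, IsFiniteMeasure (ν i)]
    (hac : ∀ i, ν i ≪ volume) (hsupp : ∀ i, ν i (Icc (0:ℝ) 1)ᶜ = 0) (r : ℝ) (hr0 : 0 ≤ r) (hr1 : r < 1) :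
    ∃ (φ : ℝ → ℕ) (P : ℕ → Prop), Monotone φ ∧ (∀ x, φ x ≤ 2 * Fintype.card ι - 2) ∧
      ∀ i, (ν i).real {x | P (φ x)} = r * (ν i).real univ := by
  let e := Fintype.equivFin ι
  obtain ⟨t, b, H⟩ := sw_exact _ hn (fun i => ν (e.symm i)) (fun i => hac _) (fun i => hsupp _) r hr0 hr1
  refine ⟨swN t, fun k => Odd (k + b), swN_mono t, swN_le t, fun i => ?_⟩
  have := H (e i)
  simp only [e, Equiv.symm_apply_apply] at this
  exact this

lemma step_meas {k : ℕ} (φ : ℝ → ℕ) (hφ : Monotone φ) (F : ℝ → Fin k) (hF : ∀ x y, φ x = φ y → F x = F y)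
    (j : Fin k) : MeasurableSet {x | F x = j} := by
  have : {x | F x = j} = φ ⁻¹' (φ '' {x | F x = j}) := by
    ext x
    constructor
    · intro h; exact ⟨x, h, rfl⟩
    · rintro ⟨y, hy, hxy⟩
      have : F y = F x := hF _ _ hxy
      exact this.symm.trans hy
  rw [this]
  exact hφ.measurable (MeasurableSet.of_discrete)

lemma fair_rec {n k : ℕ} (V : Fin n → Measure ℝ) [∀ i, IsFiniteMeasure (V i)]
    (hac : ∀ i, V i ≪ volume) (hsupp : ∀ i, V i (Icc (0:ℝ) 1)ᶜ = 0)
    (f : Fin n → Fin k) (w : Fin k → ℝ) (hw : ∀ j, 0 < w j) (s : ℕ) :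
    ∀ S : Finset (Fin k), S.card = s → S.Nonempty → ∀ C : Set ℝ, MeasurableSet C →
    ∃ (φ : ℝ → ℕ) (F : ℝ → Fin k), Monotone φ ∧
      (∀ x, φ x ≤ Nat.clog 2 S.card * (2 * (Finset.univ.filter fun i => f i ∈ S).card - 2)) ∧
      (∀ x y, φ x = φ y → F x = F y) ∧ (∀ x, F x ∈ S) ∧
      ∀ i, f i ∈ S → w (f i) * (V i).real C ≤ (∑ j ∈ S, w j) * (V i).real (C ∩ {x | F x = f i}) := by
  induction s using Nat.strong_induction_on with
  | _ s ih =>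
  intro S hs hne C hC
  by_cases hone : ∃ j0 ∈ S, ∀ i, f i ∈ S → f i = j0
  · obtain ⟨j0, hj0, h⟩ := hone
    refine ⟨fun _ => 0, fun _ => j0, monotone_const, fun _ => Nat.zero_le _, fun _ _ _ => rfl, fun _ => hj0, ?_⟩
    intro i hi
    have e := h i hi
    have : w (f i) ≤ ∑ j ∈ S, w j := Finset.single_le_sum (fun j _ => (hw j).le) hi
    simp only [← e, Set.ofPred_true, inter_univ]
    exact mul_le_mul_of_nonneg_right this measureReal_nonneg
  push Not at hone
  have hs2 : 2 ≤ s := by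
    by_contra hlt
    have : S.card = 1 := by have := hne.card_pos; omega
    obtain ⟨j0, rfl⟩ := Finset.card_eq_one.1 this
    obtain ⟨i, hi, hi'⟩ := hone j0 (by simp)
    exact hi' (by simpa using hi)
  obtain ⟨S1, hS1, hc1⟩ := Finset.exists_subset_card_eq (s := S) (n := (s + 1) / 2) (by omega)
  obtain ⟨S2, hS2def⟩ : ∃ S2, S2 = S \ S1 := ⟨_, rfl⟩
  have hS2 : S2 ⊆ S := by rw [hS2def]; exact Finset.sdiff_subset
  have hc2 : S2.card = s - (s + 1) / 2 := by rw [hS2def, Finset.card_sdiff_of_subset hS1]; omega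
  have hcover : ∀ j ∈ S, j ∈ S1 ∨ j ∈ S2 := by
    intro j hj; rw [hS2def, Finset.mem_sdiff]; tauto
  have hdisj : ∀ j ∈ S1, j ∉ S2 := by
    intro j hj; rw [hS2def, Finset.mem_sdiff]; tauto
  have hne1 : S1.Nonempty := Finset.card_pos.1 (by omega)
  have hne2 : S2.Nonempty := Finset.card_pos.1 (by omega)
  obtain ⟨c, hcdef⟩ : ∃ c, c = Nat.clog 2 ((s + 1) / 2) := ⟨_, rfl⟩
  have hclog : Nat.clog 2 S.card = c + 1 := by
    rw [hs, Nat.clog_of_two_le (by norm_num) hs2, hcdef]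
    rfl
  have hcl1 : Nat.clog 2 S1.card = c := by rw [hc1, hcdef]
  have hcl2 : Nat.clog 2 S2.card ≤ c := by
    rw [hcdef]; apply Nat.clog_mono_right; omega
  have hW : ∑ j ∈ S1, w j + ∑ j ∈ S2, w j = ∑ j ∈ S, w j := by
    rw [hS2def, add_comm]; exact Finset.sum_sdiff hS1
  have hW1 : 0 < ∑ j ∈ S1, w j := Finset.sum_pos (fun j _ => hw j) hne1
  have hW2 : 0 < ∑ j ∈ S2, w j := Finset.sum_pos (fun j _ => hw j) hne2
  -- one side has no agents
  have hempty : ∀ T : Finset (Fin k), T ⊆ S → T.card < s → T.Nonempty → Nat.clog 2 T.card ≤ c →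
      (∀ i, f i ∈ S → f i ∈ T) → ∃ (φ : ℝ → ℕ) (F : ℝ → Fin k), Monotone φ ∧
      (∀ x, φ x ≤ Nat.clog 2 S.card * (2 * (Finset.univ.filter fun i => f i ∈ S).card - 2)) ∧
      (∀ x y, φ x = φ y → F x = F y) ∧ (∀ x, F x ∈ S) ∧
      ∀ i, f i ∈ S → w (f i) * (V i).real C ≤ (∑ j ∈ S, w j) * (V i).real (C ∩ {x | F x = f i}) := by
    intro T hT hTs hTne hTc hTS
    obtain ⟨φ, F, g1, g2, g3, g4, g5⟩ := ih T.card hTs T rfl hTne C hC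
    refine ⟨φ, F, g1, fun x => (g2 x).trans ?_, g3, fun x => hT (g4 x), fun i hi => ?_⟩
    · rw [hclog]
      have : (Finset.univ.filter fun i => f i ∈ T).card ≤ (Finset.univ.filter fun i => f i ∈ S).card := by
        apply Finset.card_le_card
        intro i; simp only [Finset.mem_filter]; exact fun h => ⟨h.1, hT h.2⟩
      exact Nat.mul_le_mul (by omega) (by omega)
    · refine (g5 i (hTS i hi)).trans ?_
      exact mul_le_mul_of_nonneg_right (Finset.sum_le_sum_of_subset_of_nonneg hT (fun j _ _ => (hw j).le))
        measureReal_nonneg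
  by_cases he2 : ∀ i, f i ∈ S → f i ∈ S1
  · exact hempty S1 hS1 (by omega) hne1 hcl1.le he2
  by_cases he1 : ∀ i, f i ∈ S → f i ∈ S2
  · exact hempty S2 hS2 (by omega) hne2 hcl2 he1
  push Not at he1 he2
  obtain ⟨n1, hn1⟩ : ∃ n1, n1 = (Finset.univ.filter fun i => f i ∈ S1).card := ⟨_, rfl⟩
  obtain ⟨n2, hn2⟩ : ∃ n2, n2 = (Finset.univ.filter fun i => f i ∈ S2).card := ⟨_, rfl⟩
  have hn1p : 0 < n1 := by
    obtain ⟨i, hi, hi'⟩ := he1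
    rw [hn1]; exact Finset.card_pos.2 ⟨i, by simpa using (hcover _ hi).resolve_right hi'⟩
  have hn2p : 0 < n2 := by
    obtain ⟨i, hi, hi'⟩ := he2
    rw [hn2]; exact Finset.card_pos.2 ⟨i, by simpa using (hcover _ hi).resolve_left hi'⟩
  have hnS : (Finset.univ.filter fun i => f i ∈ S).card = n1 + n2 := by
    rw [hn1, hn2, ← Finset.card_union_of_disjoint]
    · congr 1
      ext i
      simp only [Finset.mem_filter, Finset.mem_union, Finset.mem_univ, true_and]
      exact ⟨fun h => hcover _ h, fun h => h.elim (fun h => hS1 h) (fun h => hS2 h)⟩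
    · rw [Finset.disjoint_left]
      intro i; simp only [Finset.mem_filter, Finset.mem_univ, true_and]; exact hdisj _
  have hcard : Fintype.card {i : Fin n // f i ∈ S} = n1 + n2 := by
    rw [Fintype.card_subtype, hnS]
  obtain ⟨W1, hW1d⟩ : ∃ W1, W1 = ∑ j ∈ S1, w j := ⟨_, rfl⟩
  obtain ⟨W2, hW2d⟩ : ∃ W2, W2 = ∑ j ∈ S2, w j := ⟨_, rfl⟩
  rw [← hW1d] at hW1 hW
  rw [← hW2d] at hW2 hW
  obtain ⟨φ0, P, a1, a2, a3⟩ := sw_final (ι := {i : Fin n // f i ∈ S}) (by omega)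
    (fun i => (V i).restrict C)
    (fun i => (Measure.absolutelyContinuous_of_le Measure.restrict_le_self).trans (hac i))
    (fun i => by
      have := Measure.restrict_le_self (μ := V i) (s := C) (Icc (0:ℝ) 1)ᶜ
      rw [hsupp] at this
      simpa using this) (W1 / (W1 + W2)) (by positivity)
      (by rw [div_lt_one (by positivity)]; linarith)
  have hU : MeasurableSet {x | P (φ0 x)} := a1.measurable (MeasurableSet.of_discrete (s := {c | P c}))
  obtain ⟨φ1, F1, b1, b2, b3, b4, b5⟩ := ih S1.card (by omega) S1 rfl hne1 (C ∩ {x | P (φ0 x)}) (hC.inter hU)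
  obtain ⟨φ2, F2, d1, d2, d3, d4, d5⟩ := ih S2.card (by omega) S2 rfl hne2 (C ∩ {x | P (φ0 x)}ᶜ) (hC.inter hU.compl)
  have hv : ∀ i, f i ∈ S → (V i).real (C ∩ {x | P (φ0 x)}) = W1 / (W1 + W2) * (V i).real C := by
    intro i hi
    have := a3 ⟨i, hi⟩
    simp only [measureReal_restrict_apply hU, measureReal_restrict_apply MeasurableSet.univ, univ_inter] at this
    rw [inter_comm]; exact this
  have hv2 : ∀ i, f i ∈ S → (V i).real (C ∩ {x | P (φ0 x)}ᶜ) = W2 / (W1 + W2) * (V i).real C := by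
    intro i hi
    have h1 := measureReal_inter_add_sdiff (μ := V i) (s := C) hU
    rw [hv i hi, sdiff_eq] at h1
    have : W1 / (W1 + W2) + W2 / (W1 + W2) = 1 := by field_simp
    linear_combination h1 - (V i).real C * this
  classical
  refine ⟨fun x => φ0 x + φ1 x + φ2 x, fun x => if P (φ0 x) then F1 x else F2 x, ?_, ?_, ?_, ?_, ?_⟩
  · exact (a1.add b1).add d1
  · intro x
    beta_reduce
    rw [hclog, hnS]
    have e0 := a2 x
    have e1 := b2 x
    have e2 := d2 x
    rw [hcard] at e0
    rw [hcl1, ← hn1] at e1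
    rw [← hn2] at e2
    have e2' : φ2 x ≤ c * (2 * n2 - 2) := e2.trans (Nat.mul_le_mul_right _ hcl2)
    have e3 : c * (2 * n1 - 2) + c * (2 * n2 - 2) ≤ c * (2 * (n1 + n2) - 2) := by
      rw [← mul_add]; exact Nat.mul_le_mul_left _ (by omega)
    rw [add_mul, one_mul]
    omega
  · have key : ∀ x y, x ≤ y → φ0 x + φ1 x + φ2 x = φ0 y + φ1 y + φ2 y →
        (if P (φ0 x) then F1 x else F2 x) = (if P (φ0 y) then F1 y else F2 y) := by
      intro x y hxy h
      have e0 := a1 hxy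
      have e1 := b1 hxy
      have e2 := d1 hxy
      have g0 : φ0 x = φ0 y := by omega
      rw [g0, b3 x y (by omega), d3 x y (by omega)]
    intro x y h
    rcases le_total x y with hxy | hxy
    · exact key x y hxy h
    · exact (key y x hxy h.symm).symm
  · intro x
    beta_reduce
    split_ifs
    · exact hS1 (b4 x)
    · exact hS2 (d4 x)
  · intro i hi
    rw [← hW]
    have hvC : 0 ≤ (V i).real C := measureReal_nonneg
    rcases hcover _ hi with h | h
    · have g := b5 i h
      rw [hv i hi, ← hW1d] at g
      have hm : (V i).real (C ∩ {x | P (φ0 x)} ∩ {x | F1 x = f i}) ≤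
          (V i).real (C ∩ {x | (if P (φ0 x) then F1 x else F2 x) = f i}) := by
        refine measureReal_mono ?_ (measure_ne_top _ _)
        rintro x ⟨⟨h1, h2⟩, h3⟩
        refine ⟨h1, ?_⟩
        simp only [mem_ofPred_eq] at h2 h3 ⊢
        rw [if_pos h2]; exact h3
      refine le_trans ?_ (mul_le_mul_of_nonneg_left hm (by positivity))
      generalize (V i).real (C ∩ {x | P (φ0 x)} ∩ {x | F1 x = f i}) = z at g
      have e : w (f i) * (W1 / (W1 + W2) * (V i).real C) = W1 * (w (f i) * (V i).real C / (W1 + W2)) := by ring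
      rw [e] at g
      have g' := le_of_mul_le_mul_left g hW1
      rw [div_le_iff₀ (by positivity)] at g'
      linarith
    · have g := d5 i h
      rw [hv2 i hi, ← hW2d] at g
      have hm : (V i).real (C ∩ {x | P (φ0 x)}ᶜ ∩ {x | F2 x = f i}) ≤
          (V i).real (C ∩ {x | (if P (φ0 x) then F1 x else F2 x) = f i}) := by
        refine measureReal_mono ?_ (measure_ne_top _ _)
        rintro x ⟨⟨h1, h2⟩, h3⟩
        refine ⟨h1, ?_⟩
        simp only [mem_compl_iff, mem_ofPred_eq] at h2 h3 ⊢
        rw [if_neg h2]; exact h3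
      refine le_trans ?_ (mul_le_mul_of_nonneg_left hm (by positivity))
      generalize (V i).real (C ∩ {x | P (φ0 x)}ᶜ ∩ {x | F2 x = f i}) = z at g
      have e : w (f i) * (W2 / (W1 + W2) * (V i).real C) = W2 * (w (f i) * (V i).real C / (W1 + W2)) := by ring
      rw [e] at g
      have g' := le_of_mul_le_mul_left g hW2
      rw [div_le_iff₀ (by positivity)] at g'
      linarith

/-- unanimous-proportional allocation with different entitlements,
using at most ceil(log2 k) * (2n-2) + 1 components. -/
theorem unanimous_proportional_entitlements_upper_bound
    (n k : ℕ) (hn : 1 ≤ n) (hk : 1 ≤ k)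
    (V : Fin n → Measure ℝ)
    (hprob : ∀ i, IsProbabilityMeasure (V i))
    (hsupp : ∀ i, V i (Icc (0:ℝ) 1) = 1)
    (hac : ∀ i, V i ≪ volume)
    (f : Fin n → Fin k)
    (w : Fin k → ℝ) (hw : ∀ j, 0 < w j) (hw1 : ∑ j, w j = 1) :
    ∃ (X : Fin k → Set ℝ) (m : Fin k → ℕ),
      (∀ j, IsUnionOfIntervals (X j) (m j)) ∧
      Pairwise (Function.onFun Disjoint X) ∧
      (⋃ j, X j) = Icc (0:ℝ) 1 ∧
      (∀ i : Fin n, (V i (X (f i))).toReal ≥ w (f i)) ∧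
      ∑ j, m j ≤ Nat.clog 2 k * (2 * n - 2) + 1 := by
  classical
  have hsupp' : ∀ i, V i (Icc (0:ℝ) 1)ᶜ = 0 := fun i =>
    (prob_compl_eq_zero_iff measurableSet_Icc).2 (hsupp i)
  obtain ⟨φ, F, h1, h2, h3, -, h5⟩ := fair_rec V hac hsupp' f w hw _ Finset.univ rfl
    ⟨⟨0, hk⟩, Finset.mem_univ _⟩ univ MeasurableSet.univ
  simp only [Finset.mem_univ, Finset.filter_true, Finset.card_univ, Fintype.card_fin, hw1,
    univ_inter, probReal_univ, mul_one, one_mul, true_implies] at h2 h5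
  obtain ⟨N, hN⟩ : ∃ N, N = Nat.clog 2 k * (2 * n - 2) := ⟨_, rfl⟩
  rw [← hN] at h2 ⊢
  obtain ⟨lab, hlab⟩ : ∃ lab : ℕ → Fin k, ∀ x, F x = lab (φ x) :=
    ⟨fun c => if h : ∃ y, φ y = c then F h.choose else ⟨0, hk⟩, fun x => by
      have h : ∃ y, φ y = φ x := ⟨x, rfl⟩
      beta_reduce
      rw [dif_pos h]
      exact h3 _ _ h.choose_spec.symm⟩
  let T : Fin k → Finset ℕ := fun j => (Finset.range (N + 1)).filter fun c => lab c = j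
  refine ⟨fun j => Icc (0:ℝ) 1 ∩ {x | F x = j}, fun j => (T j).card, ?_, ?_, ?_, ?_, ?_⟩
  · intro j
    refine ⟨fun l => Icc (0:ℝ) 1 ∩ φ ⁻¹' {((T j).equivFin.symm l : ℕ)}, fun l => ?_, ?_⟩
    · exact ordConnected_Icc.inter (ordConnected_singleton.preimage_mono h1)
    · ext x
      simp only [mem_inter_iff, mem_ofPred_eq, mem_iUnion, mem_preimage, mem_singleton_iff]
      constructor
      · rintro ⟨hx, hF⟩
        have hT : φ x ∈ T j := by
          simp only [T, Finset.mem_filter, Finset.mem_range]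
          exact ⟨Nat.lt_succ_of_le (h2 x), (hlab x).symm.trans hF⟩
        exact ⟨(T j).equivFin ⟨φ x, hT⟩, hx, by simp⟩
      · rintro ⟨l, hx, hl⟩
        refine ⟨hx, ?_⟩
        have := ((T j).equivFin.symm l).2
        rw [← hl] at this
        simp only [T, Finset.mem_filter] at this
        rw [hlab x, this.2]
  · intro j j' hjj
    simp only [Function.onFun]
    rw [Set.disjoint_left]
    rintro x ⟨_, hx⟩ ⟨_, hx'⟩
    exact hjj (hx.symm.trans hx')
  · ext x
    simp
  · intro i
    have e : V i (Icc (0:ℝ) 1 ∩ {x | F x = f i}) = V i {x | F x = f i} := by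
      apply measure_congr
      filter_upwards [measure_eq_zero_iff_ae_notMem.1 (hsupp' i)] with x hx
      simp only [mem_compl_iff, not_not] at hx
      exact propext ⟨fun h => h.2, fun h => ⟨hx, h⟩⟩
    rw [e]
    exact h5 i
  · rw [← Finset.card_eq_sum_card_fiberwise (f := lab) (s := Finset.range (N + 1)) (fun _ _ => Finset.mem_coe.2 (Finset.mem_univ _))]
    simp
end
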